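/- Let p ≡ 3 (mod 4), R = ℤ[√−p], and (V, φ) a positive-definite hermitian K-space of dimension n over K = ℚ(√−p) admitting a √−p-modular R-lattice (so that one of the conditions (a) p ≡ 7 (mod 8), 4|n, dφ=[1]; (b) p ≡ 3 (mod 8), 4|n, dφ=[1]; (c) p ≡ 3 (mod 8), n ≡ 2 (mod 4), dφ=[2] holds). Then two √−p-modular R-lattices in (V, φ) belong to the same genus if and only if their 2-adic completions are isometric as hermitian R⊗ℤ₂-lattices, and the number of genera of √−p-modular R-lattices in (V, φ) equals 3n/2 + 1 in case (a), n + 1 in case (b), and n/2 in case (c). -/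

import Mathlib

/-!
STATEMENT 14.  Let `p ≡ 3 (mod 4)`, `R = ℤ[√-p]`, and `(V, φ)` a positive-definite
hermitian `K`-space of dimension `n` over `K = ℚ(√-p)` admitting a `√-p`-modular
`R`-lattice, in one of the cases
(a) `p ≡ 7 (mod 8)`, `4 ∣ n`, `dφ = [1]`;
(b) `p ≡ 3 (mod 8)`, `4 ∣ n`, `dφ = [1]`;
(c) `p ≡ 3 (mod 8)`, `n ≡ 2 (mod 4)`, `dφ = [2]`.
Then two `√-p`-modular `R`-lattices in `(V, φ)` are in the same genus iff their 2-adic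
completions are isometric, and the number of genera of `√-p`-modular `R`-lattices in
`(V, φ)` is `3n/2 + 1` in case (a), `n + 1` in case (b), and `n/2` in case (c).
-/

open scoped TensorProduct

section Setup

variable (K : Type) [Field K] [Algebra ℚ K] (sp : K)
variable (V : Type) [AddCommGroup V] [Module ℚ V] [Module K V] [IsScalarTower ℚ K V]
variable (φ : V →ₗ[ℚ] V →ₗ[ℚ] K)

/-- Membership in the order `R = ℤ[√-p] = ℤ + ℤ·√-p ⊆ K`. -/
def Rmem (k : K) : Prop := ∃ a b : ℤ, k = (a : K) + (b : K) * sp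

/-- `L` is a `√-p`-modular `R`-lattice in `(V, φ)`. -/
def IsModularRLat (L : Submodule ℤ V) : Prop :=
  (∀ v ∈ L, sp • v ∈ L) ∧
  L.FG ∧
  Submodule.span K (L : Set V) = ⊤ ∧
  (∀ v : V, v ∈ L ↔ ∃ x : V, (∀ y ∈ L, Rmem K sp (φ x y)) ∧ v = sp • x)

/-- The base change of the hermitian form `φ` to `V_ℓ = ℚ_ℓ ⊗ V`, with values in
`K_ℓ = ℚ_ℓ ⊗ K`. -/
noncomputable def localForm (ℓ : ℕ) [Fact ℓ.Prime] :
    (ℚ_[ℓ] ⊗[ℚ] V) →ₗ[ℚ_[ℓ]] (ℚ_[ℓ] ⊗[ℚ] V) →ₗ[ℚ_[ℓ]] (ℚ_[ℓ] ⊗[ℚ] K) :=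
  LinearMap.liftBaseChange ℚ_[ℓ] ((LinearMap.baseChangeHom ℚ ℚ_[ℓ] V K) ∘ₗ φ)

/-- The action of a scalar `a : K` on the completion `V_ℓ = ℚ_ℓ ⊗ V`. -/
noncomputable def actK (ℓ : ℕ) [Fact ℓ.Prime] (a : K) :
    (ℚ_[ℓ] ⊗[ℚ] V) →ₗ[ℚ_[ℓ]] (ℚ_[ℓ] ⊗[ℚ] V) :=
  LinearMap.baseChange ℚ_[ℓ] (((LinearMap.lsmul K V) a).restrictScalars ℚ)

/-- The `ℓ`-adic completion `L ⊗ ℤ_ℓ` of a lattice `L ⊆ V`, realized as the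
`ℤ_ℓ`-span of (the image of) `L` inside `V_ℓ = ℚ_ℓ ⊗ V`. -/
noncomputable def latCompl (ℓ : ℕ) [Fact ℓ.Prime] (L : Submodule ℤ V) :
    Submodule ℤ_[ℓ] (ℚ_[ℓ] ⊗[ℚ] V) :=
  Submodule.span ℤ_[ℓ] ((fun v => (1 : ℚ_[ℓ]) ⊗ₜ[ℚ] v) '' (L : Set V))

/-- `L ⊗ ℤ_ℓ` and `L' ⊗ ℤ_ℓ` are isometric hermitian `R ⊗ ℤ_ℓ`-lattices: there is a
`K_ℓ`-linear isometry of `(V_ℓ, φ_ℓ)` carrying `L ⊗ ℤ_ℓ` onto `L' ⊗ ℤ_ℓ`. -/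
def SameGenusAt (ℓ : ℕ) [Fact ℓ.Prime] (L L' : Submodule ℤ V) : Prop :=
  ∃ g : (ℚ_[ℓ] ⊗[ℚ] V) ≃ₗ[ℚ_[ℓ]] (ℚ_[ℓ] ⊗[ℚ] V),
    (∀ (a : K) (w : ℚ_[ℓ] ⊗[ℚ] V), g (actK K V ℓ a w) = actK K V ℓ a (g w)) ∧
    (∀ w w' : ℚ_[ℓ] ⊗[ℚ] V,
      localForm K V φ ℓ (g w) (g w') = localForm K V φ ℓ w w') ∧
    g '' (latCompl V ℓ L : Set (ℚ_[ℓ] ⊗[ℚ] V)) = (latCompl V ℓ L' : Set (ℚ_[ℓ] ⊗[ℚ] V))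

/-- Two lattices in `(V, φ)` belong to the same genus. -/
def SameGenus (L L' : Submodule ℤ V) : Prop :=
  ∀ (ℓ : ℕ) [Fact ℓ.Prime], SameGenusAt K V φ ℓ L L'

/-- There are exactly `N` genera of `√-p`-modular `R`-lattices in `(V, φ)`. -/
def HasExactlyGenera (N : ℕ) : Prop :=
  ∃ Ls : Fin N → Submodule ℤ V,
    (∀ i, IsModularRLat K sp V φ (Ls i)) ∧
    (∀ i j, i ≠ j → ¬ SameGenus K V φ (Ls i) (Ls j)) ∧
    (∀ L : Submodule ℤ V, IsModularRLat K sp V φ L → ∃ i, SameGenus K V φ (Ls i) L)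

end Setup

namespace SqrtForm

section Basic

variable {S : Type} [CommRing S]
variable {M : Type} [AddCommGroup M] [Module S M]
variable {M' : Type} [AddCommGroup M'] [Module S M']
variable {M'' : Type} [AddCommGroup M''] [Module S M'']

/-- `B` is symmetric and `s` is a skew-adjoint square root of `-p`. -/
structure IsHerm (p : ℕ) (B : M →ₗ[S] M →ₗ[S] S) (s : M →ₗ[S] M) : Prop where
  symm : ∀ x y, B x y = B y x
  skew : ∀ x y, B (s x) y = -B x (s y)
  sq : ∀ x, s (s x) = -((p : S) • x)

/-- Unimodularity of `B` at the prime `l`. -/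
def UnimodAt (l : S) (B : M →ₗ[S] M →ₗ[S] S) : Prop :=
  ∀ x, (∀ y, l ∣ B x y) → ∃ w, x = l • w

/-- All the values `B x x` are even. -/
def IsEvenForm (B : M →ₗ[S] M →ₗ[S] S) : Prop := ∀ x, (2 : S) ∣ B x x

/-- The elements `x` with `(1 + s) / 2 • x` integral. -/
def halfStable (s : M →+ M) : AddSubgroup M where
  carrier := {x | ∃ y, x + s x = y + y}
  zero_mem' := ⟨0, by simp⟩
  add_mem' := by
    rintro a b ⟨y, hy⟩ ⟨z, hz⟩
    exact ⟨y + z, by rw [map_add, add_add_add_comm, hy, hz, add_add_add_comm]⟩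
  neg_mem' := by
    rintro a ⟨y, hy⟩
    exact ⟨-y, by rw [map_neg, ← neg_add, hy, neg_add]⟩

theorem mem_halfStable {s : M →+ M} {x : M} :
    x ∈ halfStable s ↔ ∃ y, x + s x = y + y := Iff.rfl

/-- The index of the largest submodule stable under `(1 + s) / 2`. -/
noncomputable def halfIndex (s : M →+ M) : ℕ := (halfStable s).index

/-- Isometry of modules with form and operator. -/
def Isometric (B : M →ₗ[S] M →ₗ[S] S) (s : M →ₗ[S] M)
    (B' : M' →ₗ[S] M' →ₗ[S] S) (s' : M' →ₗ[S] M') : Prop :=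
  ∃ e : M ≃ₗ[S] M', (∀ x y, B' (e x) (e y) = B x y) ∧ ∀ x, e (s x) = s' (e x)

theorem Isometric.symm {B : M →ₗ[S] M →ₗ[S] S} {s : M →ₗ[S] M}
    {B' : M' →ₗ[S] M' →ₗ[S] S} {s' : M' →ₗ[S] M'} (h : Isometric B s B' s') :
    Isometric B' s' B s := by
  obtain ⟨e, h1, h2⟩ := h
  refine ⟨e.symm, fun x y => ?_, fun x => ?_⟩
  · rw [← h1]; simp
  · apply e.injective; rw [h2]; simp

theorem Isometric.trans {B : M →ₗ[S] M →ₗ[S] S} {s : M →ₗ[S] M}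
    {B' : M' →ₗ[S] M' →ₗ[S] S} {s' : M' →ₗ[S] M'}
    {B'' : M'' →ₗ[S] M'' →ₗ[S] S} {s'' : M'' →ₗ[S] M''}
    (h : Isometric B s B' s') (h' : Isometric B' s' B'' s'') :
    Isometric B s B'' s'' := by
  obtain ⟨e, h1, h2⟩ := h
  obtain ⟨f, h3, h4⟩ := h'
  exact ⟨e.trans f, fun x y => by simp [h3, h1], fun x => by simp [h2, h4]⟩

/-- The orthogonal sum of two forms. -/
def prodForm (B : M →ₗ[S] M →ₗ[S] S) (B' : M' →ₗ[S] M' →ₗ[S] S) :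
    (M × M') →ₗ[S] (M × M') →ₗ[S] S :=
  B.compl₁₂ (LinearMap.fst S M M') (LinearMap.fst S M M') +
    B'.compl₁₂ (LinearMap.snd S M M') (LinearMap.snd S M M')

@[simp] theorem prodForm_apply (B : M →ₗ[S] M →ₗ[S] S) (B' : M' →ₗ[S] M' →ₗ[S] S)
    (x y : M × M') : prodForm B B' x y = B x.1 y.1 + B' x.2 y.2 := rfl

theorem Isometric.prod_right {B : M →ₗ[S] M →ₗ[S] S} {s : M →ₗ[S] M}
    {B' : M' →ₗ[S] M' →ₗ[S] S} {s' : M' →ₗ[S] M'}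
    (B₀ : M'' →ₗ[S] M'' →ₗ[S] S) (s₀ : M'' →ₗ[S] M'') (h : Isometric B s B' s') :
    Isometric (prodForm B₀ B) (s₀.prodMap s) (prodForm B₀ B') (s₀.prodMap s') := by
  obtain ⟨e, h1, h2⟩ := h
  exact ⟨(LinearEquiv.refl S M'').prodCongr e, fun x y => by simp [h1], fun x => by simp [h2]⟩

theorem IsHerm.of_isometric {p : ℕ} {B : M →ₗ[S] M →ₗ[S] S} {s : M →ₗ[S] M}
    {B' : M' →ₗ[S] M' →ₗ[S] S} {s' : M' →ₗ[S] M'} (h : IsHerm p B s)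
    (hi : Isometric B s B' s') : IsHerm p B' s' := by
  obtain ⟨e, h1, h2⟩ := hi.symm
  refine ⟨fun x y => ?_, fun x y => ?_, fun x => ?_⟩
  · rw [← h1, ← h1, h.symm]
  · rw [← h1, ← h1, h2, h2, h.skew]
  · apply e.injective; rw [h2, h2, h.sq]; simp

theorem IsHerm.of_prod_right {p : ℕ} {B : M →ₗ[S] M →ₗ[S] S} {s : M →ₗ[S] M}
    {B' : M' →ₗ[S] M' →ₗ[S] S} {s' : M' →ₗ[S] M'}
    (h : IsHerm p (prodForm B B') (s.prodMap s')) : IsHerm p B' s' where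
  symm x y := by simpa using h.symm (0, x) (0, y)
  skew x y := by simpa using h.skew (0, x) (0, y)
  sq x := by simpa using congrArg Prod.snd (h.sq (0, x))

theorem IsHerm.apply_self [IsDomain S] [CharZero S] {p : ℕ} {B : M →ₗ[S] M →ₗ[S] S}
    {s : M →ₗ[S] M} (h : IsHerm p B s) (x : M) : B x (s x) = 0 := by
  have h1 := h.skew x x
  rw [h.symm] at h1
  have : (2 : S) * B x (s x) = 0 := by linear_combination h1
  simpa using this

theorem IsHerm.apply_self' [IsDomain S] [CharZero S] {p : ℕ} {B : M →ₗ[S] M →ₗ[S] S}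
    {s : M →ₗ[S] M} (h : IsHerm p B s) (x : M) : B (s x) x = 0 := by
  rw [h.symm, h.apply_self]

theorem IsHerm.skew' {p : ℕ} {B : M →ₗ[S] M →ₗ[S] S}
    {s : M →ₗ[S] M} (h : IsHerm p B s) (x y : M) : B x (s y) = -B (s x) y := by
  rw [h.skew, neg_neg]

theorem IsHerm.apply_s_s {p : ℕ} {B : M →ₗ[S] M →ₗ[S] S}
    {s : M →ₗ[S] M} (h : IsHerm p B s) (x y : M) : B (s x) (s y) = p * B x y := by
  rw [h.skew, h.sq]; simp

theorem UnimodAt.prod {l : S} {B : M →ₗ[S] M →ₗ[S] S} {B' : M' →ₗ[S] M' →ₗ[S] S}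
    (h : UnimodAt l B) (h' : UnimodAt l B') : UnimodAt l (prodForm B B') := by
  intro x hx
  obtain ⟨w, hw⟩ := h x.1 fun y => by simpa using hx (y, 0)
  obtain ⟨w', hw'⟩ := h' x.2 fun y => by simpa using hx (0, y)
  exact ⟨(w, w'), Prod.ext hw hw'⟩

theorem UnimodAt.of_prod_right {l : S} {B : M →ₗ[S] M →ₗ[S] S} {B' : M' →ₗ[S] M' →ₗ[S] S}
    (h : UnimodAt l (prodForm B B')) : UnimodAt l B' := by
  intro x hx
  obtain ⟨w, hw⟩ := h (0, x) fun y => by simpa using hx y.2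
  exact ⟨w.2, congrArg Prod.snd hw⟩

theorem UnimodAt.of_isometric {l : S} {B : M →ₗ[S] M →ₗ[S] S} {s : M →ₗ[S] M}
    {B' : M' →ₗ[S] M' →ₗ[S] S} {s' : M' →ₗ[S] M'} (h : UnimodAt l B)
    (hi : Isometric B s B' s') : UnimodAt l B' := by
  obtain ⟨e, h1, -⟩ := hi
  intro x hx
  obtain ⟨w, hw⟩ := h (e.symm x) fun y => by
    have := hx (e y)
    rwa [← e.apply_symm_apply x, h1] at this
  exact ⟨e w, by rw [← map_smul, ← hw, e.apply_symm_apply]⟩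

theorem IsEvenForm.of_isometric {B : M →ₗ[S] M →ₗ[S] S} {s : M →ₗ[S] M}
    {B' : M' →ₗ[S] M' →ₗ[S] S} {s' : M' →ₗ[S] M'} (h : IsEvenForm B)
    (hi : Isometric B s B' s') : IsEvenForm B' := by
  obtain ⟨e, h1, -⟩ := hi.symm
  exact fun x => by rw [← h1]; exact h _

theorem isEvenForm_prod {B : M →ₗ[S] M →ₗ[S] S} {B' : M' →ₗ[S] M' →ₗ[S] S} :
    IsEvenForm (prodForm B B') ↔ IsEvenForm B ∧ IsEvenForm B' := by
  refine ⟨fun h => ⟨fun x => by simpa using h (x, 0), fun x => by simpa using h (0, x)⟩, ?_⟩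
  exact fun h x => by simpa using dvd_add (h.1 x.1) (h.2 x.2)

end Basic

section HalfIndex

variable {M M' : Type} [AddCommGroup M] [AddCommGroup M']

/-- A map compatible with the operators that is injective and surjective modulo the
`(1 + s) / 2`-stable parts preserves the index. -/
theorem halfIndex_eq_of_map {s : M →+ M} {s' : M' →+ M'} (f : M →+ M')
    (h1 : ∀ x, f x ∈ halfStable s' ↔ x ∈ halfStable s)
    (h2 : ∀ y, ∃ x, f x - y ∈ halfStable s') : halfIndex s = halfIndex s' := by
  have hc : halfStable s = (halfStable s').comap f := by
    ext x; rw [AddSubgroup.mem_comap, h1]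
  unfold halfIndex
  let g : M →+ M' ⧸ halfStable s' := (QuotientAddGroup.mk' _).comp f
  have hg : Function.Surjective g := by
    intro z
    obtain ⟨y, rfl⟩ := QuotientAddGroup.mk_surjective z
    obtain ⟨x, hx⟩ := h2 y
    refine ⟨x, ?_⟩
    simp only [g, AddMonoidHom.comp_apply, QuotientAddGroup.mk'_apply]
    rw [eq_comm, QuotientAddGroup.eq, neg_add_eq_sub]
    exact hx
  have hk : g.ker = halfStable s := by
    ext x
    rw [AddMonoidHom.mem_ker, hc, AddSubgroup.mem_comap]
    simp [g]
  rw [← hk, AddSubgroup.index_ker, AddSubgroup.index_eq_card,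
    AddMonoidHom.range_eq_top.mpr hg]
  exact Nat.card_congr AddSubgroup.topEquiv.toEquiv

theorem halfIndex_prod (s : M →+ M) (s' : M' →+ M') :
    halfIndex (s.prodMap s') = halfIndex s * halfIndex s' := by
  have : halfStable (s.prodMap s') = (halfStable s).prod (halfStable s') := by
    ext ⟨x, y⟩
    rw [AddSubgroup.mem_prod, mem_halfStable, mem_halfStable, mem_halfStable]
    constructor
    · rintro ⟨⟨a, b⟩, h⟩
      exact ⟨⟨a, congrArg Prod.fst h⟩, ⟨b, congrArg Prod.snd h⟩⟩
    · rintro ⟨⟨a, ha⟩, ⟨b, hb⟩⟩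
      exact ⟨(a, b), Prod.ext ha hb⟩
  rw [halfIndex, this, AddSubgroup.index_prod]
  rfl

theorem Isometric.halfIndex_eq {S : Type} [CommRing S] [Module S M] [Module S M']
    {B : M →ₗ[S] M →ₗ[S] S} {s : M →ₗ[S] M}
    {B' : M' →ₗ[S] M' →ₗ[S] S} {s' : M' →ₗ[S] M'} (h : Isometric B s B' s') :
    halfIndex s.toAddMonoidHom = halfIndex s'.toAddMonoidHom := by
  obtain ⟨e, -, h2⟩ := h
  have h2' : ∀ x, e.symm (s' x) = s (e.symm x) := fun x => by
    apply e.injective; rw [h2]; simp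
  refine halfIndex_eq_of_map e.toLinearMap.toAddMonoidHom (fun x => ?_)
    fun y => ⟨e.symm y, by simp⟩
  simp only [mem_halfStable, LinearMap.toAddMonoidHom_coe, LinearEquiv.coe_coe]
  constructor
  · rintro ⟨y, hy⟩
    refine ⟨e.symm y, ?_⟩
    apply e.injective
    simp [h2, hy]
  · rintro ⟨y, hy⟩
    exact ⟨e y, by rw [← h2, ← map_add, hy, map_add]⟩

theorem halfIndex_prodMap {S : Type} [CommRing S] [Module S M] [Module S M']
    (s : M →ₗ[S] M) (s' : M' →ₗ[S] M') :
    halfIndex (s.prodMap s').toAddMonoidHom =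
      halfIndex s.toAddMonoidHom * halfIndex s'.toAddMonoidHom := by
  rw [← halfIndex_prod]; rfl

theorem halfIndex_eq_one_iff {s : M →+ M} : halfIndex s = 1 ↔ ∀ x, ∃ y, x + s x = y + y := by
  rw [halfIndex, AddSubgroup.index_eq_one, AddSubgroup.eq_top_iff']
  rfl

end HalfIndex

section Split

variable {S : Type} [CommRing S]
variable {M : Type} [AddCommGroup M] [Module S M]
variable {E : Type} [AddCommGroup E] [Module S E]

theorem exists_complement [IsDomain S] [IsPrincipalIdealRing S]
    [Module.Finite S M] [Module.Free S M] [Module.Finite S E] [Module.Free S E]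
    {p : ℕ} {B : M →ₗ[S] M →ₗ[S] S} {s : M →ₗ[S] M}
    (h : IsHerm p B s) {β : E →ₗ[S] E →ₗ[S] S} {t : E →ₗ[S] E} (ι : E →ₗ[S] M)
    (hB : ∀ u v, B (ι u) (ι v) = β u v) (hs : ∀ u, s (ι u) = ι (t u))
    (hβ : ∀ f : E →ₗ[S] S, ∃ u, ∀ v, β u v = f v)
    (hβ0 : ∀ u, (∀ v, β u v = 0) → u = 0) :
    ∃ (C : Type) (_ : AddCommGroup C) (_ : Module S C) (_ : Module.Finite S C)
      (_ : Module.Free S C) (BC : C →ₗ[S] C →ₗ[S] S) (sC : C →ₗ[S] C) (j : C →ₗ[S] M),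
      Isometric (prodForm β BC) (t.prodMap sC) B s ∧
      (∀ c c', B (j c) (j c') = BC c c') ∧ (∀ c, s (j c) = j (sC c)) ∧
      (∀ m, (∀ u, B m (ι u) = 0) ↔ ∃ c, j c = m) ∧
      Module.finrank S M = Module.finrank S E + Module.finrank S C := by
  let C : Submodule S M :=
    { carrier := {m | ∀ u, B m (ι u) = 0}
      zero_mem' := by simp
      add_mem' := fun {a b} ha hb u => by simp [ha u, hb u]
      smul_mem' := fun c x hx u => by simp [hx u] }
  have hC : ∀ m, m ∈ C ↔ ∀ u, B m (ι u) = 0 := fun m => Iff.rfl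
  have hsC : ∀ c ∈ C, s c ∈ C := fun c hc u => by
    rw [h.skew, hs, hc, neg_zero]
  let e₀ : (E × C) →ₗ[S] M := ι.coprod C.subtype
  have he₀ : ∀ x, e₀ x = ι x.1 + x.2 := fun x => by simp [e₀]
  have hbij : Function.Bijective e₀ := by
    constructor
    · rw [← LinearMap.ker_eq_bot, LinearMap.ker_eq_bot']
      rintro ⟨u, c⟩ huc
      rw [he₀] at huc
      have hu : u = 0 := hβ0 u fun v => by
        have h1 := congrArg (fun m => B m (ι v)) huc
        simpa [hB, (hC _).1 c.2 v] using h1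
      subst hu
      simpa using huc
    · intro m
      obtain ⟨u, hu⟩ := hβ ((B m).comp ι)
      refine ⟨(u, ⟨m - ι u, fun v => ?_⟩), by simp [he₀]⟩
      simp [hB, hu]
  let e := LinearEquiv.ofBijective e₀ hbij
  have he : ∀ x, e x = ι x.1 + x.2 := he₀
  refine ⟨C, inferInstance, inferInstance, inferInstance, inferInstance,
    B.domRestrict₁₂ C C, s.restrict hsC, C.subtype, ⟨e, ?_, ?_⟩, fun _ _ => rfl,
    fun _ => rfl, fun m => ?_, ?_⟩
  · rintro ⟨u, c⟩ ⟨u', c'⟩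
    have h1 : B c (ι u') = 0 := c.2 u'
    have h2 : B (ι u) c' = 0 := by rw [h.symm]; exact c'.2 u
    simp [he, hB, h1, h2]
    rfl
  · rintro ⟨u, c⟩
    simp [he, hs]
  · exact ⟨fun hm => ⟨⟨m, hm⟩, rfl⟩, by rintro ⟨c, rfl⟩; exact c.2⟩
  · rw [← e.finrank_eq, Module.finrank_prod]

end Split

section Blocks

variable {S : Type} [CommRing S]

/-- Multiplication by `√-p` on `S[√-p]` in the basis `1, √-p`. -/
def opR (S : Type) [CommRing S] (p : ℕ) : (S × S) →ₗ[S] (S × S) where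
  toFun x := (-(p * x.2), x.1)
  map_add' x y := by ext <;> simp <;> ring
  map_smul' c x := by ext <;> simp; ring

/-- Multiplication by `√-p` on the maximal order in the basis `1, (1 + √-p) / 2`,
where `4 * q = p + 1`. -/
def opO (S : Type) [CommRing S] (q : ℕ) : (S × S) →ₗ[S] (S × S) where
  toFun x := (-x.1 - 2 * q * x.2, 2 * x.1 + x.2)
  map_add' x y := by ext <;> simp <;> ring
  map_smul' c x := by ext <;> simp <;> ring

/-- The form of a rank one lattice over `S[√-p]`. -/
def formR (p : ℕ) (u : S) : (S × S) →ₗ[S] (S × S) →ₗ[S] S :=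
  LinearMap.mk₂ S (fun x y => u * (x.1 * y.1 + p * x.2 * y.2))
    (fun x x' y => by simp; ring) (fun c x y => by simp; ring)
    (fun x y y' => by simp; ring) (fun c x y => by simp; ring)

/-- The form of a rank one lattice over the maximal order. -/
def formO (q : ℕ) (u : S) : (S × S) →ₗ[S] (S × S) →ₗ[S] S :=
  LinearMap.mk₂ S (fun x y => u * (2 * (x.1 * y.1) + x.1 * y.2 + x.2 * y.1 + 2 * q * x.2 * y.2))
    (fun x x' y => by simp; ring) (fun c x y => by simp; ring)
    (fun x y y' => by simp; ring) (fun c x y => by simp; ring)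

/-- The form of a free lattice of rank two over `S[√-p]` with basis `e, f`, where
`B e e = α`, `B f f = δ`, `B e f = β`, `B (s e) f = γ`. -/
def formP (p : ℕ) (α δ β γ : S) : ((S × S) × (S × S)) →ₗ[S] ((S × S) × (S × S)) →ₗ[S] S :=
  LinearMap.mk₂ S (fun x y => α * (x.1.1 * y.1.1 + p * x.1.2 * y.1.2) +
      δ * (x.2.1 * y.2.1 + p * x.2.2 * y.2.2) +
      β * (x.1.1 * y.2.1 + p * x.1.2 * y.2.2) + γ * (x.1.2 * y.2.1 - x.1.1 * y.2.2) +
      β * (y.1.1 * x.2.1 + p * y.1.2 * x.2.2) + γ * (y.1.2 * x.2.1 - y.1.1 * x.2.2))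
    (fun x x' y => by simp; ring) (fun c x y => by simp; ring)
    (fun x y y' => by simp; ring) (fun c x y => by simp; ring)

/-- Multiplication by `√-p` on the free module of rank two. -/
def opP (S : Type) [CommRing S] (p : ℕ) : ((S × S) × (S × S)) →ₗ[S] ((S × S) × (S × S)) :=
  (opR S p).prodMap (opR S p)

@[simp] theorem opR_apply (p : ℕ) (x : S × S) : opR S p x = (-(p * x.2), x.1) := rfl

@[simp] theorem opO_apply (q : ℕ) (x : S × S) :
    opO S q x = (-x.1 - 2 * q * x.2, 2 * x.1 + x.2) := rfl

@[simp] theorem opP_apply (p : ℕ) (x : (S × S) × (S × S)) :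
    opP S p x = ((-(p * x.1.2), x.1.1), (-(p * x.2.2), x.2.1)) := rfl

@[simp] theorem formR_apply (p : ℕ) (u : S) (x y : S × S) :
    formR p u x y = u * (x.1 * y.1 + p * x.2 * y.2) := rfl

@[simp] theorem formO_apply (q : ℕ) (u : S) (x y : S × S) :
    formO q u x y = u * (2 * (x.1 * y.1) + x.1 * y.2 + x.2 * y.1 + 2 * q * x.2 * y.2) := rfl

@[simp] theorem formP_apply (p : ℕ) (α δ β γ : S) (x y : (S × S) × (S × S)) :
    formP p α δ β γ x y = α * (x.1.1 * y.1.1 + p * x.1.2 * y.1.2) +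
      δ * (x.2.1 * y.2.1 + p * x.2.2 * y.2.2) +
      β * (x.1.1 * y.2.1 + p * x.1.2 * y.2.2) + γ * (x.1.2 * y.2.1 - x.1.1 * y.2.2) +
      β * (y.1.1 * x.2.1 + p * y.1.2 * x.2.2) + γ * (y.1.2 * x.2.1 - y.1.1 * x.2.2) := rfl

theorem halfIndex_opR {p : ℕ} (hp : p % 2 = 1) (h2 : ∀ x : S, 2 ∣ x ∨ 2 ∣ x + 1)
    (hu : ¬ IsUnit (2 : S)) : halfIndex (opR S p).toAddMonoidHom = 2 := by
  have key : ∀ x : S × S, x ∈ halfStable (opR S p).toAddMonoidHom ↔ 2 ∣ x.1 + x.2 := by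
    intro x
    have hp' : (p : S) = 2 * ((p / 2 : ℕ) : S) + 1 := by
      exact_mod_cast congrArg (Nat.cast : ℕ → S) (show p = 2 * (p / 2) + 1 by omega)
    rw [mem_halfStable]
    constructor
    · rintro ⟨y, hy⟩
      refine ⟨y.2, ?_⟩
      have := congrArg Prod.snd hy
      simp only [LinearMap.toAddMonoidHom_coe, opR_apply, Prod.snd_add] at this
      linear_combination this
    · rintro ⟨c, hc⟩
      refine ⟨(c - ((p / 2 : ℕ) + 1 : S) * x.2, c), ?_⟩
      ext
      · simp only [LinearMap.toAddMonoidHom_coe, opR_apply, Prod.fst_add]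
        rw [hp']; linear_combination hc
      · simp only [LinearMap.toAddMonoidHom_coe, opR_apply, Prod.snd_add]
        linear_combination hc
  rw [halfIndex, AddSubgroup.index_eq_two_iff]
  refine ⟨(1, 0), fun x => ?_⟩
  rw [key, key, xor_iff_iff_not]
  simp only [Prod.fst_add, Prod.snd_add, add_zero]
  rw [show x.1 + 1 + x.2 = x.1 + x.2 + 1 by ring]
  constructor
  · intro h3 h4
    exact hu (isUnit_of_dvd_one ((dvd_add_right h4).mp h3))
  · intro h3
    exact (h2 _).resolve_left h3

theorem halfIndex_opP {p : ℕ} (hp : p % 2 = 1) (h2 : ∀ x : S, 2 ∣ x ∨ 2 ∣ x + 1)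
    (hu : ¬ IsUnit (2 : S)) : halfIndex (opP S p).toAddMonoidHom = 4 := by
  rw [opP, halfIndex_prodMap, halfIndex_opR hp h2 hu]

theorem halfIndex_opO (q : ℕ) : halfIndex (opO S q).toAddMonoidHom = 1 := by
  rw [halfIndex_eq_one_iff]
  intro x
  refine ⟨(-(q * x.2), x.1 + x.2), ?_⟩
  ext <;> simp <;> ring

end Blocks

section SplitBlocks

variable {S : Type} [CommRing S] [IsDomain S] [CharZero S]
variable {M : Type} [AddCommGroup M] [Module S M]
variable {p : ℕ} {B : M →ₗ[S] M →ₗ[S] S} {s : M →ₗ[S] M}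

/-- The map `a + b √-p ↦ a x + b s x`. -/
def spanR (s : M →ₗ[S] M) (x : M) : (S × S) →ₗ[S] M where
  toFun a := a.1 • x + a.2 • s x
  map_add' a b := by simp only [Prod.fst_add, Prod.snd_add]; module
  map_smul' c a := by
    simp only [Prod.smul_fst, Prod.smul_snd, RingHom.id_apply, smul_eq_mul]
    module

@[simp] theorem spanR_apply (s : M →ₗ[S] M) (x : M) (a : S × S) :
    spanR s x a = a.1 • x + a.2 • s x := rfl

theorem spanR_opR (h : IsHerm p B s) (x : M) (a : S × S) :
    s (spanR s x a) = spanR s x (opR S p a) := by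
  simp only [spanR_apply, map_add, map_smul, h.sq, opR_apply]
  module

theorem form_spanR (h : IsHerm p B s) (x : M) (a b : S × S) :
    B (spanR s x a) (spanR s x b) = formR p (B x x) a b := by
  simp [h.apply_self, h.apply_self', h.apply_s_s]; ring

/-- The map `(a + b √-p, c + d √-p) ↦ a x + b s x + c y + d s y`. -/
def spanP (s : M →ₗ[S] M) (x y : M) : ((S × S) × (S × S)) →ₗ[S] M :=
  (spanR s x).coprod (spanR s y)

@[simp] theorem spanP_apply (s : M →ₗ[S] M) (x y : M) (a : (S × S) × (S × S)) :
    spanP s x y a = (a.1.1 • x + a.1.2 • s x) + (a.2.1 • y + a.2.2 • s y) := rfl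

theorem spanP_opP (h : IsHerm p B s) (x y : M) (a : (S × S) × (S × S)) :
    s (spanP s x y a) = spanP s x y (opP S p a) := by
  simp only [spanP_apply, map_add, map_smul, h.sq, opP_apply]
  module

theorem form_spanP (h : IsHerm p B s) (x y : M) (a b : (S × S) × (S × S)) :
    B (spanP s x y a) (spanP s x y b) =
      formP p (B x x) (B y y) (B x y) (B (s x) y) a b := by
  have h1 : B y x = B x y := h.symm _ _
  have h2 : B x (s y) = -B (s x) y := h.skew' _ _
  have h3 : B (s y) x = -B (s x) y := by rw [h.symm, h2]
  have h4 : B y (s x) = B (s x) y := h.symm _ _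
  simp [h.apply_self, h.apply_self', h.apply_s_s, h1, h2, h3, h4]; ring

/-- The map `a + b (1 + √-p) / 2 ↦ a x + b w`. -/
def spanO (x w : M) : (S × S) →ₗ[S] M where
  toFun a := a.1 • x + a.2 • w
  map_add' a b := by simp only [Prod.fst_add, Prod.snd_add]; module
  map_smul' c a := by
    simp only [Prod.smul_fst, Prod.smul_snd, RingHom.id_apply, smul_eq_mul]
    module

@[simp] theorem spanO_apply (x w : M) (a : S × S) :
    spanO x w a = a.1 • x + a.2 • w := rfl

theorem spanO_opO {q : ℕ} (hq : 4 * q = p + 1) (h : IsHerm p B s) {x w : M}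
    [Module.IsTorsionFree S M]
    (hw : x + s x = (2 : S) • w) (a : S × S) :
    s (spanO x w a) = spanO x w (opO S q a) := by
  have hq' : (4 : S) * q = p + 1 := by exact_mod_cast congrArg (Nat.cast : ℕ → S) hq
  have h1 : s x = (2 : S) • w - x := by rw [← hw]; abel
  have h2 : s w = w - (2 * q : S) • x := by
    have h3 : (2 : S) • s w = (2 : S) • (w - (2 * q : S) • x) := by
      rw [← map_smul, ← hw, map_add, h.sq, h1, smul_sub, smul_smul,
        show (2 : S) * (2 * q) = p + 1 by linear_combination hq']
      module
    exact smul_right_injective M (two_ne_zero' S) h3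
  simp only [spanO_apply, map_add, map_smul, h1, h2, opO_apply]
  module

theorem form_spanO {q : ℕ} (hq : 4 * q = p + 1) (h : IsHerm p B s) {x w : M}
    (hw : x + s x = (2 : S) • w) {u : S} (hu : B x x = 2 * u) (a b : S × S) :
    B (spanO x w a) (spanO x w b) = formO q u a b := by
  have hq' : (4 : S) * q = p + 1 := by exact_mod_cast congrArg (Nat.cast : ℕ → S) hq
  have h1 : B x w = u := by
    have h2 : B x (x + s x) = 2 * B x w := by rw [hw]; simp
    rw [map_add, h.apply_self, hu, add_zero] at h2
    exact (mul_left_cancel₀ (two_ne_zero' S) h2).symm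
  have h3 : B w w = 2 * q * u := by
    have h2 : B (x + s x) (x + s x) = 2 * (2 * B w w) := by rw [hw]; simp
    simp only [map_add, LinearMap.add_apply, h.apply_self, h.apply_self', h.apply_s_s, hu] at h2
    have h4 : (2 * 2 : S) * B w w = (2 * 2) * (2 * q * u) := by
      linear_combination -h2 - 2 * u * hq'
    exact mul_left_cancel₀ (by simp) h4
  have h5 : B w x = u := by rw [h.symm, h1]
  simp [h1, h3, h5, hu]; ring

end SplitBlocks

section Perfect

variable {S : Type} [CommRing S] {p : ℕ}

theorem formR_perfect {u : S} (hu : IsUnit u) (hp : IsUnit (p : S)) :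
    (∀ f : (S × S) →ₗ[S] S, ∃ x, ∀ y, formR p u x y = f y) ∧
      ∀ x, (∀ y, formR p u x y = 0) → x = 0 := by
  obtain ⟨u', hu'⟩ := hu.exists_left_inv
  obtain ⟨p', hp'⟩ := hp.exists_left_inv
  refine ⟨fun f => ⟨(u' * f (1, 0), u' * p' * f (0, 1)), fun y => ?_⟩, fun x hx => ?_⟩
  · have : f y = y.1 * f (1, 0) + y.2 * f (0, 1) := by
      rw [← smul_eq_mul, ← smul_eq_mul, ← map_smul, ← map_smul, ← map_add]; simp
    rw [this, formR_apply]
    linear_combination (y.1 * f (1, 0) + p * p' * f (0, 1) * y.2) * hu' +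
      f (0, 1) * y.2 * hp'
  · have h1 := hx (1, 0)
    have h2 := hx (0, 1)
    simp only [formR_apply] at h1 h2
    ext
    · change _ = (0 : S)
      linear_combination u' * h1 - x.1 * hu'
    · change _ = (0 : S)
      linear_combination u' * p' * h2 - (x.2 * p * p') * hu' - x.2 * hp'

theorem formO_perfect {q : ℕ} (hq : 4 * q = p + 1) {u : S} (hu : IsUnit u)
    (hp : IsUnit (p : S)) :
    (∀ f : (S × S) →ₗ[S] S, ∃ x, ∀ y, formO q u x y = f y) ∧
      ∀ x, (∀ y, formO q u x y = 0) → x = 0 := by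
  have hq' : (4 : S) * q = p + 1 := by exact_mod_cast congrArg (Nat.cast : ℕ → S) hq
  obtain ⟨u', hu'⟩ := hu.exists_left_inv
  obtain ⟨p', hp'⟩ := hp.exists_left_inv
  refine ⟨fun f => ⟨(u' * p' * (2 * q * f (1, 0) - f (0, 1)),
    u' * p' * (2 * f (0, 1) - f (1, 0))), fun y => ?_⟩, fun x hx => ?_⟩
  · have : f y = y.1 * f (1, 0) + y.2 * f (0, 1) := by
      rw [← smul_eq_mul, ← smul_eq_mul, ← map_smul, ← map_smul, ← map_add]; simp
    rw [this, formO_apply]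
    linear_combination (u * u' * p' * (y.1 * f (1, 0) + y.2 * f (0, 1))) * hq' +
      (p' * p) * (y.1 * f (1, 0) + y.2 * f (0, 1)) * hu' +
      (y.1 * f (1, 0) + y.2 * f (0, 1)) * hp'
  · have h1 := hx (1, 0)
    have h2 := hx (0, 1)
    simp only [formO_apply] at h1 h2
    ext
    · change _ = (0 : S)
      linear_combination u' * p' * (2 * q * h1 - h2) - u * u' * p' * x.1 * hq' -
        (p' * p) * x.1 * hu' - x.1 * hp'
    · change _ = (0 : S)
      linear_combination u' * p' * (2 * h2 - h1) - u * u' * p' * x.2 * hq' -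
        (p' * p) * x.2 * hu' - x.2 * hp'

theorem formP_perfect {β γ : S} (hu : IsUnit (p * β ^ 2 + γ ^ 2)) :
    (∀ f : ((S × S) × (S × S)) →ₗ[S] S, ∃ x, ∀ y, formP p 0 0 β γ x y = f y) ∧
      ∀ x, (∀ y, formP p 0 0 β γ x y = 0) → x = 0 := by
  obtain ⟨u', hu'⟩ := hu.exists_left_inv
  refine ⟨fun f => ?_, fun x hx => ?_⟩
  · set f1 := f ((1, 0), 0) with hf1
    set f2 := f ((0, 1), 0) with hf2
    set f3 := f (0, (1, 0)) with hf3
    set f4 := f (0, (0, 1)) with hf4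
    refine ⟨((u' * (p * β * f3 - γ * f4), u' * (γ * f3 + β * f4)),
      (u' * (p * β * f1 + γ * f2), u' * (β * f2 - γ * f1))), fun y => ?_⟩
    have : f y = y.1.1 * f1 + y.1.2 * f2 + y.2.1 * f3 + y.2.2 * f4 := by
      rw [hf1, hf2, hf3, hf4, ← smul_eq_mul, ← smul_eq_mul, ← smul_eq_mul, ← smul_eq_mul,
        ← map_smul, ← map_smul, ← map_smul, ← map_smul, ← map_add, ← map_add, ← map_add]
      congr 1
      ext <;> simp
    rw [this, formP_apply]
    linear_combination (y.1.1 * f1 + y.1.2 * f2 + y.2.1 * f3 + y.2.2 * f4) * hu'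
  · have h1 := hx ((1, 0), 0)
    have h2 := hx ((0, 1), 0)
    have h3 := hx (0, (1, 0))
    have h4 := hx (0, (0, 1))
    simp only [formP_apply, Prod.fst_zero, Prod.snd_zero] at h1 h2 h3 h4
    ext
    · change _ = (0 : S)
      linear_combination u' * (p * β * h3 - γ * h4) - x.1.1 * hu'
    · change _ = (0 : S)
      linear_combination u' * (γ * h3 + β * h4) - x.1.2 * hu'
    · change _ = (0 : S)
      linear_combination u' * (p * β * h1 + γ * h2) - x.2.1 * hu'
    · change _ = (0 : S)
      linear_combination u' * (β * h2 - γ * h1) - x.2.2 * hu'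

end Perfect

section Arithmetic

variable {l : ℕ} [Fact l.Prime]

theorem padicInt_isUnit_iff (x : ℤ_[l]) : IsUnit x ↔ ¬ (l : ℤ_[l]) ∣ x := by
  rw [← PadicInt.norm_lt_one_iff_dvd, ← PadicInt.not_isUnit_iff, not_not]

theorem padicInt_toZMod_eq_zero_iff (x : ℤ_[l]) :
    PadicInt.toZMod x = 0 ↔ (l : ℤ_[l]) ∣ x := by
  rw [← RingHom.mem_ker, PadicInt.ker_toZMod, IsLocalRing.mem_maximalIdeal, mem_nonunits_iff,
    padicInt_isUnit_iff, not_not]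

theorem padicInt_isUnit_natCast_iff (m : ℕ) : IsUnit (m : ℤ_[l]) ↔ ¬ l ∣ m := by
  rw [padicInt_isUnit_iff, ← padicInt_toZMod_eq_zero_iff, map_natCast, ZMod.natCast_eq_zero_iff]

theorem padicInt_not_isUnit_self : ¬ IsUnit (l : ℤ_[l]) := by
  rw [padicInt_isUnit_iff, not_not]

theorem padicInt_prime : Prime (l : ℤ_[l]) := PadicInt.prime_p

theorem padicInt_two_dvd (x : ℤ_[2]) : 2 ∣ x ∨ 2 ∣ x + 1 := by
  have h : ∀ y : ℤ_[2], (2 : ℤ_[2]) ∣ y ↔ PadicInt.toZMod y = 0 := fun y => by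
    rw [padicInt_toZMod_eq_zero_iff]; norm_num
  rw [h, h, map_add, map_one]
  generalize (PadicInt.toZMod x : ZMod 2) = z
  revert z; decide

theorem padicInt_two_not_isUnit : ¬ IsUnit (2 : ℤ_[2]) := by
  simpa using padicInt_not_isUnit_self (l := 2)

theorem padicInt_isUnit_two (hl : l ≠ 2) : IsUnit (2 : ℤ_[l]) := by
  have := (padicInt_isUnit_natCast_iff (l := l) 2).mpr
    (fun h => hl ((Nat.prime_dvd_prime_iff_eq Fact.out Nat.prime_two).mp h))
  simpa using this

theorem padicInt_isUnit_add {x y : ℤ_[l]} (hx : IsUnit x) (hy : (l : ℤ_[l]) ∣ y) :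
    IsUnit (x + y) := by
  rw [padicInt_isUnit_iff] at hx ⊢
  exact fun h => hx ((dvd_add_left hy).mp h)

theorem padicInt_exists_root (a b c t : ℤ_[l]) (h : (l : ℤ_[l]) ∣ a * t ^ 2 + b * t + c)
    (h' : IsUnit (2 * a * t + b)) : ∃ z, a * z ^ 2 + b * z + c = 0 := by
  let F : Polynomial ℤ_[l] := .C a * .X ^ 2 + .C b * .X + .C c
  have hF : ∀ z, F.aeval z = a * z ^ 2 + b * z + c := fun z => by simp [F]
  have hF' : F.derivative.aeval t = 2 * a * t + b := by simp [F]; ring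
  obtain ⟨z, hz, -⟩ := hensels_lemma (F := F) (a := t) (by
    rw [hF, hF', PadicInt.isUnit_iff.mp h', one_pow]
    exact (PadicInt.norm_lt_one_iff_dvd _).mpr h)
  exact ⟨z, by rw [← hF, hz]⟩

theorem padicInt_exists_sq (c : ℤ_[2]) : ∃ z : ℤ_[2], z ^ 2 = 1 + 8 * c := by
  obtain ⟨r, hr⟩ := padicInt_exists_root (l := 2) 1 1 (-2 * c) 0 (by
    push_cast; exact ⟨-c, by ring⟩) (by simp)
  exact ⟨1 + 2 * r, by linear_combination 4 * hr⟩

theorem padicInt_two_exists_norm {p : ℕ} (hp4 : p % 4 = 3) {u : ℤ_[2]} (hu : IsUnit u) :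
    ∃ a b : ℤ_[2], a ^ 2 + p * b ^ 2 = u := by
  have hp : IsUnit (p : ℤ_[2]) := by rw [padicInt_isUnit_natCast_iff]; omega
  obtain ⟨p', hp'⟩ := hp.exists_left_inv
  have red : ∀ y : ℤ_[2], ∃ z, y = 2 * z ∨ y = 2 * z + 1 := fun y => by
    rcases padicInt_two_dvd y with ⟨z, hz⟩ | ⟨z, hz⟩
    · exact ⟨z, .inl hz⟩
    · exact ⟨z - 1, .inr (by linear_combination hz)⟩
  obtain ⟨k, hk⟩ : ∃ k : ℕ, p = 8 * k + 3 ∨ p = 8 * k + 7 := ⟨p / 8, by omega⟩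
  have hk' : (p : ℤ_[2]) = 8 * k + 3 ∨ (p : ℤ_[2]) = 8 * k + 7 := by
    rcases hk with h | h
    · left; rw [h]; push_cast; rfl
    · right; rw [h]; push_cast; rfl
  have key : (∃ c, u = 1 + 8 * c) ∨ (∃ c, u = p + 8 * c) ∨ (∃ c, u = 4 * p + 1 + 8 * c) ∨
      ∃ c, u = 4 + p + 8 * c := by
    obtain ⟨y, rfl | rfl⟩ := red u
    · exact absurd (isUnit_of_mul_isUnit_left hu) padicInt_two_not_isUnit
    obtain ⟨z, rfl | rfl⟩ := red y <;> obtain ⟨w, rfl | rfl⟩ := red z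
    · exact .inl ⟨w, by ring⟩
    · exact .inr (.inr (.inl (hk'.elim (fun h => ⟨w - 1 - 4 * k, by rw [h]; ring⟩)
        (fun h => ⟨w - 3 - 4 * k, by rw [h]; ring⟩))))
    · exact hk'.elim (fun h => .inr (.inl ⟨w - k, by rw [h]; ring⟩))
        (fun h => .inr (.inr (.inr ⟨w - 1 - k, by rw [h]; ring⟩)))
    · exact hk'.elim (fun h => .inr (.inr (.inr ⟨w - k, by rw [h]; ring⟩)))
        (fun h => .inr (.inl ⟨w - k, by rw [h]; ring⟩))
  rcases key with ⟨c, rfl⟩ | ⟨c, rfl⟩ | ⟨c, rfl⟩ | ⟨c, rfl⟩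
  · obtain ⟨z, hz⟩ := padicInt_exists_sq c
    exact ⟨z, 0, by rw [hz]; ring⟩
  · obtain ⟨z, hz⟩ := padicInt_exists_sq (p' * c)
    exact ⟨0, z, by rw [hz]; linear_combination 8 * c * hp'⟩
  · obtain ⟨z, hz⟩ := padicInt_exists_sq c
    exact ⟨z, 2, by rw [hz]; ring⟩
  · obtain ⟨z, hz⟩ := padicInt_exists_sq (p' * c)
    exact ⟨2, z, by rw [hz]; linear_combination 8 * c * hp'⟩

theorem padicInt_odd_exists_norm {p : ℕ} (hl : l ≠ 2) (hlp : ¬ l ∣ p) {u : ℤ_[l]}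
    (hu : IsUnit u) : ∃ a b : ℤ_[l], a ^ 2 + p * b ^ 2 = u := by
  have h2 := padicInt_isUnit_two hl
  have hp : IsUnit (p : ℤ_[l]) := by rwa [padicInt_isUnit_natCast_iff]
  have hp0 : (p : ZMod l) ≠ 0 := by rwa [Ne, ZMod.natCast_eq_zero_iff]
  obtain ⟨a, b, hab⟩ := FiniteField.exists_root_sum_quadratic (R := ZMod l)
    (f := .X ^ 2) (g := .C (p : ZMod l) * .X ^ 2 + .C 0 * .X + .C (-PadicInt.toZMod u))
    (Polynomial.degree_X_pow 2) (Polynomial.degree_quadratic hp0)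
    (by rw [ZMod.card]; exact (Fact.out : l.Prime).eq_two_or_odd.resolve_left hl)
  obtain ⟨a, rfl⟩ := ZMod.ringHom_surjective (PadicInt.toZMod (p := l)) a
  obtain ⟨b, rfl⟩ := ZMod.ringHom_surjective (PadicInt.toZMod (p := l)) b
  have hab' : (l : ℤ_[l]) ∣ a ^ 2 + p * b ^ 2 - u := by
    rw [← padicInt_toZMod_eq_zero_iff, ← hab]
    simp; ring
  by_cases ha : IsUnit a
  · obtain ⟨z, hz⟩ := padicInt_exists_root 1 0 ((p : ℤ_[l]) * b ^ 2 - u) a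
      (by convert hab' using 1; ring) (by simpa using h2.mul ha)
    exact ⟨z, b, by linear_combination hz⟩
  · have hb : IsUnit b := by
      rw [padicInt_isUnit_iff, not_not] at ha
      rw [padicInt_isUnit_iff] at hu ⊢
      intro hb
      apply hu
      have : u = a * a + p * b * b - (a ^ 2 + p * b ^ 2 - u) := by ring
      rw [this]
      exact dvd_sub (dvd_add (ha.mul_left _) (hb.mul_left _)) hab'
    obtain ⟨z, hz⟩ := padicInt_exists_root (p : ℤ_[l]) 0 (a ^ 2 - u) b
      (by convert hab' using 1; ring) (by simpa using (h2.mul hp).mul hb)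
    exact ⟨a, z, by linear_combination hz⟩

theorem padicInt_exists_norm {p : ℕ} (hp4 : p % 4 = 3) (hlp : ¬ l ∣ p) {u : ℤ_[l]}
    (hu : IsUnit u) : ∃ a b : ℤ_[l], a ^ 2 + p * b ^ 2 = u := by
  rcases eq_or_ne l 2 with rfl | hl
  · exact padicInt_two_exists_norm hp4 hu
  · exact padicInt_odd_exists_norm hl hlp hu

end Arithmetic

section Generic

variable {S : Type} [CommRing S] [IsDomain S]
variable {M : Type} [AddCommGroup M] [Module S M]
variable {p : ℕ} {B : M →ₗ[S] M →ₗ[S] S} {s : M →ₗ[S] M}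

theorem exists_ne_smul [Module.Finite S M] [Module.Free S M] {l : S} (hl : ¬ IsUnit l)
    (hr : Module.finrank S M ≠ 0) : ∃ x : M, ∀ w, x ≠ l • w := by
  let b := Module.finBasis S M
  let i : Fin (Module.finrank S M) := ⟨0, Nat.pos_of_ne_zero hr⟩
  refine ⟨b i, fun w hw => hl (isUnit_of_dvd_one ⟨b.repr w i, ?_⟩)⟩
  have := congrArg (fun x => b.repr x i) hw
  simpa using this

theorem UnimodAt.exists_not_dvd [Module.Finite S M] [Module.Free S M] {l : S}
    (hl : ¬ IsUnit l) (hr : Module.finrank S M ≠ 0) (hU : UnimodAt l B) :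
    ∃ x y, ¬ l ∣ B x y := by
  obtain ⟨x, hx⟩ := exists_ne_smul (M := M) hl hr
  by_contra! h
  obtain ⟨w, hw⟩ := hU x (h x)
  exact hx w hw

theorem UnimodAt.exists_not_dvd_skew [Module.Finite S M] [Module.Free S M]
    (h : IsHerm p B s) (hl : ¬ IsUnit (p : S)) (hp : (p : S) ≠ 0)
    (hr : Module.finrank S M ≠ 0) (hU : UnimodAt (p : S) B) :
    ∃ x y, ¬ (p : S) ∣ B (s x) y := by
  obtain ⟨x, hx⟩ := exists_ne_smul (M := M) hl hr
  by_contra! hd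
  obtain ⟨w, hw⟩ := hU (s x) (hd x)
  obtain ⟨v, hv⟩ := hU (s w) (hd w)
  refine hx (-v) (smul_right_injective M hp ?_)
  have := h.sq x
  rw [hw, map_smul, hv] at this
  change (p : S) • x = (p : S) • (p : S) • -v
  rw [smul_neg, smul_neg, this, neg_neg]

theorem exists_split [IsPrincipalIdealRing S]
    [Module.Finite S M] [Module.Free S M] {E : Type} [AddCommGroup E] [Module S E]
    [Module.Finite S E] [Module.Free S E] {l : S} (h : IsHerm p B s) (hU : UnimodAt l B)
    {β : E →ₗ[S] E →ₗ[S] S} {t : E →ₗ[S] E} (ι : E →ₗ[S] M)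
    (hB : ∀ u v, B (ι u) (ι v) = β u v) (hs : ∀ u, s (ι u) = ι (t u))
    (hβ : (∀ f : E →ₗ[S] S, ∃ u, ∀ v, β u v = f v) ∧ ∀ u, (∀ v, β u v = 0) → u = 0) :
    ∃ (C : Type) (_ : AddCommGroup C) (_ : Module S C) (_ : Module.Finite S C)
      (_ : Module.Free S C) (BC : C →ₗ[S] C →ₗ[S] S) (sC : C →ₗ[S] C) (j : C →ₗ[S] M),
      Isometric (prodForm β BC) (t.prodMap sC) B s ∧ IsHerm p BC sC ∧ UnimodAt l BC ∧
      Module.finrank S M = Module.finrank S E + Module.finrank S C ∧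
      (∀ c c', B (j c) (j c') = BC c c') ∧ (∀ c, s (j c) = j (sC c)) ∧
      (∀ m, (∀ u, B m (ι u) = 0) ↔ ∃ c, j c = m) := by
  obtain ⟨C, _, _, _, _, BC, sC, j, h1, h2, h3, h4, h5⟩ :=
    exists_complement h ι hB hs hβ.1 hβ.2
  exact ⟨C, _, _, ‹_›, ‹_›, BC, sC, j, h1, (h.of_isometric h1.symm).of_prod_right,
    (hU.of_isometric h1.symm).of_prod_right, h5, h2, h3, h4⟩

variable [CharZero S]

theorem IsHerm.exists_adjust (h : IsHerm p B s) (x y : M)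
    (hD : IsUnit (p * B x y ^ 2 + B (s x) y ^ 2)) (b c : S) :
    ∃ y', B x y' = b ∧ B (s x) y' = c := by
  obtain ⟨d, hd⟩ := hD.exists_left_inv
  have h1 : B x (s y) = -B (s x) y := h.skew' _ _
  have h2 : B (s x) (s y) = p * B x y := h.apply_s_s _ _
  refine ⟨(d * (p * B x y * b + B (s x) y * c)) • y + (d * (B x y * c - B (s x) y * b)) • s y,
    ?_, ?_⟩ <;> simp only [map_add, map_smul, smul_eq_mul, h1, h2]
  · linear_combination b * hd
  · linear_combination c * hd

theorem isEvenForm_of_halfIndex (h : IsHerm p B s)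
    (h1 : halfIndex s.toAddMonoidHom = 1) : IsEvenForm B := by
  intro x
  obtain ⟨y, hy⟩ := halfIndex_eq_one_iff.mp h1 x
  refine ⟨B x y, ?_⟩
  have := congrArg (B x) hy
  simp only [LinearMap.toAddMonoidHom_coe, map_add, h.apply_self, add_zero] at this
  rw [this, two_mul]

theorem UnimodAt.exists_not_dvd_add (hU : UnimodAt 2 B)
    (h1 : halfIndex s.toAddMonoidHom ≠ 1) : ∃ e f, ¬ 2 ∣ B e f + B (s e) f := by
  by_contra! hd
  refine h1 (halfIndex_eq_one_iff.mpr fun x => ?_)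
  obtain ⟨w, hw⟩ := hU (x + s x) fun y => by simpa using hd x y
  exact ⟨w, by rw [← two_smul S w]; exact hw⟩

theorem exists_unit_norm (h : IsHerm p B s)
    (hN : ∀ u : S, IsUnit u → ∃ a b : S, a ^ 2 + p * b ^ 2 = u) {x : M} {u c : S}
    (hu : IsUnit u) (hx : B x x = u * c) :
    ∃ a : S × S, B (spanR s x a) (spanR s x a) = c := by
  obtain ⟨u', hu'⟩ := hu.exists_left_inv
  obtain ⟨a, b, hab⟩ := hN u' (IsUnit.of_mul_eq_one _ hu')
  refine ⟨(a, b), ?_⟩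
  rw [form_spanR h, formR_apply, hx]
  linear_combination u * c * hab + c * hu'

theorem isometric_of_finrank_zero {M' : Type} [AddCommGroup M'] [Module S M']
    [Module.Finite S M] [Module.Free S M] [Module.Finite S M'] [Module.Free S M']
    (B : M →ₗ[S] M →ₗ[S] S) (s : M →ₗ[S] M) (B' : M' →ₗ[S] M' →ₗ[S] S) (s' : M' →ₗ[S] M')
    (h : Module.finrank S M = 0) (h' : Module.finrank S M' = 0) : Isometric B s B' s' := by
  have := Module.finrank_zero_iff.mp h
  have := Module.finrank_zero_iff.mp h'
  refine ⟨0, fun x y => ?_, fun x => Subsingleton.elim _ _⟩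
  rw [Subsingleton.elim x 0]; simp

theorem Isometric.of_split {M' E C C' : Type} [AddCommGroup M'] [Module S M']
    [AddCommGroup E] [Module S E] [AddCommGroup C] [Module S C] [AddCommGroup C'] [Module S C']
    {B' : M' →ₗ[S] M' →ₗ[S] S} {s' : M' →ₗ[S] M'} {β : E →ₗ[S] E →ₗ[S] S} {t : E →ₗ[S] E}
    {BC : C →ₗ[S] C →ₗ[S] S} {sC : C →ₗ[S] C} {BC' : C' →ₗ[S] C' →ₗ[S] S} {sC' : C' →ₗ[S] C'}
    (h1 : Isometric (prodForm β BC) (t.prodMap sC) B s)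
    (h2 : Isometric (prodForm β BC') (t.prodMap sC') B' s')
    (h3 : Isometric BC sC BC' sC') : Isometric B s B' s' :=
  h1.symm.trans ((h3.prod_right β t).trans h2)

end Generic

section LocalOdd

variable {l : ℕ} [Fact l.Prime]

theorem finrank_prod_self (S : Type) [CommRing S] [Nontrivial S] :
    Module.finrank S (S × S) = 2 := by
  rw [Module.finrank_prod, Module.finrank_self]

theorem finrank_prod_prod_self (S : Type) [CommRing S] [Nontrivial S] :
    Module.finrank S ((S × S) × (S × S)) = 4 := by
  rw [Module.finrank_prod, finrank_prod_self]

section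

variable {M : Type} [AddCommGroup M] [Module ℤ_[l] M] [Module.Finite ℤ_[l] M]
  [Module.Free ℤ_[l] M]
variable {p : ℕ} {B : M →ₗ[ℤ_[l]] M →ₗ[ℤ_[l]] ℤ_[l]} {s : M →ₗ[ℤ_[l]] M}

theorem exists_split_formR_of_ne (hp4 : p % 4 = 3) (hl2 : l ≠ 2) (hlp : ¬ l ∣ p)
    (h : IsHerm p B s) (hU : UnimodAt (l : ℤ_[l]) B) (hr : Module.finrank ℤ_[l] M ≠ 0) :
    ∃ (C : Type) (_ : AddCommGroup C) (_ : Module ℤ_[l] C) (_ : Module.Finite ℤ_[l] C)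
      (_ : Module.Free ℤ_[l] C) (BC : C →ₗ[ℤ_[l]] C →ₗ[ℤ_[l]] ℤ_[l]) (sC : C →ₗ[ℤ_[l]] C),
      Isometric (prodForm (formR p 1) BC) ((opR ℤ_[l] p).prodMap sC) B s ∧ IsHerm p BC sC ∧
      UnimodAt (l : ℤ_[l]) BC ∧ Module.finrank ℤ_[l] M = 2 + Module.finrank ℤ_[l] C := by
  have h2 := padicInt_isUnit_two hl2
  have hx : ∃ x, IsUnit (B x x) := by
    obtain ⟨x, y, hxy⟩ := hU.exists_not_dvd padicInt_not_isUnit_self hr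
    by_contra! hd
    simp only [padicInt_isUnit_iff, not_not] at hd
    have h3 : (l : ℤ_[l]) ∣ 2 * B x y := by
      have : 2 * B x y = B (x + y) (x + y) - B x x - B y y := by
        simp only [map_add, LinearMap.add_apply, h.symm y x]; ring
      rw [this]
      exact dvd_sub (dvd_sub (hd _) (hd _)) (hd _)
    exact hxy (h2.dvd_mul_left.mp h3)
  obtain ⟨x, hx⟩ := hx
  obtain ⟨a, ha⟩ := exists_unit_norm h (fun u hu => padicInt_exists_norm hp4 hlp hu) hx
    (mul_one _).symm
  obtain ⟨C, _, _, _, _, BC, sC, j, h1, h2, h3, h4, -⟩ := exists_split h hU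
    (spanR s (spanR s x a)) (fun u v => by rw [form_spanR h, ha]) (spanR_opR h _)
    (formR_perfect isUnit_one ((padicInt_isUnit_natCast_iff p).mpr hlp))
  exact ⟨C, _, _, ‹_›, ‹_›, BC, sC, h1, h2, h3, by rw [h4, finrank_prod_self]⟩

theorem exists_split_formP_of_eq [Fact p.Prime] {M : Type} [AddCommGroup M] [Module ℤ_[p] M]
    [Module.Finite ℤ_[p] M] [Module.Free ℤ_[p] M]
    {B : M →ₗ[ℤ_[p]] M →ₗ[ℤ_[p]] ℤ_[p]} {s : M →ₗ[ℤ_[p]] M} (hp2 : p ≠ 2)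
    (h : IsHerm p B s) (hU : UnimodAt (p : ℤ_[p]) B) (hr : Module.finrank ℤ_[p] M ≠ 0) :
    ∃ (C : Type) (_ : AddCommGroup C) (_ : Module ℤ_[p] C) (_ : Module.Finite ℤ_[p] C)
      (_ : Module.Free ℤ_[p] C) (BC : C →ₗ[ℤ_[p]] C →ₗ[ℤ_[p]] ℤ_[p]) (sC : C →ₗ[ℤ_[p]] C),
      Isometric (prodForm (formP p 0 0 0 1) BC) ((opP ℤ_[p] p).prodMap sC) B s ∧
      IsHerm p BC sC ∧ UnimodAt (p : ℤ_[p]) BC ∧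
      Module.finrank ℤ_[p] M = 4 + Module.finrank ℤ_[p] C := by
  obtain ⟨two', h2⟩ := (padicInt_isUnit_two hp2).exists_left_inv
  have hp0 : (p : ℤ_[p]) ≠ 0 := padicInt_prime.ne_zero
  have hunit : ∀ x y, ¬ (p : ℤ_[p]) ∣ B (s x) y →
      IsUnit (p * B x y ^ 2 + B (s x) y ^ 2) := fun x y hxy => by
    rw [add_comm]
    exact padicInt_isUnit_add (((padicInt_isUnit_iff _).mpr hxy).pow 2) ⟨_, rfl⟩
  obtain ⟨x, y, hxy⟩ := hU.exists_not_dvd_skew h padicInt_not_isUnit_self hp0 hr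
  obtain ⟨y, hy1, hy2⟩ := h.exists_adjust x y (hunit x y hxy) 0 1
  obtain ⟨t, ht⟩ := padicInt_exists_root ((p : ℤ_[p]) * B y y) (-2) (B x x) (two' * B x x)
    ⟨B y y * (two' * B x x) ^ 2, by linear_combination (-B x x) * h2⟩
    (by
      have h3 : (p : ℤ_[p]) ∣ 2 * (p * B y y) * (two' * B x x) :=
        ⟨2 * B y y * (two' * B x x), by ring⟩
      rw [add_comm]
      exact padicInt_isUnit_add (IsUnit.neg (padicInt_isUnit_two hp2)) h3)
  have hxs : B x (s y) = -1 := by rw [h.skew', hy2]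
  have hsx : B (s y) x = -1 := by rw [h.symm, hxs]
  have hx0 : B (x + t • s y) (x + t • s y) = 0 := by
    simp only [map_add, map_smul, LinearMap.add_apply, LinearMap.smul_apply, smul_eq_mul,
      h.apply_s_s, hxs, hsx]
    linear_combination ht
  have hx1 : ¬ (p : ℤ_[p]) ∣ B (s (x + t • s y)) y := by
    have : B (s (x + t • s y)) y = 1 - p * (t * B y y) := by
      simp only [map_add, map_smul, h.sq, LinearMap.add_apply, LinearMap.smul_apply, smul_eq_mul,
        LinearMap.map_neg, LinearMap.neg_apply, hy2]
      ring
    rw [this, ← padicInt_isUnit_iff, sub_eq_add_neg]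
    exact padicInt_isUnit_add isUnit_one ((dvd_mul_right _ _).neg_right)
  generalize x + t • s y = x at hx0 hx1
  obtain ⟨y, hy1, hy2⟩ := h.exists_adjust x y (hunit x y hx1) 0 1
  have hyx : B y (s x) = 1 := by rw [h.symm, hy2]
  set z := y + (-(two' * B y y)) • s x with hz
  have hz1 : B x z = 0 := by simp [hz, hy1, h.apply_self]
  have hz2 : B (s x) z = 1 := by simp [hz, hy2, h.apply_s_s, hx0]
  have hz0 : B z z = 0 := by
    simp only [hz, map_add, map_smul, LinearMap.add_apply, LinearMap.smul_apply, smul_eq_mul,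
      h.apply_s_s, hx0, hyx, hy2]
    linear_combination (-B y y) * h2
  obtain ⟨C, _, _, _, _, BC, sC, j, h1, h2, h3, h4, -⟩ := exists_split h hU
    (spanP s x z) (fun u v => by rw [form_spanP h, hx0, hz0, hz1, hz2]) (spanP_opP h _ _)
    (formP_perfect (by simp))
  exact ⟨C, _, _, ‹_›, ‹_›, BC, sC, h1, h2, h3, by rw [h4, finrank_prod_prod_self]⟩

end

theorem isometric_of_ne {p : ℕ} (hp4 : p % 4 = 3) (hl2 : l ≠ 2) (hlp : ¬ l ∣ p) (n : ℕ) :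
    ∀ {M : Type} [AddCommGroup M] [Module ℤ_[l] M] [Module.Finite ℤ_[l] M]
      [Module.Free ℤ_[l] M] {M' : Type} [AddCommGroup M'] [Module ℤ_[l] M']
      [Module.Finite ℤ_[l] M'] [Module.Free ℤ_[l] M']
      {B : M →ₗ[ℤ_[l]] M →ₗ[ℤ_[l]] ℤ_[l]} {s : M →ₗ[ℤ_[l]] M}
      {B' : M' →ₗ[ℤ_[l]] M' →ₗ[ℤ_[l]] ℤ_[l]} {s' : M' →ₗ[ℤ_[l]] M'},
      IsHerm p B s → UnimodAt (l : ℤ_[l]) B → IsHerm p B' s' → UnimodAt (l : ℤ_[l]) B' →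
      Module.finrank ℤ_[l] M = n → Module.finrank ℤ_[l] M' = n → Isometric B s B' s' := by
  induction n using Nat.strong_induction_on with
  | _ n ih =>
    intro M _ _ _ _ M' _ _ _ _ B s B' s' h hU h' hU' hr hr'
    rcases Nat.eq_zero_or_pos n with rfl | hn
    · exact isometric_of_finrank_zero _ _ _ _ hr hr'
    obtain ⟨C, _, _, _, _, BC, sC, h1, h2, h3, h4⟩ :=
      exists_split_formR_of_ne hp4 hl2 hlp h hU (by omega)
    obtain ⟨C', _, _, _, _, BC', sC', h1', h2', h3', h4'⟩ :=
      exists_split_formR_of_ne hp4 hl2 hlp h' hU' (by omega)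
    exact .of_split h1 h1' (ih (n - 2) (by omega) h2 h3 h2' h3' (by omega) (by omega))

theorem isometric_of_eq {p : ℕ} [Fact p.Prime] (hp2 : p ≠ 2) (n : ℕ) :
    ∀ {M : Type} [AddCommGroup M] [Module ℤ_[p] M] [Module.Finite ℤ_[p] M]
      [Module.Free ℤ_[p] M] {M' : Type} [AddCommGroup M'] [Module ℤ_[p] M']
      [Module.Finite ℤ_[p] M'] [Module.Free ℤ_[p] M']
      {B : M →ₗ[ℤ_[p]] M →ₗ[ℤ_[p]] ℤ_[p]} {s : M →ₗ[ℤ_[p]] M}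
      {B' : M' →ₗ[ℤ_[p]] M' →ₗ[ℤ_[p]] ℤ_[p]} {s' : M' →ₗ[ℤ_[p]] M'},
      IsHerm p B s → UnimodAt (p : ℤ_[p]) B → IsHerm p B' s' → UnimodAt (p : ℤ_[p]) B' →
      Module.finrank ℤ_[p] M = n → Module.finrank ℤ_[p] M' = n → Isometric B s B' s' := by
  induction n using Nat.strong_induction_on with
  | _ n ih =>
    intro M _ _ _ _ M' _ _ _ _ B s B' s' h hU h' hU' hr hr'
    rcases Nat.eq_zero_or_pos n with rfl | hn
    · exact isometric_of_finrank_zero _ _ _ _ hr hr'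
    obtain ⟨C, _, _, _, _, BC, sC, h1, h2, h3, h4⟩ :=
      exists_split_formP_of_eq hp2 h hU (by omega)
    obtain ⟨C', _, _, _, _, BC', sC', h1', h2', h3', h4'⟩ :=
      exists_split_formP_of_eq hp2 h' hU' (by omega)
    exact .of_split h1 h1' (ih (n - 4) (by omega) h2 h3 h2' h3' (by omega) (by omega))

end LocalOdd

section LocalTwo

variable {M : Type} [AddCommGroup M] [Module ℤ_[2] M] [Module.Finite ℤ_[2] M]
  [Module.Free ℤ_[2] M]
variable {p : ℕ} {B : M →ₗ[ℤ_[2]] M →ₗ[ℤ_[2]] ℤ_[2]} {s : M →ₗ[ℤ_[2]] M}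

theorem padicInt_two_isUnit_iff (x : ℤ_[2]) : IsUnit x ↔ ¬ (2 : ℤ_[2]) ∣ x := by
  simpa using padicInt_isUnit_iff (l := 2) x

theorem padicInt_isUnit_odd {p : ℕ} (hp4 : p % 4 = 3) : IsUnit (p : ℤ_[2]) := by
  rw [padicInt_isUnit_natCast_iff]; omega

theorem padicInt_two_dvd_norm_iff (hp4 : p % 4 = 3) (x y : ℤ_[2]) :
    2 ∣ p * x ^ 2 + y ^ 2 ↔ 2 ∣ x + y := by
  have h1 : (p : ℤ_[2]) * x ^ 2 + y ^ 2 =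
      (x + y) ^ 2 + 2 * (((p / 2 : ℕ) : ℤ_[2]) * x ^ 2 - x * y) := by
    have hp' : (p : ℤ_[2]) = 2 * ((p / 2 : ℕ) : ℤ_[2]) + 1 := by
      exact_mod_cast congrArg (Nat.cast : ℕ → ℤ_[2]) (show p = 2 * (p / 2) + 1 by omega)
    linear_combination x ^ 2 * hp'
  have h2 : Prime (2 : ℤ_[2]) := by simpa using padicInt_prime (l := 2)
  rw [h1, dvd_add_left (dvd_mul_right _ _), h2.dvd_pow_iff_dvd two_ne_zero]

/-- Splitting a block off a form that is unimodular over `ℤ₂`. -/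
def SplitsTwo (p : ℕ) {E : Type} [AddCommGroup E] [Module ℤ_[2] E]
    (β : E →ₗ[ℤ_[2]] E →ₗ[ℤ_[2]] ℤ_[2]) (t : E →ₗ[ℤ_[2]] E)
    (B : M →ₗ[ℤ_[2]] M →ₗ[ℤ_[2]] ℤ_[2]) (s : M →ₗ[ℤ_[2]] M) (P : Prop → ℕ → Prop) : Prop :=
  ∃ (C : Type) (_ : AddCommGroup C) (_ : Module ℤ_[2] C) (_ : Module.Finite ℤ_[2] C)
    (_ : Module.Free ℤ_[2] C) (BC : C →ₗ[ℤ_[2]] C →ₗ[ℤ_[2]] ℤ_[2]) (sC : C →ₗ[ℤ_[2]] C),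
    Isometric (prodForm β BC) (t.prodMap sC) B s ∧ IsHerm p BC sC ∧
    UnimodAt (2 : ℤ_[2]) BC ∧
    Module.finrank ℤ_[2] M = Module.finrank ℤ_[2] E + Module.finrank ℤ_[2] C ∧
    halfIndex s.toAddMonoidHom = halfIndex t.toAddMonoidHom * halfIndex sC.toAddMonoidHom ∧
    (IsEvenForm B ↔ IsEvenForm β ∧ IsEvenForm BC) ∧
    P (IsEvenForm BC) (halfIndex sC.toAddMonoidHom)

theorem splitsTwo_formO {q : ℕ} (hq : 4 * q = p + 1) (hp4 : p % 4 = 3)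
    (h : IsHerm p B s) (hU : UnimodAt (2 : ℤ_[2]) B) (hr : Module.finrank ℤ_[2] M ≠ 0)
    (h1 : halfIndex s.toAddMonoidHom = 1) :
    SplitsTwo p (formO q (1 : ℤ_[2])) (opO ℤ_[2] q) B s fun _ _ => True := by
  have hev := isEvenForm_of_halfIndex h h1
  have hx : ∃ x u, IsUnit u ∧ B x x = u * 2 := by
    obtain ⟨x, y, hxy⟩ := hU.exists_not_dvd padicInt_two_not_isUnit hr
    obtain ⟨a, ha⟩ := hev x
    obtain ⟨b, hb⟩ := hev y
    obtain ⟨c, hc⟩ := hev (x + y)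
    by_cases h2 : IsUnit a
    · exact ⟨x, a, h2, by rw [ha, mul_comm]⟩
    by_cases h3 : IsUnit b
    · exact ⟨y, b, h3, by rw [hb, mul_comm]⟩
    refine ⟨x + y, c, ?_, by rw [hc, mul_comm]⟩
    rw [padicInt_two_isUnit_iff] at h2 h3 ⊢
    rw [not_not] at h2 h3
    intro h4
    apply hxy
    have : B x y = c - a - b := by
      have h5 : 2 * B x y = 2 * (c - a - b) := by
        have : B (x + y) (x + y) = B x x + 2 * B x y + B y y := by
          simp only [map_add, LinearMap.add_apply, h.symm y x]; ring
        linear_combination hc - this - ha - hb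
      exact mul_left_cancel₀ two_ne_zero h5
    rw [this]
    exact dvd_sub (dvd_sub h4 h2) h3
  obtain ⟨x, u, hu, hx⟩ := hx
  obtain ⟨a, ha⟩ := exists_unit_norm h (fun u hu => padicInt_two_exists_norm hp4 hu) hu hx
  generalize spanR s x a = x at ha
  obtain ⟨w, hw⟩ := halfIndex_eq_one_iff.mp h1 x
  replace hw : x + s x = (2 : ℤ_[2]) • w := by rw [two_smul]; exact hw
  obtain ⟨C, _, _, _, _, BC, sC, j, h1, h2, h3, h4, -⟩ := exists_split h hU (spanO x w)
    (form_spanO hq h hw (u := 1) (by rw [ha, mul_one])) (spanO_opO hq h hw)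
    (formO_perfect hq isUnit_one (padicInt_isUnit_odd hp4))
  exact ⟨C, _, _, ‹_›, ‹_›, BC, sC, h1, h2, h3, h4,
    by rw [← h1.halfIndex_eq, halfIndex_prodMap],
    by rw [← isEvenForm_prod]; exact ⟨fun h => h.of_isometric h1.symm, fun h => h.of_isometric h1⟩,
    trivial⟩

theorem splitsTwo_formP (hp4 : p % 4 = 3)
    (h : IsHerm p B s) (hU : UnimodAt (2 : ℤ_[2]) B) (hev : IsEvenForm B)
    (h1 : halfIndex s.toAddMonoidHom ≠ 1) :
    SplitsTwo p (formP p (0 : ℤ_[2]) 0 1 0) (opP ℤ_[2] p) B s fun _ _ => True := by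
  have hunit : ∀ x y, ¬ (2 : ℤ_[2]) ∣ B x y + B (s x) y →
      IsUnit (p * B x y ^ 2 + B (s x) y ^ 2) := fun x y hxy => by
    rwa [padicInt_two_isUnit_iff, padicInt_two_dvd_norm_iff hp4]
  obtain ⟨x, y, hxy⟩ := hU.exists_not_dvd_add h1
  obtain ⟨y, hy1, hy2⟩ := h.exists_adjust x y (hunit x y hxy) 1 0
  obtain ⟨a, ha⟩ := hev x
  obtain ⟨d, hd⟩ := hev y
  have hpar : ∃ b t : ℤ_[2], 2 ∣ d * t ^ 2 + 1 * t + (a + d * p * b ^ 2) := by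
    by_cases h2 : (2 : ℤ_[2]) ∣ d
    · obtain ⟨k, rfl⟩ := h2
      exact ⟨0, a, k * a ^ 2 + a, by ring⟩
    · have h3 : (2 : ℤ_[2]) ∣ d + 1 := (padicInt_two_dvd d).resolve_left h2
      rcases padicInt_two_dvd a with h4 | h4
      · exact ⟨0, 0, by simpa using h4⟩
      · refine ⟨1, 0, ?_⟩
        obtain ⟨k, hk⟩ := h3
        obtain ⟨m, hm⟩ := h4
        have hp' : (p : ℤ_[2]) = 2 * ((p / 2 : ℕ) : ℤ_[2]) + 1 := by
          exact_mod_cast congrArg (Nat.cast : ℕ → ℤ_[2]) (show p = 2 * (p / 2) + 1 by omega)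
        refine ⟨m - 1 + k + d * ((p / 2 : ℕ) : ℤ_[2]), ?_⟩
        linear_combination hk + hm + d * hp'
  obtain ⟨b, t, hbt⟩ := hpar
  obtain ⟨t, ht⟩ := padicInt_exists_root (l := 2) d 1 (a + d * p * b ^ 2) t
    (by simpa using hbt) (by
      rw [add_comm]
      exact padicInt_isUnit_add isUnit_one ⟨d * t, by push_cast; ring⟩)
  have hxs : B x (s y) = 0 := by rw [h.skew', hy2, neg_zero]
  have hsx : B (s y) x = 0 := by rw [h.symm, hxs]
  have hyx : B y x = 1 := by rw [h.symm, hy1]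
  set e := x + t • y + b • s y with he
  have he0 : B e e = 0 := by
    simp only [he, map_add, map_smul, LinearMap.add_apply, LinearMap.smul_apply, smul_eq_mul,
      h.apply_s_s, hxs, hsx, h.apply_self, h.apply_self', hy1, hyx, ha, hd]
    linear_combination 2 * ht
  have he1 : ¬ (2 : ℤ_[2]) ∣ B e y + B (s e) y := by
    have : B e y + B (s e) y = 1 + 2 * (d * t - p * d * b) := by
      simp only [he, map_add, map_smul, LinearMap.add_apply, LinearMap.smul_apply, smul_eq_mul,
        h.sq, LinearMap.map_neg, LinearMap.neg_apply, h.apply_self', hy1, hy2, hd]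
      ring
    rw [this, ← padicInt_two_isUnit_iff]
    exact padicInt_isUnit_add isUnit_one (by simp)
  clear_value e
  obtain ⟨y, hy1, hy2⟩ := h.exists_adjust e y (hunit e y he1) 1 0
  obtain ⟨d, hd⟩ := hev y
  set z := y + (-d) • e with hz
  have hz1 : B e z = 1 := by simp [hz, hy1, he0]
  have hz2 : B (s e) z = 0 := by simp [hz, hy2, h.apply_self']
  have hz0 : B z z = 0 := by
    simp only [hz, map_add, map_smul, LinearMap.add_apply, LinearMap.smul_apply, smul_eq_mul,
      he0, h.symm y e, hy1, hd]
    ring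
  obtain ⟨C, _, _, _, _, BC, sC, j, h1, h2, h3, h4, -⟩ := exists_split h hU
    (spanP s e z) (fun u v => by rw [form_spanP h, he0, hz0, hz1, hz2]) (spanP_opP h _ _)
    (formP_perfect (by simpa using padicInt_isUnit_odd hp4))
  exact ⟨C, _, _, ‹_›, ‹_›, BC, sC, h1, h2, h3, h4,
    by rw [← h1.halfIndex_eq, halfIndex_prodMap],
    by rw [← isEvenForm_prod]; exact ⟨fun h => h.of_isometric h1.symm, fun h => h.of_isometric h1⟩,
    trivial⟩

theorem splitsTwo_formR (hp4 : p % 4 = 3)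
    (h : IsHerm p B s) (hU : UnimodAt (2 : ℤ_[2]) B) (hev : ¬ IsEvenForm B) :
    SplitsTwo p (formR p (1 : ℤ_[2])) (opR ℤ_[2] p) B s fun e k => e → k = 1 := by
  have hN : ∀ u : ℤ_[2], IsUnit u → ∃ a b : ℤ_[2], a ^ 2 + p * b ^ 2 = u :=
    fun u hu => padicInt_two_exists_norm hp4 hu
  have split : ∀ x, B x x = 1 → _ := fun x hx => exists_split h hU
    (spanR s x) (fun u v => by rw [form_spanR h, hx]) (spanR_opR h _)
    (formR_perfect isUnit_one (padicInt_isUnit_odd hp4))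
  simp only [IsEvenForm, not_forall, ← padicInt_two_isUnit_iff] at hev
  obtain ⟨x, hx⟩ := hev
  obtain ⟨a, ha⟩ := exists_unit_norm h hN hx (mul_one _).symm
  generalize spanR s x a = x at ha
  obtain ⟨C, _, _, _, _, BC, sC, j, h1, h2, h3, h4, hj, hjs, hjC⟩ := split x ha
  by_cases hC : IsEvenForm BC → halfIndex sC.toAddMonoidHom = 1
  · exact ⟨C, _, _, ‹_›, ‹_›, BC, sC, h1, h2, h3, h4,
      by rw [← h1.halfIndex_eq, halfIndex_prodMap],
      by
        rw [← isEvenForm_prod]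
        exact ⟨fun h => h.of_isometric h1.symm, fun h => h.of_isometric h1⟩, hC⟩
  push Not at hC
  obtain ⟨hC, hC1⟩ := hC
  obtain ⟨e, f, hef⟩ := h3.exists_not_dvd_add hC1
  have horth : ∀ c, B (j c) x = 0 ∧ B (j c) (s x) = 0 := fun c => by
    have := (hjC (j c)).mpr ⟨c, rfl⟩
    exact ⟨by simpa using this (1, 0), by simpa using this (0, 1)⟩
  obtain ⟨p', hp'⟩ := (padicInt_isUnit_odd hp4).exists_left_inv
  have hfe : B (j f) (j e) = BC e f := by rw [hj, h2.symm]
  have hfse : B (j f) (s (j e)) = BC (sC e) f := by rw [hjs, hj, h2.symm]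
  have h5 := fun c => (horth c).1
  have h6 := fun c => (horth c).2
  have h7 : ∀ c, B x (j c) = 0 := fun c => by rw [h.symm, h5]
  have h8 : ∀ c, B (s x) (j c) = 0 := fun c => by rw [h.symm, h6]
  obtain ⟨k, hk⟩ := hC e
  have hx' : IsUnit (B (x + j e) (x + j e)) := by
    have : B (x + j e) (x + j e) = 1 + 2 * k := by
      simp only [map_add, LinearMap.add_apply, ha, h5, h7, hj, hk]; ring
    rw [this]
    exact padicInt_isUnit_add isUnit_one (by simp)
  obtain ⟨a, ha'⟩ := exists_unit_norm h hN hx' (mul_one _).symm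
  obtain ⟨D, _, _, _, _, BD, sD, i, h1', h2', h3', h4', hi, his, hiD⟩ := split _ ha'
  refine ⟨D, _, _, ‹_›, ‹_›, BD, sD, h1', h2', h3', h4',
    by rw [← h1'.halfIndex_eq, halfIndex_prodMap],
    by
      rw [← isEvenForm_prod]
      exact ⟨fun h => h.of_isometric h1'.symm, fun h => h.of_isometric h1'⟩, fun hD => ?_⟩
  exfalso
  set z := j f + (-BC e f) • x + (-(p' * BC (sC e) f)) • s x with hz
  have hz1 : B z (x + j e) = 0 := by
    simp [hz, h5, h7, h8, h.apply_self', hfe, ha]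
  have hz2 : B z (s (x + j e)) = 0 := by
    simp only [hz, map_add, map_smul, LinearMap.add_apply, LinearMap.smul_apply, smul_eq_mul,
      h6, hjs, h7, h8, h.apply_self, h.apply_s_s, ha, ← hfse]
    linear_combination (-B (j f) (j (sC e))) * hp'
  obtain ⟨c, hc⟩ := (hiD z).mp fun u => by
    simp only [spanR_apply, map_add, map_smul, h.sq, smul_eq_mul, LinearMap.map_neg] at hz1 hz2 ⊢
    linear_combination (u.1 * a.1 - u.2 * a.2 * p) * hz1 + (u.1 * a.2 + u.2 * a.1) * hz2
  have hzz : (2 : ℤ_[2]) ∣ B z z := by rw [← hc, hi]; exact hD c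
  obtain ⟨m, hm⟩ := hC f
  have h9 : p * B z z = 2 * (p * m) + (p * BC e f ^ 2 + BC (sC e) f ^ 2) := by
    simp only [hz, map_add, map_smul, LinearMap.add_apply, LinearMap.smul_apply, smul_eq_mul,
      h5, h6, h7, h8, h.apply_self, h.apply_self', h.apply_s_s, ha, hj, hm]
    linear_combination (p' * p * BC (sC e) f ^ 2 + BC (sC e) f ^ 2) * hp'
  refine hef ((padicInt_two_dvd_norm_iff hp4 _ _).mp ?_)
  rw [← dvd_add_right (dvd_mul_right (2 : ℤ_[2]) (p * m)), ← h9]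
  exact hzz.mul_left _

end LocalTwo

section ClassifyTwo

theorem isometric_two {p : ℕ} (hp4 : p % 4 = 3) (n : ℕ) :
    ∀ {M : Type} [AddCommGroup M] [Module ℤ_[2] M] [Module.Finite ℤ_[2] M]
      [Module.Free ℤ_[2] M] {M' : Type} [AddCommGroup M'] [Module ℤ_[2] M']
      [Module.Finite ℤ_[2] M'] [Module.Free ℤ_[2] M']
      {B : M →ₗ[ℤ_[2]] M →ₗ[ℤ_[2]] ℤ_[2]} {s : M →ₗ[ℤ_[2]] M}
      {B' : M' →ₗ[ℤ_[2]] M' →ₗ[ℤ_[2]] ℤ_[2]} {s' : M' →ₗ[ℤ_[2]] M'},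
      IsHerm p B s → UnimodAt (2 : ℤ_[2]) B → IsHerm p B' s' → UnimodAt (2 : ℤ_[2]) B' →
      Module.finrank ℤ_[2] M = n → Module.finrank ℤ_[2] M' = n →
      halfIndex s.toAddMonoidHom = halfIndex s'.toAddMonoidHom →
      (IsEvenForm B ↔ IsEvenForm B') → Isometric B s B' s' := by
  obtain ⟨q, hq⟩ : ∃ q, 4 * q = p + 1 := ⟨(p + 1) / 4, by omega⟩
  induction n using Nat.strong_induction_on with
  | _ n ih =>
    intro M _ _ _ _ M' _ _ _ _ B s B' s' h hU h' hU' hr hr' hi he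
    rcases Nat.eq_zero_or_pos n with rfl | hn
    · exact isometric_of_finrank_zero _ _ _ _ hr hr'
    by_cases h1 : halfIndex s.toAddMonoidHom = 1
    · obtain ⟨C, _, _, _, _, BC, sC, h2, h3, h4, h5, h6, h7, -⟩ :=
        splitsTwo_formO hq hp4 h hU (by omega) h1
      obtain ⟨C', _, _, _, _, BC', sC', h2', h3', h4', h5', h6', h7', -⟩ :=
        splitsTwo_formO hq hp4 h' hU' (by omega) (by omega)
      rw [finrank_prod_self] at h5 h5'
      rw [halfIndex_opO, one_mul] at h6 h6'
      have hc := isEvenForm_of_halfIndex h3 (by omega)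
      have hc' := isEvenForm_of_halfIndex h3' (by omega)
      exact .of_split h2 h2' (ih (n - 2) (by omega) h3 h4 h3' h4' (by omega) (by omega)
        (by omega) (by tauto))
    by_cases h2 : IsEvenForm B
    · obtain ⟨C, _, _, _, _, BC, sC, h2, h3, h4, h5, h6, h7, -⟩ :=
        splitsTwo_formP hp4 h hU h2 h1
      obtain ⟨C', _, _, _, _, BC', sC', h2', h3', h4', h5', h6', h7', -⟩ :=
        splitsTwo_formP hp4 h' hU' (by tauto) (by omega)
      rw [finrank_prod_prod_self] at h5 h5'
      rw [halfIndex_opP (by omega) padicInt_two_dvd padicInt_two_not_isUnit] at h6 h6'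
      exact .of_split h2 h2' (ih (n - 4) (by omega) h3 h4 h3' h4' (by omega) (by omega)
        (by omega) (by tauto))
    · obtain ⟨C, _, _, _, _, BC, sC, h2, h3, h4, h5, h6, h7, h8⟩ :=
        splitsTwo_formR hp4 h hU h2
      obtain ⟨C', _, _, _, _, BC', sC', h2', h3', h4', h5', h6', h7', h8'⟩ :=
        splitsTwo_formR hp4 h' hU' (by tauto)
      rw [finrank_prod_self] at h5 h5'
      rw [halfIndex_opR (by omega) padicInt_two_dvd padicInt_two_not_isUnit] at h6 h6'
      have hc := isEvenForm_of_halfIndex h3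
      have hc' := isEvenForm_of_halfIndex h3'
      have hcc : halfIndex sC.toAddMonoidHom = halfIndex sC'.toAddMonoidHom := by omega
      rw [← hcc] at hc' h8'
      exact .of_split h2 h2' (ih (n - 2) (by omega) h3 h4 h3' h4' (by omega) (by omega)
        hcc (by tauto))

theorem halfIndex_two {p : ℕ} (hp4 : p % 4 = 3) (n : ℕ) :
    ∀ {M : Type} [AddCommGroup M] [Module ℤ_[2] M] [Module.Finite ℤ_[2] M]
      [Module.Free ℤ_[2] M]
      {B : M →ₗ[ℤ_[2]] M →ₗ[ℤ_[2]] ℤ_[2]} {s : M →ₗ[ℤ_[2]] M},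
      IsHerm p B s → UnimodAt (2 : ℤ_[2]) B → Module.finrank ℤ_[2] M = n →
      ∃ a, halfIndex s.toAddMonoidHom = 2 ^ a ∧ 2 * a ≤ n ∧ (IsEvenForm B → Even a) ∧
        (a = 0 → IsEvenForm B) := by
  obtain ⟨q, hq⟩ : ∃ q, 4 * q = p + 1 := ⟨(p + 1) / 4, by omega⟩
  induction n using Nat.strong_induction_on with
  | _ n ih =>
    intro M _ _ _ _ B s h hU hr
    by_cases h1 : halfIndex s.toAddMonoidHom = 1
    · exact ⟨0, by simpa using h1, by omega, by simp, fun _ => isEvenForm_of_halfIndex h h1⟩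
    have hn : n ≠ 0 := by
      rintro rfl
      have := Module.finrank_zero_iff.mp hr
      exact h1 (halfIndex_eq_one_iff.mpr fun x => ⟨0, Subsingleton.elim _ _⟩)
    by_cases h2 : IsEvenForm B
    · obtain ⟨C, _, _, _, _, BC, sC, h2, h3, h4, h5, h6, h7, -⟩ :=
        splitsTwo_formP hp4 h hU h2 h1
      rw [finrank_prod_prod_self] at h5
      rw [halfIndex_opP (by omega) padicInt_two_dvd padicInt_two_not_isUnit] at h6
      obtain ⟨a, ha1, ha2, ha3, -⟩ := ih (n - 4) (by omega) h3 h4 (by omega)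
      refine ⟨a + 2, by rw [h6, ha1]; ring, by omega, fun h => ?_, by omega⟩
      exact (ha3 (h7.mp h).2).add even_two
    · obtain ⟨C, _, _, _, _, BC, sC, h3, h3, h4, h5, h6, h7, h8⟩ :=
        splitsTwo_formR hp4 h hU h2
      rw [finrank_prod_self] at h5
      rw [halfIndex_opR (by omega) padicInt_two_dvd padicInt_two_not_isUnit] at h6
      obtain ⟨a, ha1, ha2, -⟩ := ih (n - 2) (by omega) h3 h4 (by omega)
      exact ⟨a + 1, by rw [h6, ha1]; ring, by omega, fun h => absurd h h2, by omega⟩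

end ClassifyTwo

section PadicForm

variable {M : Type} [AddCommGroup M]
variable (l : ℕ) [Fact l.Prime]

/-- The extension of scalars of a form to `ℤ_l`. -/
noncomputable def padicForm (B : M →ₗ[ℤ] M →ₗ[ℤ] ℤ) :
    (ℤ_[l] ⊗[ℤ] M) →ₗ[ℤ_[l]] (ℤ_[l] ⊗[ℤ] M) →ₗ[ℤ_[l]] ℤ_[l] :=
  LinearMap.BilinForm.baseChange ℤ_[l] B

/-- The extension of scalars of an operator to `ℤ_l`. -/
noncomputable def padicOp (s : M →ₗ[ℤ] M) : (ℤ_[l] ⊗[ℤ] M) →ₗ[ℤ_[l]] (ℤ_[l] ⊗[ℤ] M) :=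
  s.baseChange ℤ_[l]

@[simp] theorem padicForm_tmul (B : M →ₗ[ℤ] M →ₗ[ℤ] ℤ) (a b : ℤ_[l]) (x y : M) :
    padicForm l B (a ⊗ₜ x) (b ⊗ₜ y) = B x y * (a * b) := by
  rw [padicForm, LinearMap.BilinForm.baseChange_tmul, zsmul_eq_mul]

@[simp] theorem padicOp_tmul (s : M →ₗ[ℤ] M) (a : ℤ_[l]) (x : M) :
    padicOp l s (a ⊗ₜ x) = a ⊗ₜ s x := rfl

variable {l}

theorem padic_ext_form {N : Type} [AddCommGroup N] [Module ℤ_[l] N]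
    {F G : (ℤ_[l] ⊗[ℤ] M) →ₗ[ℤ_[l]] (ℤ_[l] ⊗[ℤ] M) →ₗ[ℤ_[l]] N}
    (h : ∀ x y, F (1 ⊗ₜ x) (1 ⊗ₜ y) = G (1 ⊗ₜ x) (1 ⊗ₜ y)) : F = G := by
  have key : ∀ (a : ℤ_[l]) (x : M), a ⊗ₜ[ℤ] x = a • (1 : ℤ_[l]) ⊗ₜ[ℤ] x := fun a x => by
    rw [TensorProduct.smul_tmul', smul_eq_mul, mul_one]
  refine LinearMap.ext fun u => LinearMap.ext fun v => ?_
  induction u using TensorProduct.induction_on with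
  | zero => simp
  | add u u' hu hu' => rw [map_add, map_add, LinearMap.add_apply, LinearMap.add_apply, hu, hu']
  | tmul a x =>
    induction v using TensorProduct.induction_on with
    | zero => simp
    | add v v' hv hv' => rw [map_add, map_add, hv, hv']
    | tmul b y => rw [key a, key b, map_smul, map_smul, map_smul, map_smul, LinearMap.smul_apply,
        LinearMap.smul_apply, h]

variable {p : ℕ} {B : M →ₗ[ℤ] M →ₗ[ℤ] ℤ} {s : M →ₗ[ℤ] M}

theorem IsHerm.padic (h : IsHerm p B s) : IsHerm p (padicForm l B) (padicOp l s) where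
  symm x y := by
    have : padicForm l B = (padicForm l B).flip :=
      padic_ext_form fun x y => by simp [h.symm x y]
    exact LinearMap.congr_fun₂ this x y
  skew x y := by
    have : (padicForm l B).comp (padicOp l s) = -(padicForm l B).compl₂ (padicOp l s) :=
      padic_ext_form fun x y => by simp [h.skew x y]
    exact LinearMap.congr_fun₂ this x y
  sq x := by
    induction x using TensorProduct.induction_on with
    | zero => simp
    | add x y hx hy => rw [map_add, map_add, hx, hy, smul_add, neg_add]
    | tmul a x =>
      rw [padicOp_tmul, padicOp_tmul, h.sq, TensorProduct.tmul_neg, TensorProduct.tmul_smul,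
        Nat.cast_smul_eq_nsmul, Nat.cast_smul_eq_nsmul]

theorem padic_exists_approx (x : ℤ_[l] ⊗[ℤ] M) :
    ∃ (x₀ : M) (z : ℤ_[l] ⊗[ℤ] M), x = 1 ⊗ₜ x₀ + (l : ℤ_[l]) • z := by
  induction x using TensorProduct.induction_on with
  | zero => exact ⟨0, 0, by simp⟩
  | add x y hx hy =>
    obtain ⟨x₀, z, rfl⟩ := hx
    obtain ⟨y₀, w, rfl⟩ := hy
    exact ⟨x₀ + y₀, z + w, by rw [TensorProduct.tmul_add, smul_add]; abel⟩
  | tmul a x =>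
    obtain ⟨n, hn⟩ : ∃ n : ℤ, (l : ℤ_[l]) ∣ a - n := by
      obtain ⟨n, hn⟩ := ZMod.intCast_surjective (PadicInt.toZMod a)
      exact ⟨n, by rw [← padicInt_toZMod_eq_zero_iff, map_sub, map_intCast, hn, sub_self]⟩
    obtain ⟨c, hc⟩ := hn
    refine ⟨n • x, c ⊗ₜ x, ?_⟩
    rw [← TensorProduct.smul_tmul, TensorProduct.smul_tmul', ← TensorProduct.add_tmul]
    congr 1
    rw [zsmul_eq_mul, mul_one, smul_eq_mul, ← hc]
    ring

theorem padicInt_dvd_intCast_iff (m : ℤ) : (l : ℤ_[l]) ∣ m ↔ (l : ℤ) ∣ m := by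
  simpa using PadicInt.pow_p_dvd_int_iff (p := l) 1 m

theorem UnimodAt.exists_smul_of_padic (hU : UnimodAt (l : ℤ) B) {x : M}
    {z : ℤ_[l] ⊗[ℤ] M} (hx : 1 ⊗ₜ x = (l : ℤ_[l]) • z) : ∃ w, x = (l : ℤ) • w := by
  refine hU x fun y => ?_
  rw [← padicInt_dvd_intCast_iff]
  refine ⟨padicForm l B z (1 ⊗ₜ y), ?_⟩
  rw [← smul_eq_mul, ← LinearMap.smul_apply, ← map_smul, ← hx]
  simp

theorem UnimodAt.padic (hU : UnimodAt (l : ℤ) B) : UnimodAt (l : ℤ_[l]) (padicForm l B) := by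
  intro x hx
  obtain ⟨x₀, z, rfl⟩ := padic_exists_approx x
  obtain ⟨w, hw⟩ := hU x₀ fun y => by
    rw [← padicInt_dvd_intCast_iff]
    have := hx (1 ⊗ₜ y)
    rw [map_add, LinearMap.add_apply, map_smul, LinearMap.smul_apply, smul_eq_mul,
      dvd_add_left (dvd_mul_right _ _)] at this
    simpa using this
  refine ⟨1 ⊗ₜ w + z, ?_⟩
  rw [hw, smul_add, ← TensorProduct.smul_tmul, TensorProduct.smul_tmul']
  simp

theorem halfIndex_padic (hU : UnimodAt (2 : ℤ) B) :
    halfIndex (padicOp 2 s).toAddMonoidHom = halfIndex s.toAddMonoidHom := by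
  refine (halfIndex_eq_of_map
    ((TensorProduct.mk ℤ ℤ_[2] M 1).toAddMonoidHom) (fun x => ?_) fun y => ?_).symm
  · simp only [mem_halfStable, LinearMap.toAddMonoidHom_coe, TensorProduct.mk_apply,
      padicOp_tmul, ← TensorProduct.tmul_add]
    constructor
    · rintro ⟨y, hy⟩
      rw [← two_smul ℤ_[2] y] at hy
      obtain ⟨w, hw⟩ := UnimodAt.exists_smul_of_padic (l := 2) hU (z := y) (by simpa using hy)
      exact ⟨w, by rw [hw, Nat.cast_ofNat, two_smul]⟩
    · rintro ⟨y, hy⟩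
      exact ⟨1 ⊗ₜ y, by rw [hy, TensorProduct.tmul_add]⟩
  · obtain ⟨x₀, z, rfl⟩ := padic_exists_approx y
    refine ⟨x₀, mem_halfStable.mpr ⟨-(z + padicOp 2 s z), ?_⟩⟩
    simp only [LinearMap.toAddMonoidHom_coe, TensorProduct.mk_apply, map_sub, map_add,
      Nat.cast_ofNat, two_smul]
    abel

theorem isEvenForm_padic_iff (h : IsHerm p B s) :
    IsEvenForm (padicForm 2 B) ↔ IsEvenForm B := by
  constructor
  · intro he x
    have h2 := he (1 ⊗ₜ x)
    rw [← Nat.cast_ofNat, ← padicInt_dvd_intCast_iff]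
    simpa using h2
  · intro he x
    obtain ⟨x₀, z, rfl⟩ := padic_exists_approx x
    obtain ⟨c, hc⟩ := he x₀
    refine ⟨c + 2 * padicForm 2 B (1 ⊗ₜ x₀) z + 2 * padicForm 2 B z z, ?_⟩
    simp only [map_add, map_smul, LinearMap.add_apply, LinearMap.smul_apply, smul_eq_mul,
      h.padic.symm z, padicForm_tmul, hc, Nat.cast_ofNat]
    push_cast
    ring

end PadicForm

section Classification

variable {M : Type} [AddCommGroup M] [Module.Finite ℤ M] [Module.Free ℤ M]
variable {M' : Type} [AddCommGroup M'] [Module.Finite ℤ M'] [Module.Free ℤ M']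
variable {p : ℕ} {B : M →ₗ[ℤ] M →ₗ[ℤ] ℤ} {s : M →ₗ[ℤ] M}
variable {B' : M' →ₗ[ℤ] M' →ₗ[ℤ] ℤ} {s' : M' →ₗ[ℤ] M'}

theorem isometric_padic_of_ne_two (hp : p.Prime) (hp4 : p % 4 = 3) {l : ℕ} [hl : Fact l.Prime]
    (hl2 : l ≠ 2) (h : IsHerm p B s) (hU : UnimodAt (l : ℤ) B)
    (h' : IsHerm p B' s') (hU' : UnimodAt (l : ℤ) B')
    (hr : Module.finrank ℤ M = Module.finrank ℤ M') :
    Isometric (padicForm l B) (padicOp l s) (padicForm l B') (padicOp l s') := by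
  by_cases hlp : l ∣ p
  · obtain rfl := (Nat.prime_dvd_prime_iff_eq hl.out hp).mp hlp
    exact isometric_of_eq hl2 (Module.finrank ℤ M) h.padic hU.padic h'.padic hU'.padic
      (by rw [Module.finrank_baseChange]) (by rw [Module.finrank_baseChange, hr])
  · exact isometric_of_ne hp4 hl2 hlp (Module.finrank ℤ M) h.padic hU.padic h'.padic hU'.padic
      (by rw [Module.finrank_baseChange]) (by rw [Module.finrank_baseChange, hr])

theorem isometric_padic_two_iff (hp4 : p % 4 = 3) (h : IsHerm p B s)
    (hU : UnimodAt (2 : ℤ) B) (h' : IsHerm p B' s') (hU' : UnimodAt (2 : ℤ) B')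
    (hr : Module.finrank ℤ M = Module.finrank ℤ M') :
    Isometric (padicForm 2 B) (padicOp 2 s) (padicForm 2 B') (padicOp 2 s') ↔
      halfIndex s.toAddMonoidHom = halfIndex s'.toAddMonoidHom ∧
        (IsEvenForm B ↔ IsEvenForm B') := by
  have h2 : UnimodAt (2 : ℤ_[2]) (padicForm 2 B) := by
    simpa using UnimodAt.padic (l := 2) hU
  have h2' : UnimodAt (2 : ℤ_[2]) (padicForm 2 B') := by
    simpa using UnimodAt.padic (l := 2) hU'
  rw [← halfIndex_padic hU, ← halfIndex_padic hU', ← isEvenForm_padic_iff h,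
    ← isEvenForm_padic_iff h']
  refine ⟨fun hI => ⟨hI.halfIndex_eq, fun he => he.of_isometric hI,
    fun he => he.of_isometric hI.symm⟩, fun ⟨h3, h4⟩ => ?_⟩
  exact isometric_two hp4 (Module.finrank ℤ M) h.padic h2 h'.padic h2'
    (by rw [Module.finrank_baseChange]) (by rw [Module.finrank_baseChange, hr]) h3 h4

theorem exists_halfIndex_eq (hp4 : p % 4 = 3) (h : IsHerm p B s) (hU : UnimodAt (2 : ℤ) B) :
    ∃ a, halfIndex s.toAddMonoidHom = 2 ^ a ∧ 2 * a ≤ Module.finrank ℤ M ∧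
      (IsEvenForm B → Even a) ∧ (a = 0 → IsEvenForm B) := by
  have h2 : UnimodAt (2 : ℤ_[2]) (padicForm 2 B) := by
    simpa using UnimodAt.padic (l := 2) hU
  rw [← halfIndex_padic hU, ← isEvenForm_padic_iff h]
  exact halfIndex_two hp4 (Module.finrank ℤ M) h.padic h2 (by rw [Module.finrank_baseChange])

end Classification

section Lattice

variable {V : Type} [AddCommGroup V] [Module ℚ V]
variable {M : Type} [AddCommGroup M]

/-- `j` embeds the integral module `(M, b, t)` in the rational space `(V, B, s)`. -/
structure IsModel (B : V →ₗ[ℚ] V →ₗ[ℚ] ℚ) (s : V →ₗ[ℚ] V) (b : M →ₗ[ℤ] M →ₗ[ℤ] ℤ)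
    (t : M →ₗ[ℤ] M) (j : M →ₗ[ℤ] V) : Prop where
  injective : Function.Injective j
  form : ∀ x y, (b x y : ℚ) = B (j x) (j y)
  op : ∀ x, j (t x) = s (j x)

/-- `L` is an `s`-stable lattice which is self-dual for `B`. -/
structure IsUnimodLat (B : V →ₗ[ℚ] V →ₗ[ℚ] ℚ) (s : V →ₗ[ℚ] V) (L : Submodule ℤ V) : Prop where
  stable : ∀ v ∈ L, s v ∈ L
  fg : L.FG
  span : Submodule.span ℚ (L : Set V) = ⊤
  mem_iff : ∀ v, v ∈ L ↔ ∀ y ∈ L, ∃ m : ℤ, B v y = m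

variable {p : ℕ} {B : V →ₗ[ℚ] V →ₗ[ℚ] ℚ} {s : V →ₗ[ℚ] V}

theorem map_ratCast_smul_int (j : M →ₗ[ℤ] V) (m : ℤ) (x : M) : j (m • x) = (m : ℚ) • j x := by
  rw [map_smul, Int.cast_smul_eq_zsmul]

theorem IsModel.isHerm {b : M →ₗ[ℤ] M →ₗ[ℤ] ℤ} {t : M →ₗ[ℤ] M} {j : M →ₗ[ℤ] V}
    (hj : IsModel B s b t j) (h : IsHerm p B s) : IsHerm p b t where
  symm x y := by
    have : (b x y : ℚ) = b y x := by rw [hj.form, hj.form, h.symm]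
    exact_mod_cast this
  skew x y := by
    have : (b (t x) y : ℚ) = -b x (t y) := by rw [hj.form, hj.form, hj.op, hj.op, h.skew]
    exact_mod_cast this
  sq x := by
    apply hj.injective
    rw [hj.op, hj.op, h.sq, map_neg, map_ratCast_smul_int]
    simp

theorem finite_free_of_fg {L : Submodule ℤ V} (hL : L.FG) :
    Module.Finite ℤ L ∧ Module.Free ℤ L := by
  have : IsAddTorsionFree V := IsAddTorsionFree.of_module_rat V
  have : Module.Finite ℤ L := Module.Finite.iff_fg.mpr hL
  exact ⟨this, inferInstance⟩

theorem IsUnimodLat.exists_model {L : Submodule ℤ V} (hL : IsUnimodLat B s L) :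
    ∃ (b : L →ₗ[ℤ] L →ₗ[ℤ] ℤ) (t : L →ₗ[ℤ] L), IsModel B s b t L.subtype := by
  have h1 : ∀ x y : L, ∃ m : ℤ, B x y = m := fun x y => (hL.mem_iff x).mp x.2 y y.2
  choose f hf using h1
  refine ⟨LinearMap.mk₂ ℤ f (fun x y z => ?_) (fun c x y => ?_) (fun x y z => ?_)
    (fun c x y => ?_), ((s.restrictScalars ℤ).restrict hL.stable), L.injective_subtype,
    fun x y => (hf x y).symm, fun x => rfl⟩
  all_goals
    apply Int.cast_injective (α := ℚ)
    simp only [Int.cast_add, ← hf, Submodule.coe_add, map_add, LinearMap.add_apply,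
      Int.cast_mul, smul_eq_mul]
    try simp [map_zsmul]

theorem IsUnimodLat.unimodAt {L : Submodule ℤ V} (hL : IsUnimodLat B s L)
    {b : L →ₗ[ℤ] L →ₗ[ℤ] ℤ} {t : L →ₗ[ℤ] L} (hj : IsModel B s b t L.subtype) {l : ℤ}
    (hl : l ≠ 0) : UnimodAt l b := by
  intro x hx
  have hlq : (l : ℚ) ≠ 0 := by exact_mod_cast hl
  have hv : (l : ℚ)⁻¹ • (x : V) ∈ L := by
    rw [hL.mem_iff]
    intro y hy
    obtain ⟨c, hc⟩ := hx ⟨y, hy⟩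
    refine ⟨c, ?_⟩
    have := hj.form x ⟨y, hy⟩
    rw [hc] at this
    push_cast at this
    rw [map_smul, LinearMap.smul_apply, smul_eq_mul]
    simp only [Submodule.subtype_apply] at this
    rw [← this, inv_mul_cancel_left₀ hlq]
  refine ⟨⟨_, hv⟩, Subtype.ext ?_⟩
  rw [Submodule.coe_smul, ← Int.cast_smul_eq_zsmul ℚ, smul_inv_smul₀ hlq]

/-- A basis of `V` coming from a basis of a full integral module in `V`. -/
theorem exists_basis_of_span {j : M →ₗ[ℤ] V} (hj : Function.Injective j)
    (hs : Submodule.span ℚ (Set.range j) = ⊤) {ι : Type} (b : Module.Basis ι ℤ M) :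
    ∃ β : Module.Basis ι ℚ V, ∀ i, β i = j (b i) := by
  have h1 : LinearIndependent ℤ fun i => j (b i) :=
    b.linearIndependent.map' j (LinearMap.ker_eq_bot.mpr hj)
  have h2 := (LinearIndependent.iff_fractionRing ℤ ℚ).mp h1
  refine ⟨Module.Basis.mk h2 ?_, fun i => Module.Basis.mk_apply ..⟩
  rw [← hs, Submodule.span_le]
  rintro _ ⟨x, rfl⟩
  rw [← b.linearCombination_repr x, Finsupp.linearCombination_apply, Finsupp.sum, map_sum]
  refine Submodule.sum_mem _ fun i _ => ?_
  rw [map_ratCast_smul_int]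
  exact Submodule.smul_mem _ _ (Submodule.subset_span ⟨i, rfl⟩)

theorem finrank_of_span [Module.Free ℤ M] {j : M →ₗ[ℤ] V} (hj : Function.Injective j)
    (hs : Submodule.span ℚ (Set.range j) = ⊤) : Module.finrank ℤ M = Module.finrank ℚ V := by
  obtain ⟨β, -⟩ := exists_basis_of_span hj hs (Module.Free.chooseBasis ℤ M)
  rw [Module.finrank_eq_nat_card_basis β,
    Module.finrank_eq_nat_card_basis (Module.Free.chooseBasis ℤ M)]

end Lattice

section LocalMap

variable {V : Type} [AddCommGroup V] [Module ℚ V]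
variable {M : Type} [AddCommGroup M]
variable (l : ℕ) [Fact l.Prime]

/-- The map from the completion of an integral module to the completion of a rational space. -/
noncomputable def localMap (j : M →ₗ[ℤ] V) : (ℤ_[l] ⊗[ℤ] M) →ₗ[ℤ_[l]] (ℚ_[l] ⊗[ℚ] V) :=
  LinearMap.liftBaseChange ℤ_[l]
    (((TensorProduct.mk ℚ ℚ_[l] V 1).restrictScalars ℤ) ∘ₗ j)

theorem localMap_one_tmul (j : M →ₗ[ℤ] V) (x : M) : localMap l j (1 ⊗ₜ x) = 1 ⊗ₜ j x := by
  simp [localMap]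

theorem range_localMap_subtype (L : Submodule ℤ V) :
    LinearMap.range (localMap l L.subtype) = latCompl V l L := by
  apply le_antisymm
  · rintro _ ⟨u, rfl⟩
    induction u using TensorProduct.induction_on with
    | zero => rw [map_zero]; exact zero_mem _
    | add u v hu hv => rw [map_add]; exact add_mem hu hv
    | tmul a x =>
      rw [localMap, LinearMap.liftBaseChange_tmul]
      exact Submodule.smul_mem _ _ (Submodule.subset_span ⟨x, x.2, rfl⟩)
  · rw [latCompl, Submodule.span_le]
    rintro _ ⟨x, hx, rfl⟩
    exact ⟨1 ⊗ₜ ⟨x, hx⟩, localMap_one_tmul l _ _⟩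

theorem exists_localBasis [Module.Free ℤ M] {j : M →ₗ[ℤ] V} (hj : Function.Injective j)
    (hs : Submodule.span ℚ (Set.range j) = ⊤) :
    ∃ (ι : Type) (β : Module.Basis ι ℤ_[l] (ℤ_[l] ⊗[ℤ] M))
      (β' : Module.Basis ι ℚ_[l] (ℚ_[l] ⊗[ℚ] V)), ∀ i, β' i = localMap l j (β i) := by
  obtain ⟨β, hβ⟩ := exists_basis_of_span hj hs (Module.Free.chooseBasis ℤ M)
  refine ⟨_, Algebra.TensorProduct.basis ℤ_[l] (Module.Free.chooseBasis ℤ M),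
    Algebra.TensorProduct.basis ℚ_[l] β, fun i => ?_⟩
  rw [Algebra.TensorProduct.basis_apply, Algebra.TensorProduct.basis_apply, localMap_one_tmul, hβ]

theorem localMap_injective [Module.Free ℤ M] {j : M →ₗ[ℤ] V} (hj : Function.Injective j)
    (hs : Submodule.span ℚ (Set.range j) = ⊤) : Function.Injective (localMap l j) := by
  obtain ⟨ι, β, β', h⟩ := exists_localBasis l hj hs
  have h1 : LinearIndependent ℤ_[l] (localMap l j ∘ β) := by
    have := β'.linearIndependent.restrict_scalars (R := ℤ_[l]) (by
      intro a b hab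
      simpa using hab)
    convert this using 1
    exact funext fun i => (h i).symm
  rw [injective_iff_map_eq_zero]
  intro u hu
  rw [← β.linearCombination_repr u, Finsupp.apply_linearCombination] at hu
  have := (linearIndependent_iff.mp h1) _ hu
  simpa using this

end LocalMap

section LocalForm

variable {K : Type} [Field K] [Algebra ℚ K] {sp : K}
variable {V : Type} [AddCommGroup V] [Module ℚ V] [Module K V] [IsScalarTower ℚ K V]
variable {φ : V →ₗ[ℚ] V →ₗ[ℚ] K} {p : ℕ} {B : V →ₗ[ℚ] V →ₗ[ℚ] ℚ} {s : V →ₗ[ℚ] V}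
variable (l : ℕ) [Fact l.Prime]

/-- The rational form and operator describing the hermitian form `φ`. -/
structure IsRealization (sp : K) (φ : V →ₗ[ℚ] V →ₗ[ℚ] K) (p : ℕ)
    (B : V →ₗ[ℚ] V →ₗ[ℚ] ℚ) (s : V →ₗ[ℚ] V) : Prop where
  form : ∀ x y, φ x y = algebraMap ℚ K (p * B x y) - algebraMap ℚ K (B (s x) y) * sp
  op : ∀ x, s x = sp • x

theorem localForm_one_tmul (x y : V) :
    localForm K V φ l (1 ⊗ₜ x) (1 ⊗ₜ y) = 1 ⊗ₜ φ x y := by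
  simp [localForm]

theorem actK_tmul (a : K) (c : ℚ_[l]) (x : V) : actK K V l a (c ⊗ₜ x) = c ⊗ₜ (a • x) := by
  simp [actK]

theorem actK_add_mul (q r : ℚ) (a : K) (w : ℚ_[l] ⊗[ℚ] V) :
    actK K V l (algebraMap ℚ K q + algebraMap ℚ K r * a) w =
      (q : ℚ_[l]) • w + (r : ℚ_[l]) • actK K V l a w := by
  induction w using TensorProduct.induction_on with
  | zero => simp
  | add u v hu hv =>
    simp only [map_add, smul_add, hu, hv]
    abel
  | tmul c x =>
    have h : ∀ (m : ℚ) (v : V), (m : ℚ_[l]) • c ⊗ₜ[ℚ] v = c ⊗ₜ[ℚ] (m • v) := fun m v => by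
      rw [TensorProduct.tmul_smul, Rat.cast_smul_eq_qsmul]
    rw [actK_tmul, actK_tmul, h, h, ← TensorProduct.tmul_add, add_smul, mul_smul,
      algebraMap_smul, algebraMap_smul]

variable {M : Type} [AddCommGroup M]
variable {b : M →ₗ[ℤ] M →ₗ[ℤ] ℤ} {t : M →ₗ[ℤ] M} {j : M →ₗ[ℤ] V}

theorem localMap_padicOp (hR : IsRealization sp φ p B s) (hj : IsModel B s b t j)
    (u : ℤ_[l] ⊗[ℤ] M) :
    localMap l j (padicOp l t u) = actK K V l sp (localMap l j u) := by
  induction u using TensorProduct.induction_on with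
  | zero => simp
  | add u v hu hv => simp only [map_add, hu, hv]
  | tmul a x =>
    rw [padicOp_tmul, localMap, LinearMap.liftBaseChange_tmul, LinearMap.liftBaseChange_tmul,
      LinearMap.comp_apply, hj.op, hR.op]
    change a • (1 : ℚ_[l]) ⊗ₜ[ℚ] (sp • j x) = actK K V l sp (a • (1 : ℚ_[l]) ⊗ₜ[ℚ] j x)
    rw [TensorProduct.smul_tmul', TensorProduct.smul_tmul', actK_tmul]

theorem localForm_localMap (hR : IsRealization sp φ p B s) (hj : IsModel B s b t j)
    (u v : ℤ_[l] ⊗[ℤ] M) :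
    localForm K V φ l (localMap l j u) (localMap l j v) =
      padicForm l b u v • ((1 : ℚ_[l]) ⊗ₜ[ℚ] (p : K)) -
        padicForm l b (padicOp l t u) v • ((1 : ℚ_[l]) ⊗ₜ[ℚ] sp) := by
  have key : ((localForm K V φ l).restrictScalars₁₂ ℤ_[l] ℤ_[l]).compl₁₂
        (localMap l j) (localMap l j) =
      (padicForm l b).compr₂ (LinearMap.toSpanSingleton ℤ_[l] _ ((1 : ℚ_[l]) ⊗ₜ[ℚ] (p : K))) -
      ((padicForm l b).comp (padicOp l t)).compr₂
        (LinearMap.toSpanSingleton ℤ_[l] _ ((1 : ℚ_[l]) ⊗ₜ[ℚ] sp)) := by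
    refine padic_ext_form fun x y => ?_
    simp only [LinearMap.compl₁₂_apply, LinearMap.restrictScalars₁₂_apply_apply,
      localMap_one_tmul, localForm_one_tmul, LinearMap.sub_apply, LinearMap.compr₂_apply,
      LinearMap.comp_apply, padicOp_tmul, padicForm_tmul, LinearMap.toSpanSingleton_apply,
      mul_one, hR.form, ← hj.op, ← hj.form]
    rw [Int.cast_smul_eq_zsmul, Int.cast_smul_eq_zsmul, ← TensorProduct.tmul_smul,
      ← TensorProduct.tmul_smul, ← TensorProduct.tmul_sub, map_mul, map_natCast, map_intCast,
      map_intCast, zsmul_eq_mul,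
      zsmul_eq_mul, mul_comm (p : K)]
  exact LinearMap.congr_fun₂ key u v

variable {M' : Type} [AddCommGroup M']
variable {b' : M' →ₗ[ℤ] M' →ₗ[ℤ] ℤ} {t' : M' →ₗ[ℤ] M'} {j' : M' →ₗ[ℤ] V}

theorem localForm_localMap_eq_iff (hp : p ≠ 0)
    (hre : ∃ re : K →ₗ[ℚ] ℚ, re 1 = 1 ∧ re sp = 0)
    (hR : IsRealization sp φ p B s) (hj : IsModel B s b t j) (hj' : IsModel B s b' t' j')
    (e : (ℤ_[l] ⊗[ℤ] M) → (ℤ_[l] ⊗[ℤ] M'))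
    (he : ∀ u, e (padicOp l t u) = padicOp l t' (e u)) :
    (∀ u v, localForm K V φ l (localMap l j' (e u)) (localMap l j' (e v)) =
      localForm K V φ l (localMap l j u) (localMap l j v)) ↔
    ∀ u v, padicForm l b' (e u) (e v) = padicForm l b u v := by
  simp only [localForm_localMap l hR hj, localForm_localMap l hR hj', ← he]
  refine ⟨fun h u v => ?_, fun h u v => by rw [h, h]⟩
  obtain ⟨re, h1, h2⟩ := hre
  have hp1 : re (p : K) = p := by
    have : (p : K) = (p : ℚ) • (1 : K) := by simp [Nat.cast_smul_eq_nsmul]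
    rw [this, map_smul, h1]; simp
  let R : (ℚ_[l] ⊗[ℚ] K) →ₗ[ℚ_[l]] ℚ_[l] :=
    LinearMap.liftBaseChange ℚ_[l] (Algebra.linearMap ℚ ℚ_[l] ∘ₗ re)
  have hRs : ∀ (c : ℤ_[l]) (k : K), R (c • ((1 : ℚ_[l]) ⊗ₜ[ℚ] k)) = (c : ℚ_[l]) * (re k : ℚ) := by
    intro c k
    rw [TensorProduct.smul_tmul', LinearMap.liftBaseChange_tmul]
    simp [Algebra.smul_def]
  have h3 := congrArg R (h u v)
  rw [map_sub, map_sub, hRs, hRs, hRs, hRs, h2, hp1] at h3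
  have hpl : ((p : ℚ) : ℚ_[l]) ≠ 0 := by
    rw [Rat.cast_natCast]; exact_mod_cast hp
  exact PadicInt.ext (by simpa [hp] using h3)

theorem sameGenusAt_of_isometric [FiniteDimensional ℚ V] (hp : p ≠ 0)
    (hre : ∃ re : K →ₗ[ℚ] ℚ, re 1 = 1 ∧ re sp = 0)
    (hK : ∀ a : K, ∃ q r : ℚ, a = algebraMap ℚ K q + algebraMap ℚ K r * sp)
    (hR : IsRealization sp φ p B s) {L L' : Submodule ℤ V}
    [Module.Free ℤ L] [Module.Free ℤ L']
    (hs : Submodule.span ℚ (L : Set V) = ⊤) (hs' : Submodule.span ℚ (L' : Set V) = ⊤)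
    {b : L →ₗ[ℤ] L →ₗ[ℤ] ℤ} {t : L →ₗ[ℤ] L} (hj : IsModel B s b t L.subtype)
    {b' : L' →ₗ[ℤ] L' →ₗ[ℤ] ℤ} {t' : L' →ₗ[ℤ] L'} (hj' : IsModel B s b' t' L'.subtype)
    (hI : Isometric (padicForm l b) (padicOp l t) (padicForm l b') (padicOp l t')) :
    SameGenusAt K V φ l L L' := by
  obtain ⟨e, he, het⟩ := hI
  obtain ⟨ι, β, γ, hγ⟩ := exists_localBasis l hj.injective (by simpa using hs)
  obtain ⟨ι', β', γ', hγ'⟩ := exists_localBasis l hj'.injective (by simpa using hs')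
  let g₀ : (ℚ_[l] ⊗[ℚ] V) →ₗ[ℚ_[l]] (ℚ_[l] ⊗[ℚ] V) :=
    γ.constr ℚ_[l] fun i => localMap l L'.subtype (e (β i))
  have hg : ∀ u, g₀ (localMap l L.subtype u) = localMap l L'.subtype (e u) := by
    have : g₀.restrictScalars ℤ_[l] ∘ₗ localMap l L.subtype =
        localMap l L'.subtype ∘ₗ e.toLinearMap := β.ext fun i => by
      simp [← hγ, g₀]
    exact fun u => LinearMap.congr_fun this u
  have hsurj : Function.Surjective g₀ := by
    rw [← LinearMap.range_eq_top, eq_top_iff, ← γ'.span_eq, Submodule.span_le]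
    rintro _ ⟨i, rfl⟩
    exact ⟨localMap l L.subtype (e.symm (β' i)), by rw [hg, e.apply_symm_apply, hγ']⟩
  let g := LinearEquiv.ofBijective g₀ ⟨LinearMap.injective_iff_surjective.mpr hsurj, hsurj⟩
  have hg' : ∀ u, g (localMap l L.subtype u) = localMap l L'.subtype (e u) := hg
  have hsp : ∀ w, g (actK K V l sp w) = actK K V l sp (g w) := by
    have : g.toLinearMap ∘ₗ actK K V l sp = actK K V l sp ∘ₗ g.toLinearMap := γ.ext fun i => by
      simp only [LinearMap.comp_apply, LinearEquiv.coe_coe, hγ, hg',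
        ← localMap_padicOp l hR hj, ← localMap_padicOp l hR hj', het]
    exact fun w => LinearMap.congr_fun this w
  refine ⟨g, fun a w => ?_, fun w w' => ?_, ?_⟩
  · obtain ⟨q, r, rfl⟩ := hK a
    rw [actK_add_mul, actK_add_mul, map_add, map_smul, map_smul, hsp]
  · have : (localForm K V φ l).compl₁₂ g.toLinearMap g.toLinearMap = localForm K V φ l :=
      γ.ext fun i => γ.ext fun k => by
        simp only [LinearMap.compl₁₂_apply, LinearEquiv.coe_coe, hγ, hg']
        exact (localForm_localMap_eq_iff l hp hre hR hj hj' e het).mpr he _ _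
    exact LinearMap.congr_fun₂ this w w'
  · rw [← range_localMap_subtype, ← range_localMap_subtype]
    ext w
    constructor
    · rintro ⟨_, ⟨u, rfl⟩, rfl⟩
      exact ⟨e u, (hg' u).symm⟩
    · rintro ⟨u, rfl⟩
      exact ⟨_, ⟨e.symm u, rfl⟩, by rw [hg', e.apply_symm_apply]⟩

theorem isometric_of_sameGenusAt (hp : p ≠ 0)
    (hre : ∃ re : K →ₗ[ℚ] ℚ, re 1 = 1 ∧ re sp = 0)
    (hR : IsRealization sp φ p B s) {L L' : Submodule ℤ V}
    [Module.Free ℤ L] [Module.Free ℤ L']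
    (hs : Submodule.span ℚ (L : Set V) = ⊤) (hs' : Submodule.span ℚ (L' : Set V) = ⊤)
    {b : L →ₗ[ℤ] L →ₗ[ℤ] ℤ} {t : L →ₗ[ℤ] L} (hj : IsModel B s b t L.subtype)
    {b' : L' →ₗ[ℤ] L' →ₗ[ℤ] ℤ} {t' : L' →ₗ[ℤ] L'} (hj' : IsModel B s b' t' L'.subtype)
    (hG : SameGenusAt K V φ l L L') :
    Isometric (padicForm l b) (padicOp l t) (padicForm l b') (padicOp l t') := by
  obtain ⟨g, hgK, hgf, hgL⟩ := hG
  have hinj := localMap_injective l hj.injective (by simpa using hs)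
  have hinj' := localMap_injective l hj'.injective (by simpa using hs')
  rw [← range_localMap_subtype, ← range_localMap_subtype] at hgL
  have hmap : (LinearMap.range (localMap l L.subtype)).map
      ((g.restrictScalars ℤ_[l]).toLinearMap) = LinearMap.range (localMap l L'.subtype) :=
    SetLike.coe_injective hgL
  let e : (ℤ_[l] ⊗[ℤ] L) ≃ₗ[ℤ_[l]] (ℤ_[l] ⊗[ℤ] L') :=
    LinearEquiv.ofInjective _ hinj ≪≫ₗ (g.restrictScalars ℤ_[l]).submoduleMap _ ≪≫ₗ
      LinearEquiv.ofEq _ _ hmap ≪≫ₗ (LinearEquiv.ofInjective _ hinj').symm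
  have he : ∀ u, localMap l L'.subtype (e u) = g (localMap l L.subtype u) := by
    intro u
    have : LinearEquiv.ofInjective _ hinj' (e u) = LinearEquiv.ofEq _ _ hmap
        ((g.restrictScalars ℤ_[l]).submoduleMap _ (LinearEquiv.ofInjective _ hinj u)) :=
      LinearEquiv.apply_symm_apply _ _
    simpa using congrArg Subtype.val this
  have het : ∀ u, e (padicOp l t u) = padicOp l t' (e u) := by
    intro u
    apply hinj'
    rw [he, localMap_padicOp l hR hj, localMap_padicOp l hR hj', he, hgK]
  refine ⟨e, (localForm_localMap_eq_iff l hp hre hR hj hj' e het).mp fun u v => ?_, het⟩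
  rw [he, he, hgf]

end LocalForm

section Realization

variable {K : Type} [Field K] [Algebra ℚ K] {sp : K} {p : ℕ}

theorem linearIndependent_one_sqrt (hp : p.Prime) (hsp : sp ^ 2 = -(p : K)) :
    LinearIndependent ℚ ![(1 : K), sp] := by
  have hp0 : (0 : ℚ) < p := by exact_mod_cast hp.pos
  rw [LinearIndependent.pair_iff]
  intro q r h
  have h1 : algebraMap ℚ K r * sp = -algebraMap ℚ K q := by
    rw [Algebra.smul_def, Algebra.smul_def, mul_one] at h
    linear_combination h
  have h2 : algebraMap ℚ K (r ^ 2 * p + q ^ 2) = 0 := by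
    have : algebraMap ℚ K (r ^ 2 * p + q ^ 2) =
        -(algebraMap ℚ K r * sp) ^ 2 + (algebraMap ℚ K q) ^ 2 := by
      rw [mul_pow, hsp, map_add, map_mul, map_pow, map_pow, map_natCast]; ring
    rw [this, h1]; ring
  have h3 : r ^ 2 * p + q ^ 2 = 0 := (map_eq_zero _).mp h2
  have hr : r ^ 2 * p = 0 := by nlinarith [sq_nonneg q, mul_nonneg (sq_nonneg r) hp0.le]
  have hq : q ^ 2 = 0 := by linarith
  exact ⟨by simpa using hq, by simpa [hp0.ne'] using hr⟩

theorem exists_coordinates (hp : p.Prime) (hK2 : Module.finrank ℚ K = 2)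
    (hsp : sp ^ 2 = -(p : K)) :
    ∃ re im : K →ₗ[ℚ] ℚ, re 1 = 1 ∧ re sp = 0 ∧ im 1 = 0 ∧ im sp = 1 ∧
      ∀ a, a = algebraMap ℚ K (re a) + algebraMap ℚ K (im a) * sp := by
  obtain ⟨β, hβ⟩ : ∃ β : Module.Basis (Fin 2) ℚ K, ⇑β = ![1, sp] :=
    ⟨basisOfLinearIndependentOfCardEqFinrank (linearIndependent_one_sqrt hp hsp)
      (by rw [hK2, Fintype.card_fin]), coe_basisOfLinearIndependentOfCardEqFinrank _ _⟩
  have h0 : β 0 = 1 := by rw [hβ]; rfl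
  have h1 : β 1 = sp := by rw [hβ]; rfl
  refine ⟨β.coord 0, β.coord 1, ?_, ?_, ?_, ?_, fun a => ?_⟩
  · rw [← h0]; simp
  · rw [← h1]; simp
  · rw [← h0]; simp
  · rw [← h1]; simp
  · have := β.sum_repr a
    rw [Fin.sum_univ_two, h0, h1, Algebra.smul_def, Algebra.smul_def, mul_one] at this
    exact this.symm

variable {V : Type} [AddCommGroup V] [Module ℚ V] [Module K V] [IsScalarTower ℚ K V]
variable {φ : V →ₗ[ℚ] V →ₗ[ℚ] K}

theorem exists_realization (hp : p.Prime) (hK2 : Module.finrank ℚ K = 2)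
    (hsp : sp ^ 2 = -(p : K)) (σ : K →ₐ[ℚ] K) (hσ : σ sp = -sp)
    (hlin : ∀ (a : K) (x y : V), φ (a • x) y = a * φ x y)
    (hherm : ∀ x y : V, φ y x = σ (φ x y))
    (hpos : ∀ x : V, x ≠ 0 → ∃ q : ℚ, 0 < q ∧ φ x x = algebraMap ℚ K q) :
    ∃ (B : V →ₗ[ℚ] V →ₗ[ℚ] ℚ) (s : V →ₗ[ℚ] V), IsRealization sp φ p B s ∧ IsHerm p B s ∧
      ∀ x, x ≠ 0 → 0 < B x x := by
  obtain ⟨re, im, hre1, hresp, him1, himsp, hdec⟩ := exists_coordinates hp hK2 hsp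
  have hp0 : (0 : ℚ) < p := by exact_mod_cast hp.pos
  have halg : ∀ q : ℚ, re (algebraMap ℚ K q) = q := fun q => by
    rw [Algebra.algebraMap_eq_smul_one, map_smul, hre1]; simp
  have hre_mul : ∀ a b : ℚ, re (algebraMap ℚ K a + algebraMap ℚ K b * sp) = a := fun a b => by
    rw [map_add, halg, ← Algebra.smul_def, map_smul, hresp]; simp
  have hre_sp : ∀ k, re (sp * k) = -(p * im k) := fun k => by
    have h1 : sp * k = algebraMap ℚ K (-(p * im k)) + algebraMap ℚ K (re k) * sp := by
      conv_lhs => rw [hdec k]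
      simp only [map_neg, map_mul, map_natCast]
      linear_combination (algebraMap ℚ K (im k)) * hsp
    rw [h1, hre_mul]
  have hre_σ : ∀ k, re (σ k) = re k := fun k => by
    have h1 : σ k = algebraMap ℚ K (re k) + algebraMap ℚ K (-im k) * sp := by
      conv_lhs => rw [hdec k]
      simp only [map_add, map_mul, AlgHom.commutes, hσ, map_neg]
      ring
    rw [h1, hre_mul]
  let B : V →ₗ[ℚ] V →ₗ[ℚ] ℚ := (p : ℚ)⁻¹ • φ.compr₂ re
  have hB : ∀ x y, B x y = (p : ℚ)⁻¹ * re (φ x y) := fun x y => rfl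
  have hsymm : ∀ x y, B x y = B y x := fun x y => by rw [hB, hB, hherm x y, hre_σ]
  refine ⟨B, ((LinearMap.lsmul K V) sp).restrictScalars ℚ,
    ⟨fun x y => ?_, fun x => rfl⟩, ⟨hsymm, fun x y => ?_, fun x => ?_⟩, fun x hx => ?_⟩
  · conv_lhs => rw [hdec (φ x y)]
    simp only [LinearMap.coe_restrictScalars, LinearMap.lsmul_apply, hB, hlin, hre_sp]
    rw [mul_inv_cancel_left₀ hp0.ne', mul_neg, inv_mul_cancel_left₀ hp0.ne', map_neg]
    ring
  · simp only [LinearMap.coe_restrictScalars, LinearMap.lsmul_apply]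
    rw [hsymm x, hB, hB, hlin, hlin, hre_sp, hre_sp, hherm x y]
    have : im (σ (φ x y)) = -im (φ x y) := by
      conv_lhs => rw [hdec (φ x y)]
      simp only [map_add, map_mul, AlgHom.commutes, hσ, mul_neg]
      rw [← Algebra.smul_def, map_neg, map_smul, Algebra.algebraMap_eq_smul_one,
        map_smul, him1, himsp]
      simp
    rw [this]; ring
  · simp only [LinearMap.coe_restrictScalars, LinearMap.lsmul_apply]
    rw [smul_smul, ← pow_two, hsp, neg_smul, Nat.cast_smul_eq_nsmul, Nat.cast_smul_eq_nsmul]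
  · obtain ⟨q, hq, hxx⟩ := hpos x hx
    rw [hB, hxx, halg]
    positivity

theorem isModularRLat_iff (hp : p.Prime) (hK2 : Module.finrank ℚ K = 2)
    (hsp : sp ^ 2 = -(p : K)) {B : V →ₗ[ℚ] V →ₗ[ℚ] ℚ} {s : V →ₗ[ℚ] V}
    (hR : IsRealization sp φ p B s) (h : IsHerm p B s) (L : Submodule ℤ V) :
    IsModularRLat K sp V φ L ↔ IsUnimodLat B s L := by
  have hp0 : (p : ℚ) ≠ 0 := by exact_mod_cast hp.ne_zero
  have : CharZero K := algebraRat.charZero K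
  have hsp0 : sp ≠ 0 := by
    rintro rfl
    have : (p : K) = 0 := by simpa using hsp.symm
    exact hp.ne_zero (by exact_mod_cast this)
  obtain ⟨re, im, hre1, hresp, him1, himsp, hdec⟩ := exists_coordinates hp hK2 hsp
  have halg : ∀ q : ℚ, re (algebraMap ℚ K q) = q := fun q => by
    rw [Algebra.algebraMap_eq_smul_one, map_smul, hre1]; simp
  have hialg : ∀ q : ℚ, im (algebraMap ℚ K q) = 0 := fun q => by
    rw [Algebra.algebraMap_eq_smul_one, map_smul, him1]; simp
  have hRmem : ∀ x y : V, Rmem K sp (φ x y) ↔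
      (∃ m : ℤ, p * B x y = m) ∧ ∃ m : ℤ, B (s x) y = m := by
    intro x y
    rw [hR.form]
    constructor
    · rintro ⟨c, d, hcd⟩
      have hcd' : algebraMap ℚ K (p * B x y) - algebraMap ℚ K (B (s x) y) * sp =
        algebraMap ℚ K c + algebraMap ℚ K d * sp := by rw [hcd]; simp
      have h1 := congrArg re hcd'
      have h2 := congrArg im hcd'
      rw [map_sub, map_add, halg, halg, ← Algebra.smul_def, ← Algebra.smul_def, map_smul,
        map_smul, hresp] at h1
      rw [map_sub, map_add, hialg, hialg, ← Algebra.smul_def, ← Algebra.smul_def, map_smul,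
        map_smul, himsp] at h2
      exact ⟨⟨c, by simpa using h1⟩, ⟨-d, by push_cast; simp at h2; linarith⟩⟩
    · rintro ⟨⟨c, hc⟩, ⟨d, hd⟩⟩
      exact ⟨c, -d, by rw [hc, hd]; push_cast; simp; ring⟩
  have hspan : (∀ v ∈ L, sp • v ∈ L) → (Submodule.span K (L : Set V) = ⊤ ↔
      Submodule.span ℚ (L : Set V) = ⊤) := by
    intro hst
    have hsp' : ∀ v ∈ Submodule.span ℚ (L : Set V), sp • v ∈ Submodule.span ℚ (L : Set V) := by
      intro v hv
      induction hv using Submodule.span_induction with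
      | mem v hv => exact Submodule.subset_span (hst v hv)
      | zero => rw [smul_zero]; exact zero_mem _
      | add v w _ _ h1 h2 => rw [smul_add]; exact add_mem h1 h2
      | smul c v _ h1 => rw [smul_comm]; exact Submodule.smul_mem _ _ h1
    have hle : (Submodule.span K (L : Set V) : Set V) ⊆ Submodule.span ℚ (L : Set V) := by
      intro v hv
      induction hv using Submodule.span_induction with
      | mem v hv => exact Submodule.subset_span hv
      | zero => exact zero_mem _
      | add v w _ _ h1 h2 => exact add_mem h1 h2
      | smul c v _ h1 =>
        rw [hdec c, add_smul, mul_smul, algebraMap_smul, algebraMap_smul]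
        exact add_mem (Submodule.smul_mem _ _ h1) (Submodule.smul_mem _ _ (hsp' _ h1))
    have hge : (Submodule.span ℚ (L : Set V) : Set V) ⊆ Submodule.span K (L : Set V) :=
      Submodule.span_subset_span ℚ K _
    constructor
    · intro ht
      exact eq_top_iff.mpr fun v _ => hle (by rw [ht]; trivial)
    · intro ht
      exact eq_top_iff.mpr fun v _ => hge (by rw [ht]; trivial)
  have hdual : (∀ v ∈ L, sp • v ∈ L) → ∀ v, (∃ x : V, (∀ y ∈ L, Rmem K sp (φ x y)) ∧
      v = sp • x) ↔ ∀ y ∈ L, ∃ m : ℤ, B v y = m := by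
    intro hst v
    constructor
    · rintro ⟨x, hx, rfl⟩ y hy
      rw [← hR.op]
      exact ((hRmem x y).mp (hx y hy)).2
    · intro hv
      have hv' : v = sp • (sp⁻¹ • v) := (smul_inv_smul₀ hsp0 v).symm
      refine ⟨sp⁻¹ • v, fun y hy => (hRmem _ _).mpr ⟨?_, ?_⟩, hv'⟩
      · rw [← h.apply_s_s, hR.op, ← hv', hR.op]
        exact hv _ (hst y hy)
      · rw [hR.op, ← hv']
        exact hv y hy
  constructor
  · rintro ⟨h1, h2, h3, h4⟩
    exact ⟨fun v hv => by rw [hR.op]; exact h1 v hv, h2, (hspan h1).mp h3,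
      fun v => (h4 v).trans (hdual h1 v)⟩
  · rintro ⟨h1, h2, h3, h4⟩
    have h1' : ∀ v ∈ L, sp • v ∈ L := fun v hv => by rw [← hR.op]; exact h1 v hv
    exact ⟨h1', h2, (hspan h1').mpr h3, fun v => (h4 v).trans (hdual h1' v).symm⟩

end Realization

/-- The lattice `L` has half index `2 ^ a` and parity `e`. -/
def HasType {V : Type} [AddCommGroup V] [Module ℚ V] (B : V →ₗ[ℚ] V →ₗ[ℚ] ℚ)
    (s : V →ₗ[ℚ] V) (L : Submodule ℤ V) (a : ℕ) (e : Prop) : Prop :=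
  ∃ (b : L →ₗ[ℤ] L →ₗ[ℤ] ℤ) (t : L →ₗ[ℤ] L), IsModel B s b t L.subtype ∧
    halfIndex t.toAddMonoidHom = 2 ^ a ∧ (IsEvenForm b ↔ e)

section Genus

variable {K : Type} [Field K] [Algebra ℚ K] {sp : K} {p : ℕ}
variable {V : Type} [AddCommGroup V] [Module ℚ V] [Module K V] [IsScalarTower ℚ K V]
variable {φ : V →ₗ[ℚ] V →ₗ[ℚ] K} {B : V →ₗ[ℚ] V →ₗ[ℚ] ℚ} {s : V →ₗ[ℚ] V}

theorem IsUnimodLat.finrank_eq {L : Submodule ℤ V} (hL : IsUnimodLat B s L) :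
    Module.finrank ℤ L = Module.finrank ℚ V := by
  obtain ⟨_, _⟩ := finite_free_of_fg hL.fg
  exact finrank_of_span (j := L.subtype) L.injective_subtype (by simpa using hL.span)

theorem sameGenusAt_iff_isometric [FiniteDimensional ℚ V] (l : ℕ) [Fact l.Prime]
    (hp : p.Prime) (hK2 : Module.finrank ℚ K = 2) (hsp : sp ^ 2 = -(p : K))
    (hR : IsRealization sp φ p B s) {L L' : Submodule ℤ V}
    (hL : IsUnimodLat B s L) (hL' : IsUnimodLat B s L')
    {b : L →ₗ[ℤ] L →ₗ[ℤ] ℤ} {t : L →ₗ[ℤ] L} (hj : IsModel B s b t L.subtype)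
    {b' : L' →ₗ[ℤ] L' →ₗ[ℤ] ℤ} {t' : L' →ₗ[ℤ] L'} (hj' : IsModel B s b' t' L'.subtype) :
    SameGenusAt K V φ l L L' ↔
      Isometric (padicForm l b) (padicOp l t) (padicForm l b') (padicOp l t') := by
  obtain ⟨re, im, hre1, hresp, -, -, hdec⟩ := exists_coordinates hp hK2 hsp
  obtain ⟨_, _⟩ := finite_free_of_fg hL.fg
  obtain ⟨_, _⟩ := finite_free_of_fg hL'.fg
  exact ⟨isometric_of_sameGenusAt l hp.ne_zero ⟨re, hre1, hresp⟩ hR hL.span hL'.span hj hj',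
    sameGenusAt_of_isometric l hp.ne_zero ⟨re, hre1, hresp⟩ (fun a => ⟨_, _, hdec a⟩) hR
      hL.span hL'.span hj hj'⟩

theorem sameGenus_iff_sameGenusAt_two [FiniteDimensional ℚ V]
    (hp : p.Prime) (hp4 : p % 4 = 3) (hK2 : Module.finrank ℚ K = 2) (hsp : sp ^ 2 = -(p : K))
    (hR : IsRealization sp φ p B s) (h : IsHerm p B s) {L L' : Submodule ℤ V}
    (hL : IsUnimodLat B s L) (hL' : IsUnimodLat B s L') :
    SameGenus K V φ L L' ↔ SameGenusAt K V φ 2 L L' := by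
  refine ⟨fun hG => hG 2, fun hG l hl => ?_⟩
  rcases eq_or_ne l 2 with rfl | hl2
  · exact hG
  obtain ⟨b, t, hj⟩ := hL.exists_model
  obtain ⟨b', t', hj'⟩ := hL'.exists_model
  obtain ⟨_, _⟩ := finite_free_of_fg hL.fg
  obtain ⟨_, _⟩ := finite_free_of_fg hL'.fg
  have hl0 : (l : ℤ) ≠ 0 := by exact_mod_cast hl.out.ne_zero
  rw [sameGenusAt_iff_isometric l hp hK2 hsp hR hL hL' hj hj']
  exact isometric_padic_of_ne_two hp hp4 hl2 (hj.isHerm h) (hL.unimodAt hj hl0)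
    (hj'.isHerm h) (hL'.unimodAt hj' hl0) (by rw [hL.finrank_eq, hL'.finrank_eq])

theorem HasType.sameGenus_iff [FiniteDimensional ℚ V]
    (hp : p.Prime) (hp4 : p % 4 = 3) (hK2 : Module.finrank ℚ K = 2) (hsp : sp ^ 2 = -(p : K))
    (hR : IsRealization sp φ p B s) (h : IsHerm p B s) {L L' : Submodule ℤ V}
    (hL : IsUnimodLat B s L) (hL' : IsUnimodLat B s L') {a a' : ℕ} {e e' : Prop}
    (ht : HasType B s L a e) (ht' : HasType B s L' a' e') :
    SameGenus K V φ L L' ↔ a = a' ∧ (e ↔ e') := by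
  obtain ⟨b, t, hj, hi, he⟩ := ht
  obtain ⟨b', t', hj', hi', he'⟩ := ht'
  obtain ⟨_, _⟩ := finite_free_of_fg hL.fg
  obtain ⟨_, _⟩ := finite_free_of_fg hL'.fg
  rw [sameGenus_iff_sameGenusAt_two hp hp4 hK2 hsp hR h hL hL',
    sameGenusAt_iff_isometric 2 hp hK2 hsp hR hL hL' hj hj',
    isometric_padic_two_iff hp4 (hj.isHerm h) (hL.unimodAt hj two_ne_zero) (hj'.isHerm h)
      (hL'.unimodAt hj' two_ne_zero) (by rw [hL.finrank_eq, hL'.finrank_eq]),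
    hi, hi', he, he', Nat.pow_right_inj one_lt_two]

theorem IsUnimodLat.exists_hasType (hp4 : p % 4 = 3) (h : IsHerm p B s) {L : Submodule ℤ V}
    (hL : IsUnimodLat B s L) :
    ∃ (a : ℕ) (e : Prop), HasType B s L a e ∧ 2 * a ≤ Module.finrank ℚ V ∧ (e → Even a) ∧
      (a = 0 → e) := by
  obtain ⟨b, t, hj⟩ := hL.exists_model
  obtain ⟨_, _⟩ := finite_free_of_fg hL.fg
  obtain ⟨a, h1, h2, h3, h4⟩ := exists_halfIndex_eq hp4 (hj.isHerm h)
    (hL.unimodAt hj two_ne_zero)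
  exact ⟨a, IsEvenForm b, ⟨b, t, hj, h1, Iff.rfl⟩, by rwa [← hL.finrank_eq], h3, h4⟩

end Genus

section Character

variable (p : ℕ) [Fact p.Prime]

/-- The quadratic character modulo `p` of the prime-to-`p` part of a natural number. -/
noncomputable def partChar (N : ℕ) : ℤ := legendreSym p ((ordCompl[p] N : ℕ) : ℤ)

theorem partChar_mul (a b : ℕ) : partChar p (a * b) = partChar p a * partChar p b := by
  rw [partChar, Nat.ordCompl_mul, Nat.cast_mul, legendreSym.mul]; rfl

theorem partChar_one : partChar p 1 = 1 := by
  simp [partChar, legendreSym.at_one]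

theorem partChar_self : partChar p p = 1 := by
  have := Nat.ordCompl_self_pow (k := 1) (Fact.out : p.Prime)
  rw [pow_one] at this
  rw [partChar, this, Nat.cast_one, legendreSym.at_one]

theorem partChar_of_not_dvd {N : ℕ} (h : ¬ p ∣ N) : partChar p N = legendreSym p N := by
  rw [partChar, Nat.factorization_eq_zero_of_not_dvd h, pow_zero, Nat.div_one]

theorem partChar_sq {N : ℕ} (hN : N ≠ 0) : partChar p (N * N) = 1 := by
  rw [partChar_mul, ← pow_two]
  refine legendreSym.sq_one p ?_
  have := Nat.not_dvd_ordCompl (Fact.out : p.Prime) hN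
  rwa [Int.cast_natCast, Ne, ZMod.natCast_eq_zero_iff]

theorem partChar_pow (N k : ℕ) : partChar p (N ^ k) = partChar p N ^ k := by
  induction k with
  | zero => rw [pow_zero, pow_zero, partChar_one]
  | succ k ih => rw [pow_succ, pow_succ, partChar_mul, ih]

theorem partChar_prod {ι : Type} (I : Finset ι) (f : ι → ℕ) :
    partChar p (∏ i ∈ I, f i) = ∏ i ∈ I, partChar p (f i) := by
  classical
  induction I using Finset.induction_on with
  | empty => simp [partChar_one]
  | insert i I hi ih => rw [Finset.prod_insert hi, Finset.prod_insert hi, partChar_mul, ih]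

theorem partChar_two (hp8 : p % 8 = 3) : partChar p 2 = -1 := by
  have hp2 : p ≠ 2 := by rintro rfl; omega
  rw [partChar_of_not_dvd]
  · rw [Nat.cast_ofNat, legendreSym.at_two hp2, ZMod.χ₈_nat_eq_if_mod_eight]
    split_ifs <;> omega
  · exact fun h => hp2 ((Nat.prime_dvd_prime_iff_eq Fact.out Nat.prime_two).mp h)

theorem partChar_eq_one_of_root (hp8 : p % 8 = 3) {q : ℕ} (hq : 4 * q = p + 1) {l : ℕ}
    (hl : l.Prime) {c : ℤ} (hc : (l : ℤ) ∣ c ^ 2 - c + q) : partChar p l = 1 := by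
  have hp2 : p ≠ 2 := by rintro rfl; omega
  have : Fact l.Prime := ⟨hl⟩
  rcases eq_or_ne l p with rfl | hlp
  · exact partChar_self l
  rcases eq_or_ne l 2 with rfl | hl2
  · exfalso
    have h1 : Even (c ^ 2 - c) := by
      rw [show c ^ 2 - c = (c - 1) * (c - 1 + 1) by ring]; exact Int.even_mul_succ_self _
    rw [Nat.cast_ofNat, ← even_iff_two_dvd, Int.even_add] at hc
    have h2 := hc.mp h1
    rw [Int.even_iff] at h2
    omega
  rw [partChar_of_not_dvd _ fun h => hlp ((Nat.prime_dvd_prime_iff_eq Fact.out hl).mp h).symm]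
  have hpl : ((p : ℤ) : ZMod l) ≠ 0 := by
    rw [Int.cast_natCast, Ne, ZMod.natCast_eq_zero_iff]
    exact fun h => hlp ((Nat.prime_dvd_prime_iff_eq hl Fact.out).mp h)
  have h1 : legendreSym l (-p) = 1 := by
    rw [legendreSym.eq_one_iff _ (by rw [Int.cast_neg]; exact neg_ne_zero.mpr hpl)]
    refine ⟨2 * (c : ZMod l) - 1, ?_⟩
    have h0 := (ZMod.intCast_zmod_eq_zero_iff_dvd _ l).mpr hc
    have h4 : (4 : ZMod l) * q = p + 1 := by exact_mod_cast congrArg (Nat.cast (R := ZMod l)) hq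
    push_cast at h0 ⊢
    linear_combination (-4) * h0 + h4
  rw [legendreSym.at_neg hl2, ZMod.χ₄_eq_neg_one_pow
    ((Nat.Prime.mod_two_eq_one_iff_ne_two hl).mpr hl2)] at h1
  rw [legendreSym.quadratic_reciprocity' hl2 hp2, mul_comm (l / 2), pow_mul, Odd.neg_one_pow
    (Nat.odd_iff.mpr (by omega)), h1]

end Character

/-- A finite module over the maximal order has cardinality of trivial character. -/
theorem partChar_card (p : ℕ) [Fact p.Prime] (hp8 : p % 8 = 3) {q : ℕ} (hq : 4 * q = p + 1) :
    ∀ (n : ℕ) {Q : Type} [AddCommGroup Q] [Finite Q] (w : Q →+ Q)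
      (_ : ∀ x, w (w x) = w x - q • x) (_ : Nat.card Q = n), partChar p n = 1 := by
  intro n
  induction n using Nat.strong_induction_on with
  | _ n ih =>
    intro Q _ _ w hw hn
    rcases eq_or_ne n 1 with rfl | hn1
    · exact partChar_one p
    obtain ⟨l, hl, hln⟩ := Nat.exists_prime_and_dvd hn1
    have : Fact l.Prime := ⟨hl⟩
    have : Fintype Q := Fintype.ofFinite Q
    obtain ⟨x, hx⟩ := exists_prime_addOrderOf_dvd_card' (G := Q) l (hn ▸ hln)
    have hlx : (l : ℤ) • x = 0 := by
      rw [natCast_zsmul, ← hx, addOrderOf_nsmul_eq_zero]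
    have hlw : (l : ℤ) • w x = 0 := by rw [← map_zsmul, hlx, map_zero]
    have hdvd : ∀ m : ℤ, m • x = 0 → (l : ℤ) ∣ m := fun m hm => by
      rw [← hx]; exact addOrderOf_dvd_iff_zsmul_eq_zero.mpr hm
    obtain ⟨H, hH, hcard, hstab⟩ : ∃ H : AddSubgroup Q, partChar p (Nat.card H) = 1 ∧
        1 < Nat.card H ∧ H ≤ H.comap w := by
      by_cases hc : ∃ c : ℤ, w x = c • x
      · obtain ⟨c, hc⟩ := hc
        refine ⟨AddSubgroup.zmultiples x, ?_, ?_, ?_⟩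
        · rw [Nat.card_zmultiples, hx]
          refine partChar_eq_one_of_root p hp8 hq hl (c := c) (hdvd _ ?_)
          have h1 := hw x
          rw [hc, map_zsmul, hc, smul_smul, ← natCast_zsmul, ← sub_smul] at h1
          have h2 : (c ^ 2 - c + (q : ℤ)) • x = (c * c) • x - (c - (q : ℤ)) • x := by
            rw [← sub_smul]; congr 1; ring
          rw [h2, h1, sub_self]
        · rw [Nat.card_zmultiples, hx]; exact hl.one_lt
        · rw [AddSubgroup.zmultiples_le]
          exact ⟨c, hc.symm⟩
      · let f₁ : ZMod l →+ Q := ZMod.lift l ⟨zmultiplesHom Q x, by simpa using hlx⟩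
        let f₂ : ZMod l →+ Q := ZMod.lift l ⟨zmultiplesHom Q (w x), by simpa using hlw⟩
        have hf₁ : ∀ m : ℤ, f₁ (m : ZMod l) = m • x := fun m => by simp [f₁]
        have hf₂ : ∀ m : ℤ, f₂ (m : ZMod l) = m • w x := fun m => by simp [f₂]
        let f : ZMod l × ZMod l →+ Q := f₁.coprod f₂
        have hf : ∀ m k : ℤ, f ((m : ZMod l), (k : ZMod l)) = m • x + k • w x := fun m k => by
          simp only [f, AddMonoidHom.coprod_apply, hf₁, hf₂]
        have hinj : Function.Injective f := by
          rw [injective_iff_map_eq_zero]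
          rintro ⟨a, b⟩ hab
          obtain ⟨m, rfl⟩ := ZMod.intCast_surjective a
          obtain ⟨k, rfl⟩ := ZMod.intCast_surjective b
          rw [hf] at hab
          have hk : (l : ℤ) ∣ k := by
            by_contra hk
            obtain ⟨u, v, huv⟩ := ((Nat.prime_iff_prime_int.mp hl).coprime_iff_not_dvd).mpr hk
            refine hc ⟨-(v * m), ?_⟩
            have h1 : w x = (u * l + v * k) • w x := by rw [huv, one_smul]
            rw [h1, add_smul, mul_smul, mul_smul, hlw, eq_neg_of_add_eq_zero_right hab, smul_zero,
              zero_add, smul_neg, neg_smul, mul_smul]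
          obtain ⟨d, rfl⟩ := hk
          rw [mul_comm, mul_smul, hlw, smul_zero, add_zero] at hab
          have hm := (ZMod.intCast_zmod_eq_zero_iff_dvd _ l).mpr (hdvd m hab)
          rw [hm]
          simp
        have hcf : Nat.card f.range = l * l := by
          rw [← Nat.card_congr (AddMonoidHom.ofInjective hinj).toEquiv, Nat.card_prod,
            Nat.card_zmod]
        refine ⟨f.range, ?_, ?_, ?_⟩
        · rw [hcf, partChar_sq p hl.ne_zero]
        · rw [hcf]; nlinarith [hl.one_lt]
        · rintro _ ⟨⟨a, b⟩, rfl⟩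
          obtain ⟨m, rfl⟩ := ZMod.intCast_surjective a
          obtain ⟨k, rfl⟩ := ZMod.intCast_surjective b
          refine ⟨(((-(k * q) : ℤ) : ZMod l), ((m + k : ℤ) : ZMod l)), ?_⟩
          rw [hf, hf, map_add, map_zsmul, map_zsmul, hw, smul_sub, ← natCast_zsmul, smul_smul,
            neg_smul, add_smul]
          abel
    have hmul := H.card_mul_index
    rw [AddSubgroup.index, hn] at hmul
    have hpos : 0 < Nat.card (Q ⧸ H) := Nat.card_pos
    have hlt : Nat.card (Q ⧸ H) < n := by rw [← hmul]; nlinarith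
    have := ih _ hlt (QuotientAddGroup.map H H w hstab) (fun y => by
      obtain ⟨y, rfl⟩ := QuotientAddGroup.mk_surjective y
      simp only [QuotientAddGroup.map_mk, hw, QuotientAddGroup.mk_sub, QuotientAddGroup.mk_nsmul])
      rfl
    rw [← hmul, partChar_mul, hH, this, one_mul]

section Quaternary

variable {M : Type} [AddCommGroup M]
variable {p : ℕ} {B : M →ₗ[ℤ] M →ₗ[ℤ] ℤ} {s : M →ₗ[ℤ] M}

/-- The square root of the Gram determinant of `x, s x, y, s y`. -/
def quadDisc (p : ℕ) (B : M →ₗ[ℤ] M →ₗ[ℤ] ℤ) (s : M →ₗ[ℤ] M) (x y : M) : ℤ :=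
  p * (B x x * B y y - B x y ^ 2) - B (s x) y ^ 2

theorem IsHerm.exists_quadDisc_smul (h : IsHerm p B s) (x y : M) (a₁ a₂ b₁ b₂ : ℤ) :
    ∃ c₁ c₂ d₁ d₂ : ℤ, ∃ m, m = c₁ • x + c₂ • s x + d₁ • y + d₂ • s y ∧
      B x m = quadDisc p B s x y * a₁ ∧ B (s x) m = quadDisc p B s x y * a₂ ∧
      B y m = quadDisc p B s x y * b₁ ∧ B (s y) m = quadDisc p B s x y * b₂ := by
  refine ⟨p * B y y * a₁ - p * B x y * b₁ + B (s x) y * b₂,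
    B y y * a₂ - B (s x) y * b₁ - B x y * b₂,
    p * B x x * b₁ - p * B x y * a₁ - B (s x) y * a₂,
    B x x * b₂ + B (s x) y * a₁ - B x y * a₂, _, rfl, ?_⟩
  have h1 : B x (s y) = -B (s x) y := h.skew' _ _
  have h2 : B y (s x) = B (s x) y := h.symm _ _
  have h3 : B (s y) x = -B (s x) y := by rw [h.symm, h1]
  have h4 : B y x = B x y := h.symm _ _
  simp only [quadDisc, map_add, map_zsmul, smul_eq_mul, h.apply_self, h.apply_self',
    h.apply_s_s, h1, h2, h3, h4]
  refine ⟨?_, ?_, ?_, ?_⟩ <;> ring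

theorem not_dvd_quadDisc (hp : p.Prime) {x y : M} (hxy : ¬ (p : ℤ) ∣ B (s x) y) :
    ¬ (p : ℤ) ∣ quadDisc p B s x y := fun h =>
  hxy ((Nat.prime_iff_prime_int.mp hp).dvd_of_dvd_pow
    ((dvd_sub_right (dvd_mul_right _ _)).mp h))

theorem IsHerm.quadDisc_pos (h : IsHerm p B s) (hp : p.Prime) (hpos : ∀ x, x ≠ 0 → 0 < B x x)
    {x y : M} (hxy : ¬ (p : ℤ) ∣ B (s x) y) : 0 < quadDisc p B s x y := by
  have hx : x ≠ 0 := by rintro rfl; simp at hxy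
  have hne : quadDisc p B s x y ≠ 0 := fun h0 =>
    not_dvd_quadDisc hp hxy (h0 ▸ dvd_zero _)
  have hnn : ∀ z, 0 ≤ B z z := fun z => by
    rcases eq_or_ne z 0 with rfl | hz
    · simp
    · exact (hpos z hz).le
  have h2 : B y (s x) = B (s x) y := h.symm _ _
  have h4 : B y x = B x y := h.symm _ _
  have key := hnn ((p * B x x) • y - (p * B x y) • x - B (s x) y • s x)
  have e : B ((p * B x x) • y - (p * B x y) • x - B (s x) y • s x)
      ((p * B x x) • y - (p * B x y) • x - B (s x) y • s x)
      = p * B x x * quadDisc p B s x y := by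
    simp only [quadDisc, map_sub, map_zsmul, smul_eq_mul, LinearMap.sub_apply,
      LinearMap.smul_apply, h.apply_self, h.apply_self', h.apply_s_s, h2, h4]
    ring
  rw [e] at key
  have h5 : (0 : ℤ) < p * B x x := mul_pos (by exact_mod_cast hp.pos) (hpos x hx)
  exact lt_of_le_of_ne (nonneg_of_mul_nonneg_right key h5) (Ne.symm hne)

theorem partChar_quadDisc [Fact p.Prime] (hp4 : p % 4 = 3) {x y : M}
    (hxy : ¬ (p : ℤ) ∣ B (s x) y) (hw : 0 < quadDisc p B s x y) :
    partChar p (quadDisc p B s x y).natAbs = -1 := by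
  have hp2 : p ≠ 2 := by rintro rfl; omega
  have hp : p.Prime := Fact.out
  rw [partChar_of_not_dvd _ (by rw [← Int.natCast_dvd]; exact not_dvd_quadDisc hp hxy),
    Int.natAbs_of_nonneg hw.le, legendreSym.mod, quadDisc, sub_eq_add_neg,
    Int.mul_add_emod_self_left, ← legendreSym.mod, legendreSym.at_neg hp2,
    ZMod.χ₄_nat_three_mod_four hp4, legendreSym.sq_one', mul_one]
  rwa [Ne, ZMod.intCast_zmod_eq_zero_iff_dvd]

/-- A family of pairs spanning mutually orthogonal submodules stable under `s`. -/
def IsOrthoPairs (B : M →ₗ[ℤ] M →ₗ[ℤ] ℤ) (s : M →ₗ[ℤ] M) {k : ℕ} (u : Fin k → Fin 2 → M) :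
    Prop :=
  ∀ i j, i ≠ j → ∀ a c, B (u i a) (u j c) = 0 ∧ B (s (u i a)) (u j c) = 0

theorem exists_orthoPairs (hp : p.Prime) : ∀ (r : ℕ) {M : Type} [AddCommGroup M]
    [Module.Finite ℤ M] [Module.Free ℤ M] {B : M →ₗ[ℤ] M →ₗ[ℤ] ℤ} {s : M →ₗ[ℤ] M}
    (_ : IsHerm p B s) (_ : ∀ x, x ≠ 0 → 0 < B x x) (_ : UnimodAt (p : ℤ) B)
    (_ : Module.finrank ℤ M = r),
    ∃ k, Module.finrank ℤ M = 4 * k ∧ ∃ u : Fin k → Fin 2 → M, IsOrthoPairs B s u ∧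
      ∀ i, ¬ (p : ℤ) ∣ B (s (u i 0)) (u i 1) := by
  intro r
  induction r using Nat.strong_induction_on with
  | _ r ih =>
    intro M _ _ _ B s h hpos hU hr
    rcases eq_or_ne r 0 with rfl | hr0
    · exact ⟨0, by rw [hr], fun i => i.elim0, fun i => i.elim0, fun i => i.elim0⟩
    have hpp := Nat.prime_iff_prime_int.mp hp
    obtain ⟨x, y, hxy⟩ := hU.exists_not_dvd_skew h hpp.not_isUnit hpp.ne_zero (hr ▸ hr0)
    set w := quadDisc p B s x y with hw
    have hw0 : w ≠ 0 := (h.quadDisc_pos hp hpos hxy).ne'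
    let f : M →ₗ[ℤ] (Fin 4 → ℤ) := LinearMap.pi ![B x, B (s x), B y, B (s y)]
    have hf : ∀ z, f z = ![B x z, B (s x) z, B y z, B (s y) z] := fun z => by
      ext i; fin_cases i <;> rfl
    let C := LinearMap.ker f
    have hC : ∀ z, z ∈ C ↔ B x z = 0 ∧ B (s x) z = 0 ∧ B y z = 0 ∧ B (s y) z = 0 := fun z => by
      simp [C, hf]
    have hsC : ∀ z ∈ C, s z ∈ C := fun z hz => by
      rw [hC] at hz ⊢
      simp only [h.skew' x, h.skew' y, h.apply_s_s, hz]
      simp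
    have hproj : ∀ z, ∃ m, w • z - m ∈ C ∧ ∀ c ∈ C, B c m = 0 := fun z => by
      obtain ⟨c₁, c₂, d₁, d₂, m, rfl, h1, h2, h3, h4⟩ :=
        h.exists_quadDisc_smul x y (B x z) (B (s x) z) (B y z) (B (s y) z)
      refine ⟨c₁ • x + c₂ • s x + d₁ • y + d₂ • s y, (hC _).mpr ?_, fun c hc => ?_⟩
      · simp only [map_sub, map_zsmul, smul_eq_mul] at h1 h2 h3 h4 ⊢
        exact ⟨sub_eq_zero.mpr h1.symm, sub_eq_zero.mpr h2.symm, sub_eq_zero.mpr h3.symm,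
          sub_eq_zero.mpr h4.symm⟩
      · rw [hC] at hc
        rw [h.symm]
        simp [hc]
    have hrank : Module.finrank ℤ C + 4 = r := by
      have h1 : _ + Module.finrank ℤ C = _ := (LinearMap.ker f).finrank_quotient_add_finrank
      rw [f.quotKerEquivRange.finrank_eq] at h1
      have h2 : Module.finrank ℤ (LinearMap.range f) = 4 := by
        refine le_antisymm ?_ ?_
        · simpa using Submodule.finrank_le (LinearMap.range f)
        · have hg : ∀ a : Fin 4 → ℤ, (w • LinearMap.id : (Fin 4 → ℤ) →ₗ[ℤ] _) a ∈
              LinearMap.range f := fun a => by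
            obtain ⟨c₁, c₂, d₁, d₂, m, -, h1, h2, h3, h4⟩ :=
              h.exists_quadDisc_smul x y (a 0) (a 1) (a 2) (a 3)
            refine ⟨m, ?_⟩
            rw [hf, h1, h2, h3, h4]
            ext i; fin_cases i <;> rfl
          have := LinearMap.finrank_le_finrank_of_injective
            (f := (w • LinearMap.id : (Fin 4 → ℤ) →ₗ[ℤ] _).codRestrict _ hg) (by
              intro a b hab
              have := congrArg Subtype.val hab
              exact smul_right_injective _ hw0 this)
          simpa using this
      omega
    let BC : C →ₗ[ℤ] C →ₗ[ℤ] ℤ := B.domRestrict₁₂ C C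
    let sC : C →ₗ[ℤ] C := s.restrict hsC
    obtain ⟨k, hk, u, hu, hup⟩ := ih (Module.finrank ℤ C) (by omega) (M := C) (B := BC) (s := sC)
      ⟨fun a b => h.symm a b, fun a b => h.skew a b, fun a => Subtype.ext (h.sq a)⟩
      (fun a ha => hpos a fun h0 => ha (Subtype.ext h0))
      (fun c hc => by
        obtain ⟨v, hv⟩ := hU c fun z => by
          obtain ⟨m, hm1, hm2⟩ := hproj z
          have h1 := hc ⟨_, hm1⟩
          change (p : ℤ) ∣ B c (w • z - m) at h1
          rw [map_sub, hm2 c c.2, sub_zero, map_zsmul, smul_eq_mul] at h1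
          exact (hpp.dvd_or_dvd h1).resolve_left (not_dvd_quadDisc hp hxy)
        have hvC : v ∈ C := by
          have h1 : f ((p : ℤ) • v) = 0 := hv ▸ c.2
          rw [map_zsmul] at h1
          exact (smul_eq_zero.mp h1).resolve_left hpp.ne_zero
        exact ⟨⟨v, hvC⟩, Subtype.ext hv⟩) rfl
    refine ⟨k + 1, by omega, Fin.cons ![x, y] fun i a => (u i a : M), ?_, ?_⟩
    · have hz : ∀ z ∈ C, ∀ a, B (![x, y] a) z = 0 ∧ B (s (![x, y] a)) z = 0 := fun z hz a => by
        rw [hC] at hz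
        fin_cases a
        · exact ⟨hz.1, hz.2.1⟩
        · exact ⟨hz.2.2.1, hz.2.2.2⟩
      intro i j
      refine Fin.cases ?_ (fun i => ?_) i <;> refine Fin.cases ?_ (fun j => ?_) j
      · intro h0; exact absurd rfl h0
      · intro _ a c
        simp only [Fin.cons_zero, Fin.cons_succ]
        exact hz _ (u j c).2 a
      · intro _ a c
        simp only [Fin.cons_zero, Fin.cons_succ]
        have h1 := hz _ (u i a).2 c
        refine ⟨(h.symm _ _).trans h1.1, ?_⟩
        rw [h.skew, h.symm, h1.2, neg_zero]
      · intro hij a c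
        simp only [Fin.cons_succ]
        exact hu i j (fun e => hij (by rw [e])) a c
    · intro i
      refine Fin.cases ?_ (fun i => ?_) i
      · simpa using hxy
      · exact hup i

end Quaternary

section Gram

variable {M : Type} [AddCommGroup M] {B : M →ₗ[ℤ] M →ₗ[ℤ] ℤ} {s : M →ₗ[ℤ] M} {p : ℕ}
variable {ι : Type}

/-- The Gram matrix of a family. -/
def gram (B : M →ₗ[ℤ] M →ₗ[ℤ] ℤ) (v : ι → M) : Matrix ι ι ℤ := Matrix.of fun i j => B (v i) (v j)

variable [Fintype ι]

theorem gram_eq (b : Module.Basis ι ℤ M) (v : ι → M) :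
    gram B v = (b.toMatrix v).transpose * gram B b * b.toMatrix v := by
  ext i j
  have h1 : ∀ i, v i = ∑ k, b.toMatrix v k i • b k := fun i => by
    simp only [Module.Basis.toMatrix_apply, b.sum_repr]
  simp only [gram, Matrix.of_apply, Matrix.mul_apply, Matrix.transpose_apply]
  conv_lhs => rw [h1 i, h1 j]
  simp only [map_sum, LinearMap.sum_apply, map_zsmul, LinearMap.smul_apply, smul_eq_mul,
    Finset.sum_mul, Finset.mul_sum]
  exact Finset.sum_congr rfl fun _ _ => Finset.sum_congr rfl fun _ _ => by ring

variable [DecidableEq ι]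

theorem natAbs_det_gram (hU : ∀ l : ℕ, l.Prime → UnimodAt (l : ℤ) B)
    (b : Module.Basis ι ℤ M) : (gram B b).det.natAbs = 1 := by
  by_contra hne
  obtain ⟨l, hl, hdvd⟩ := Nat.exists_prime_and_dvd hne
  have : Fact l.Prime := ⟨hl⟩
  have h0 : ((gram B b).transpose.map (Int.castRingHom (ZMod l))).det = 0 := by
    rw [← RingHom.mapMatrix_apply, ← RingHom.map_det, Matrix.det_transpose, eq_intCast,
      ZMod.intCast_zmod_eq_zero_iff_dvd]
    exact Int.natCast_dvd.mpr hdvd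
  obtain ⟨v, hv0, hv⟩ := Matrix.exists_mulVec_eq_zero_iff.mpr h0
  choose c hc using fun i => ZMod.intCast_surjective (v i)
  have hdiv : ∀ y, (l : ℤ) ∣ B (∑ i, c i • b i) y := by
    intro y
    rw [← b.sum_repr y, map_sum]
    refine Finset.dvd_sum fun j _ => ?_
    rw [map_zsmul, smul_eq_mul]
    refine Dvd.dvd.mul_left ?_ _
    rw [← ZMod.intCast_zmod_eq_zero_iff_dvd]
    have := congrFun hv j
    simp only [Matrix.mulVec, dotProduct, Matrix.map_apply, Matrix.transpose_apply, gram,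
      Matrix.of_apply, ← hc, Pi.zero_apply, eq_intCast] at this
    rw [← this]
    simp only [map_sum, LinearMap.sum_apply, map_zsmul, LinearMap.smul_apply, smul_eq_mul,
      Int.cast_sum, Int.cast_mul]
    exact Finset.sum_congr rfl fun _ _ => mul_comm _ _
  obtain ⟨w, hw⟩ := hU l hl _ hdiv
  refine hv0 (funext fun i => ?_)
  have h1 := congrArg (fun x => b.repr x i) hw
  simp only [b.repr_sum_self, map_zsmul, Finsupp.smul_apply, smul_eq_mul] at h1
  rw [Pi.zero_apply, ← hc, ZMod.intCast_zmod_eq_zero_iff_dvd, h1]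
  exact dvd_mul_right _ _

theorem index_span_sq (hU : ∀ l : ℕ, l.Prime → UnimodAt (l : ℤ) B)
    (b : Module.Basis ι ℤ M) (v : ι → M) (hv : (gram B v).det ≠ 0) :
    (Submodule.span ℤ (Set.range v)).toAddSubgroup.index ^ 2 = (gram B v).det.natAbs := by
  have hli : LinearIndependent ℤ v := by
    rw [Fintype.linearIndependent_iff]
    intro c hc i
    have h1 : Matrix.vecMul c (gram B v) = 0 := by
      ext j
      simp only [Matrix.vecMul, dotProduct, gram, Matrix.of_apply, Pi.zero_apply]
      have := congrArg (fun x => B x (v j)) hc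
      simpa using this
    exact congrFun (Matrix.eq_zero_of_vecMul_eq_zero hv h1) i
  rw [AddSubgroup.index_eq_natAbs_det b _ (Module.Basis.span hli)]
  have h2 : b.det (fun i => ((Module.Basis.span hli i : _) : M)) = (b.toMatrix v).det := by
    rw [Module.Basis.det_apply]
    congr 2
    ext i
    simp [Module.Basis.span_apply]
  have h3 := congrArg (fun m => m.det.natAbs) (gram_eq (B := B) b v)
  simp only [Matrix.det_mul, Matrix.det_transpose, Int.natAbs_mul, natAbs_det_gram hU b,
    mul_one] at h3
  rw [h3, ← pow_two]
  exact congrArg (fun z : ℤ => z.natAbs ^ 2) h2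

/-- The generators `x + s x, 2 x, y + s y, 2 y` attached to a pair. -/
def halfQuad (s : M →ₗ[ℤ] M) (x y : M) : Fin 4 → M :=
  ![x + s x, x + x, y + s y, y + y]

theorem det_gram_halfQuad (h : IsHerm p B s) (x y : M) :
    (gram B (halfQuad s x y)).det = (4 * quadDisc p B s x y) ^ 2 := by
  have h1 : B x (s y) = -B (s x) y := h.skew' _ _
  have h2 : B y (s x) = B (s x) y := h.symm _ _
  have h3 : B (s y) x = -B (s x) y := by rw [h.symm, h1]
  have h4 : B y x = B x y := h.symm _ _
  rw [Matrix.det_succ_row_zero]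
  simp [Fin.sum_univ_succ, Matrix.det_fin_three, gram, halfQuad, Fin.succAbove,
    h.apply_self, h.apply_self', h.apply_s_s, h1, h2, h3, h4, quadDisc]
  ring

theorem det_gram_halfQuads (h : IsHerm p B s) {k : ℕ} {u : Fin k → Fin 2 → M}
    (hu : IsOrthoPairs B s u) :
    (gram B fun i : Fin 4 × Fin k => halfQuad s (u i.2 0) (u i.2 1) i.1).det =
      ∏ i, (4 * quadDisc p B s (u i 0) (u i 1)) ^ 2 := by
  have h1 : (gram B fun i : Fin 4 × Fin k => halfQuad s (u i.2 0) (u i.2 1) i.1) =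
      Matrix.blockDiagonal fun i => gram B (halfQuad s (u i 0) (u i 1)) := by
    ext ⟨a, i⟩ ⟨c, j⟩
    rw [Matrix.blockDiagonal_apply']
    split_ifs with hij
    · subst hij; rfl
    · have h2 : ∀ a c, B (u i a) (u j c) = 0 := fun a c => (hu i j hij a c).1
      have h3 : ∀ a c, B (s (u i a)) (u j c) = 0 := fun a c => (hu i j hij a c).2
      have h4 : ∀ a c, B (u i a) (s (u j c)) = 0 := fun a c => by rw [h.skew', h3, neg_zero]
      fin_cases a <;> fin_cases c <;> simp [gram, halfQuad, h2, h3, h4, h.apply_s_s]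
  rw [h1, Matrix.det_blockDiagonal]
  exact Finset.prod_congr rfl fun i _ => det_gram_halfQuad h _ _

end Gram

section HalfStable

variable {M : Type} [AddCommGroup M] [IsAddTorsionFree M]

/-- The operator `(1 + s) / 2` on the submodule where it is defined. -/
theorem exists_halfOp {p q : ℕ} (hq : 4 * q = p + 1) {s : M →+ M}
    (hs : ∀ x, s (s x) = -(p • x)) :
    ∃ w : halfStable s →+ halfStable s, (∀ x : halfStable s, x + s x = w x + w x) ∧
      ∀ x, w (w x) = w x - q • x := by
  choose f hf using fun x : halfStable s => mem_halfStable.mp x.2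
  have hinj : ∀ a b : M, a + a = b + b → a = b := fun a b hab => by
    rw [← two_nsmul, ← two_nsmul] at hab
    exact nsmul_right_injective two_ne_zero hab
  have hsf : ∀ x, f x + s (f x) = (f x - q • (x : M)) + (f x - q • (x : M)) := fun x => by
    apply hinj
    have h1 := congrArg s (hf x)
    rw [map_add, map_add, hs] at h1
    have h2 : (4 * q) • (x : M) = p • (x : M) + (x : M) := by rw [hq, succ_nsmul]
    have h3 : (f x + s (f x)) + (f x + s (f x)) = (f x + f x) + (s (f x) + s (f x)) := by abel
    rw [h3, ← h1, ← hf]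
    have h4 : (f x - q • (x : M)) + (f x - q • (x : M)) + (f x - q • (x : M) + (f x - q • (x : M)))
        = (f x + f x) + (f x + f x) - (4 * q) • (x : M) := by
      rw [mul_comm, mul_nsmul, succ_nsmul, succ_nsmul, succ_nsmul, one_nsmul]; abel
    rw [h4, h2, ← hf]
    abel
  refine ⟨AddMonoidHom.mk' (fun x => ⟨f x, _, hsf x⟩) fun x y => Subtype.ext (hinj _ _ ?_),
    hf, fun x => Subtype.ext (hinj _ _ ?_)⟩
  · simp only [AddSubgroup.coe_add]
    rw [← hf, AddSubgroup.coe_add, map_add, add_add_add_comm, hf, hf]; abel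
  · exact (hf _).symm.trans (hsf x)

end HalfStable

/-- The parity of the half index of a unimodular lattice. -/
theorem even_halfIndex_iff {p : ℕ} (hp : p.Prime) (hp8 : p % 8 = 3) {M : Type} [AddCommGroup M]
    [Module.Finite ℤ M] [Module.Free ℤ M] {B : M →ₗ[ℤ] M →ₗ[ℤ] ℤ} {s : M →ₗ[ℤ] M}
    (h : IsHerm p B s) (hpos : ∀ x, x ≠ 0 → 0 < B x x)
    (hU : ∀ l : ℕ, l.Prime → UnimodAt (l : ℤ) B) {a : ℕ}
    (ha : halfIndex s.toAddMonoidHom = 2 ^ a) :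
    ∃ k, Module.finrank ℤ M = 4 * k ∧ (Even a ↔ Even k) := by
  have : Fact p.Prime := ⟨hp⟩
  obtain ⟨q, hq⟩ : ∃ q, 4 * q = p + 1 := ⟨(p + 1) / 4, by omega⟩
  obtain ⟨k, hk, u, hu, hup⟩ := exists_orthoPairs hp _ h hpos (hU p hp) rfl
  refine ⟨k, hk, ?_⟩
  have hw := fun i => h.quadDisc_pos hp hpos (hup i)
  let v : Fin 4 × Fin k → M := fun i => halfQuad s (u i.2 0) (u i.2 1) i.1
  let b : Module.Basis (Fin 4 × Fin k) ℤ M := (Module.finBasis ℤ M).reindex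
    (Fintype.equivOfCardEq (by simp [hk]))
  have hdet := det_gram_halfQuads h hu
  have hdet0 : (gram B v).det ≠ 0 := by
    rw [hdet]
    exact Finset.prod_ne_zero_iff.mpr fun i _ => pow_ne_zero _ (mul_ne_zero four_ne_zero (hw i).ne')
  have hidx := index_span_sq hU b v hdet0
  set N := (Submodule.span ℤ (Set.range v)).toAddSubgroup with hN
  have hidx' : N.index = ∏ i, 4 * (quadDisc p B s (u i 0) (u i 1)).natAbs := by
    have := hdet
    refine Nat.pow_left_injective two_ne_zero ?_
    change N.index ^ 2 = _ ^ 2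
    rw [hidx, hdet, Finset.prod_pow, Int.natAbs_pow]
    congr 1
    rw [← Int.natAbsHom_apply, map_prod]
    exact Finset.prod_congr rfl fun i _ => by rw [Int.natAbsHom_apply, Int.natAbs_mul]; rfl
  have hchar : partChar p N.index = (-1) ^ k := by
    rw [hidx', partChar_prod]
    have : ∀ i : Fin k, partChar p (4 * (quadDisc p B s (u i 0) (u i 1)).natAbs) = -1 := fun i => by
      rw [partChar_mul, show 4 = 2 * 2 from rfl, partChar_sq p two_ne_zero, one_mul,
        partChar_quadDisc (by omega) (hup i) (hw i)]
    rw [Finset.prod_congr rfl fun i _ => this i, Finset.prod_const, Finset.card_univ,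
      Fintype.card_fin]
  have hstab : ∀ z ∈ N, ∃ y ∈ N, z + s z = y + y := by
    intro z hz'
    have hz : z ∈ Submodule.span ℤ (Set.range v) := hz'
    clear hz'
    induction hz using Submodule.span_induction with
    | zero => exact ⟨0, N.zero_mem, by simp⟩
    | add z z' _ _ ih ih' =>
      obtain ⟨y, hy, e⟩ := ih
      obtain ⟨y', hy', e'⟩ := ih'
      exact ⟨y + y', N.add_mem hy hy', by rw [map_add, add_add_add_comm, e, e']; abel⟩
    | smul c z _ ih =>
      obtain ⟨y, hy, e⟩ := ih
      exact ⟨c • y, N.zsmul_mem hy c, by rw [map_zsmul, ← smul_add, e, smul_add]⟩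
    | mem z hz =>
      obtain ⟨⟨c, i⟩, rfl⟩ := hz
      have hm : ∀ c, halfQuad s (u i 0) (u i 1) c ∈ N := fun c =>
        Submodule.subset_span ⟨(c, i), rfl⟩
      have hgen : ∀ x : M, x + s x ∈ N → x + x ∈ N →
          (∃ y ∈ N, (x + s x) + s (x + s x) = y + y) ∧ ∃ y ∈ N, (x + x) + s (x + x) = y + y := by
        intro x h1 h2
        refine ⟨⟨x + s x - q • (x + x), N.sub_mem h1 (N.nsmul_mem h2 q), ?_⟩, ⟨x + s x, h1, ?_⟩⟩
        · have h3 : q • (x + x) + q • (x + x) = x + (p : ℤ) • x := by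
            rw [← two_nsmul x, ← two_nsmul (q • _), smul_smul, smul_smul,
              show 2 * q * 2 = p + 1 by omega, succ_nsmul, natCast_zsmul, add_comm]
          rw [map_add, h.sq]
          calc x + s x + (s x + -((p : ℤ) • x)) = (x + s x) + (x + s x) - (x + (p : ℤ) • x) := by
                abel
            _ = _ := by rw [← h3]; abel
        · rw [map_add]; abel
      have h0 := hgen _ (hm 0) (hm 1)
      have h1 := hgen _ (hm 2) (hm 3)
      fin_cases c
      · exact h0.1
      · exact h0.2
      · exact h1.1
      · exact h1.2
  have : IsAddTorsionFree M := Module.isTorsionFree_int_iff_isAddTorsionFree.mp inferInstance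
  obtain ⟨w, hw1, hw2⟩ := exists_halfOp hq (s := s.toAddMonoidHom) fun x => by
    rw [← natCast_zsmul]; exact h.sq x
  have hle : N ≤ halfStable s.toAddMonoidHom := fun z hz => by
    obtain ⟨y, -, hy⟩ := hstab z hz; exact ⟨y, hy⟩
  have hmul := AddSubgroup.relIndex_mul_index hle
  have hne : N.index ≠ 0 := fun h0 => by
    rw [h0, zero_pow two_ne_zero, eq_comm, Int.natAbs_eq_zero] at hidx
    exact hdet0 hidx
  have hne' : N.relIndex (halfStable s.toAddMonoidHom) ≠ 0 := left_ne_zero_of_mul (hmul ▸ hne)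
  let Q := halfStable s.toAddMonoidHom ⧸ N.addSubgroupOf (halfStable s.toAddMonoidHom)
  have : Finite Q := Nat.finite_of_card_ne_zero hne'
  have hwN : N.addSubgroupOf (halfStable s.toAddMonoidHom) ≤
      (N.addSubgroupOf (halfStable s.toAddMonoidHom)).comap w := fun x hx => by
    obtain ⟨y, hy, e⟩ := hstab x hx
    have h1 : y = w x := by
      refine nsmul_right_injective two_ne_zero ?_
      change 2 • y = 2 • (w x : M)
      rw [two_nsmul, two_nsmul, ← e]
      exact hw1 x
    change (w x : M) ∈ N
    exact h1 ▸ hy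
  have hQ : partChar p (Nat.card Q) = 1 := by
    refine partChar_card p hp8 hq _ (Q := Q) (QuotientAddGroup.map _ _ w hwN) (fun y => ?_) rfl
    obtain ⟨y, rfl⟩ := QuotientAddGroup.mk_surjective y
    rw [QuotientAddGroup.map_mk, QuotientAddGroup.map_mk, hw2, QuotientAddGroup.mk_sub,
      QuotientAddGroup.mk_nsmul]
  have hfin : partChar p N.index = (-1) ^ a := by
    rw [← hmul, partChar_mul]
    have h1 : (halfStable s.toAddMonoidHom).index = 2 ^ a := ha
    rw [h1, partChar_pow, partChar_two p hp8]
    exact (congrArg (· * (-1 : ℤ) ^ a) hQ).trans (one_mul _)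
  rw [hchar] at hfin
  rw [← neg_one_pow_eq_one_iff_even (R := ℤ) (by decide), ← hfin,
    neg_one_pow_eq_one_iff_even (by decide)]

section OddIndex

variable {M M' : Type} [AddCommGroup M] [AddCommGroup M']

theorem halfIndex_eq_of_odd {s : M →ₗ[ℤ] M} {s' : M' →ₗ[ℤ] M'} (f : M →ₗ[ℤ] M')
    (hf : Function.Injective f) (hs : ∀ x, f (s x) = s' (f x))
    (hodd : ∀ y, ∃ (c : ℤ) (x : M), Odd c ∧ c • y = f x) :
    halfIndex s.toAddMonoidHom = halfIndex s'.toAddMonoidHom := by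
  refine halfIndex_eq_of_map f.toAddMonoidHom (fun x => ?_) fun y => ?_
  · simp only [mem_halfStable, LinearMap.toAddMonoidHom_coe]
    constructor
    · rintro ⟨y, hy⟩
      obtain ⟨c, z, ⟨d, rfl⟩, hz⟩ := hodd y
      refine ⟨z - d • (x + s x), hf ?_⟩
      rw [map_add, map_add, map_sub, map_zsmul, map_add, hs, ← hz, hy]
      module
    · rintro ⟨y, hy⟩
      exact ⟨f y, by rw [← hs, ← map_add, hy, map_add]⟩
  · obtain ⟨c, x, ⟨d, rfl⟩, hx⟩ := hodd y
    refine ⟨x, d • (y + s' y), ?_⟩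
    simp only [LinearMap.toAddMonoidHom_coe, ← hx, map_sub, map_zsmul]
    module

theorem isEvenForm_iff_of_odd {B : M →ₗ[ℤ] M →ₗ[ℤ] ℤ} {B' : M' →ₗ[ℤ] M' →ₗ[ℤ] ℤ} (f : M →ₗ[ℤ] M')
    (hB : ∀ x y, B' (f x) (f y) = B x y)
    (hodd : ∀ y, ∃ (c : ℤ) (x : M), Odd c ∧ c • y = f x) : IsEvenForm B ↔ IsEvenForm B' := by
  refine ⟨fun h y => ?_, fun h x => hB x x ▸ h _⟩
  obtain ⟨c, x, hc, hx⟩ := hodd y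
  have h1 := h x
  rw [← hB, ← hx] at h1
  simp only [map_zsmul, LinearMap.smul_apply, smul_eq_mul] at h1
  have h2 : ¬ (2 : ℤ) ∣ c := by rwa [← even_iff_two_dvd, Int.not_even_iff_odd]
  exact (Int.prime_two.dvd_or_dvd ((Int.prime_two.dvd_or_dvd h1).resolve_left h2)).resolve_left h2

theorem UnimodAt.pow [Module.Free ℤ M] {l : ℤ} (hl : l ≠ 0) {B : M →ₗ[ℤ] M →ₗ[ℤ] ℤ}
    (hU : UnimodAt l B) : ∀ (m : ℕ) (x : M), (∀ y, l ^ m ∣ B x y) → ∃ w, x = l ^ m • w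
  | 0, x, _ => ⟨x, by rw [pow_zero, one_smul]⟩
  | m + 1, x, h => by
    obtain ⟨w, rfl⟩ := hU x fun y => dvd_trans ⟨l ^ m, pow_succ' l m⟩ (h y)
    obtain ⟨v, rfl⟩ := UnimodAt.pow hl hU m w fun y => by
      have := h y
      rw [map_zsmul, LinearMap.smul_apply, smul_eq_mul, pow_succ'] at this
      exact (mul_dvd_mul_iff_left hl).mp this
    exact ⟨v, by rw [smul_smul, pow_succ']⟩

end OddIndex

section Glue

variable {V : Type} [AddCommGroup V] [Module ℚ V]
variable {B : V →ₗ[ℚ] V →ₗ[ℚ] ℚ} {s : V →ₗ[ℚ] V}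

theorem exists_zsmul_mem {L : Submodule ℤ V} (hL : Submodule.span ℚ (L : Set V) = ⊤) (v : V) :
    ∃ D : ℤ, D ≠ 0 ∧ D • v ∈ L := by
  have hv : v ∈ Submodule.span ℚ (L : Set V) := hL ▸ Submodule.mem_top
  induction hv using Submodule.span_induction with
  | mem v hv => exact ⟨1, one_ne_zero, by rwa [one_smul]⟩
  | zero => exact ⟨1, one_ne_zero, by rw [smul_zero]; exact L.zero_mem⟩
  | add v w _ _ h1 h2 =>
    obtain ⟨D, hD, hv⟩ := h1
    obtain ⟨E, hE, hw⟩ := h2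
    refine ⟨D * E, mul_ne_zero hD hE, ?_⟩
    rw [smul_add, mul_comm, mul_smul, mul_comm, mul_smul]
    exact L.add_mem (L.smul_mem _ hv) (L.smul_mem _ hw)
  | smul c v _ h1 =>
    obtain ⟨D, hD, hv⟩ := h1
    refine ⟨c.den * D, mul_ne_zero (by exact_mod_cast c.den_ne_zero) hD, ?_⟩
    have : ((c.den : ℤ) * D) • c • v = c.num • D • v := by
      rw [← Int.cast_smul_eq_zsmul ℚ, ← Int.cast_smul_eq_zsmul ℚ c.num,
        ← Int.cast_smul_eq_zsmul ℚ D, smul_smul, smul_smul]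
      congr 1
      push_cast
      rw [mul_right_comm, Rat.den_mul_eq_num]
    rw [this]
    exact L.smul_mem _ hv

theorem exists_two_pow_mul_odd {D : ℤ} (hD : D ≠ 0) : ∃ (m : ℕ) (c : ℤ), Odd c ∧ D = 2 ^ m * c := by
  obtain ⟨c, h, hc⟩ := (Int.finiteMultiplicity_iff.mpr
    ⟨(by decide : Int.natAbs 2 ≠ 1), hD⟩).exists_eq_pow_mul_and_not_dvd
  exact ⟨_, c, by rwa [← Int.not_even_iff_odd, even_iff_two_dvd], h⟩

theorem exists_int_of_odd {r : ℚ} {c : ℤ} (hc : Odd c) {k : ℕ} (h1 : ∃ m : ℤ, c * r = m)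
    (h2 : ∃ m : ℤ, 2 ^ k * r = m) : ∃ m : ℤ, r = m := by
  obtain ⟨m, hm⟩ := h1
  obtain ⟨m', hm'⟩ := h2
  have : IsCoprime c (2 ^ k) := by
    refine IsCoprime.pow_right ?_
    obtain ⟨d, rfl⟩ := hc
    exact ⟨1, -d, by ring⟩
  obtain ⟨u, v, huv⟩ := this
  refine ⟨u * m + v * m', ?_⟩
  have h3 : (u : ℚ) * c + v * 2 ^ k = 1 := by exact_mod_cast huv
  push_cast
  rw [← hm, ← hm']
  linear_combination (-r) * h3

theorem mem_of_odd {L : Submodule ℤ V} {v : V} {c : ℤ} (hc : Odd c) {k : ℕ} (h1 : c • v ∈ L)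
    (h2 : (2 ^ k : ℤ) • v ∈ L) : v ∈ L := by
  have : IsCoprime c (2 ^ k) := by
    refine IsCoprime.pow_right ?_
    obtain ⟨d, rfl⟩ := hc
    exact ⟨1, -d, by ring⟩
  obtain ⟨u, w, huw⟩ := this
  rw [← one_smul ℤ v, ← huw, add_smul, mul_smul, mul_smul]
  exact L.add_mem (L.smul_mem _ h1) (L.smul_mem _ h2)

/-- The lattice which agrees with `N` at `2` and with `L` away from `2`. -/
def glue (L N : Submodule ℤ V) : Submodule ℤ V where
  carrier := {v | (∃ c : ℤ, Odd c ∧ c • v ∈ N) ∧ ∃ k : ℕ, (2 ^ k : ℤ) • v ∈ L}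
  zero_mem' := ⟨⟨1, odd_one, by simp⟩, 0, by simp⟩
  add_mem' := by
    rintro v w ⟨⟨c, hc, h1⟩, k, h2⟩ ⟨⟨d, hd, h3⟩, l, h4⟩
    refine ⟨⟨c * d, hc.mul hd, ?_⟩, k + l, ?_⟩
    · rw [smul_add, mul_comm, mul_smul, mul_comm, mul_smul]
      exact N.add_mem (N.smul_mem _ h1) (N.smul_mem _ h3)
    · rw [pow_add, smul_add, mul_comm, mul_smul, mul_comm, mul_smul]
      exact L.add_mem (L.smul_mem _ h2) (L.smul_mem _ h4)
  smul_mem' := by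
    rintro a v ⟨⟨c, hc, h1⟩, k, h2⟩
    exact ⟨⟨c, hc, by rw [smul_comm]; exact N.smul_mem _ h1⟩, k,
      by rw [smul_comm]; exact L.smul_mem _ h2⟩

theorem exists_odd_mem_glue {L N : Submodule ℤ V}
    (hL : Submodule.span ℚ (L : Set V) = ⊤) {v : V} (hv : v ∈ N) :
    ∃ c : ℤ, Odd c ∧ c • v ∈ glue L N := by
  obtain ⟨D, hD, h⟩ := exists_zsmul_mem hL v
  obtain ⟨m, c, hc, rfl⟩ := exists_two_pow_mul_odd hD
  exact ⟨c, hc, ⟨1, odd_one, N.smul_mem _ (N.smul_mem _ hv)⟩, m, by rwa [smul_smul]⟩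

theorem exists_pow_mem_glue {L N : Submodule ℤ V}
    (hN : Submodule.span ℚ (N : Set V) = ⊤) {v : V} (hv : v ∈ L) :
    ∃ k : ℕ, (2 ^ k : ℤ) • v ∈ glue L N := by
  obtain ⟨D, hD, h⟩ := exists_zsmul_mem hN v
  obtain ⟨m, c, hc, rfl⟩ := exists_two_pow_mul_odd hD
  exact ⟨m, ⟨c, hc, by rwa [smul_smul, mul_comm]⟩, 0, L.smul_mem _ (L.smul_mem _ hv)⟩

theorem glue_fg {L N : Submodule ℤ V} (hL : Submodule.span ℚ (L : Set V) = ⊤) (hLfg : L.FG)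
    (hNfg : N.FG) : (glue L N).FG := by
  obtain ⟨D, hD, hDN⟩ : ∃ D : ℤ, D ≠ 0 ∧ ∀ v ∈ N, D • v ∈ L := by
    obtain ⟨S, rfl⟩ := hNfg
    choose f hf0 hf using exists_zsmul_mem hL
    refine ⟨∏ v ∈ S, f v, Finset.prod_ne_zero_iff.mpr fun v _ => hf0 v, fun v hv => ?_⟩
    induction hv using Submodule.span_induction with
    | mem v hv =>
      obtain ⟨d, hd⟩ := Finset.dvd_prod_of_mem f hv
      rw [hd, mul_comm, mul_smul]
      exact L.smul_mem _ (hf v)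
    | zero => rw [smul_zero]; exact L.zero_mem
    | add v w _ _ h1 h2 => rw [smul_add]; exact L.add_mem h1 h2
    | smul c v _ h1 => rw [smul_comm]; exact L.smul_mem _ h1
  obtain ⟨m, d, hd, rfl⟩ := exists_two_pow_mul_odd hD
  have : IsAddTorsionFree V := IsAddTorsionFree.of_module_rat V
  let g : V →ₗ[ℤ] V := LinearMap.lsmul ℤ V (2 ^ m)
  have hg : Function.Injective g := smul_right_injective V (pow_ne_zero m two_ne_zero)
  refine Submodule.fg_of_fg_map_injective g hg ?_
  have : IsNoetherian ℤ L := isNoetherian_of_fg_of_noetherian _ hLfg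
  refine isNoetherian_submodule.mp this _ ?_
  rintro _ ⟨v, ⟨⟨c, hc, h1⟩, k, h2⟩, rfl⟩
  refine mem_of_odd (hd.mul hc) (k := k) ?_ ?_
  · have := hDN _ h1
    change (d * c) • (2 ^ m : ℤ) • v ∈ L
    rwa [smul_smul, show d * c * 2 ^ m = 2 ^ m * d * c by ring, mul_smul]
  · change (2 ^ k : ℤ) • (2 ^ m : ℤ) • v ∈ L
    rw [smul_comm]
    exact L.smul_mem _ h2

theorem exists_glue {L : Submodule ℤ V} (hL : IsUnimodLat B s L)
    {N : Type} [AddCommGroup N] [Module.Finite ℤ N] [Module.Free ℤ N]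
    {b : N →ₗ[ℤ] N →ₗ[ℤ] ℤ} {t : N →ₗ[ℤ] N} {j : N →ₗ[ℤ] V} (hj : IsModel B s b t j)
    (hU : UnimodAt 2 b) (hspan : Submodule.span ℚ (Set.range j) = ⊤) {a : ℕ} {e : Prop}
    (ha : halfIndex t.toAddMonoidHom = 2 ^ a) (he : IsEvenForm b ↔ e) :
    ∃ L', IsUnimodLat B s L' ∧ HasType B s L' a e := by
  have htf : IsAddTorsionFree V := IsAddTorsionFree.of_module_rat V
  set R := LinearMap.range j with hRdef
  have hR : Submodule.span ℚ (R : Set V) = ⊤ := by rw [hRdef, LinearMap.coe_range, hspan]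
  have hval : ∀ v ∈ glue L R, ∀ w ∈ glue L R, ∃ m : ℤ, B v w = m := by
    rintro v ⟨⟨c, hc, x, hx⟩, k, hk⟩ w ⟨⟨d, hd, y, hy⟩, l, hl⟩
    refine exists_int_of_odd (hc.mul hd) (k := k + l) ⟨b x y, ?_⟩ ?_
    · rw [hj.form, hx, hy]
      simp only [map_zsmul, LinearMap.smul_apply, zsmul_eq_mul]
      push_cast
      ring
    · obtain ⟨m, hm⟩ := (hL.mem_iff _).mp hk _ hl
      refine ⟨m, ?_⟩
      rw [← hm]
      simp only [map_zsmul, LinearMap.smul_apply, zsmul_eq_mul]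
      push_cast
      ring
  have hU' : IsUnimodLat B s (glue L R) := by
    refine ⟨?_, glue_fg hL.span hL.fg (Submodule.fg_range j), ?_, fun v => ⟨hval v, fun h => ?_⟩⟩
    · rintro v ⟨⟨c, hc, x, hx⟩, k, hk⟩
      exact ⟨⟨c, hc, t x, by rw [hj.op, hx, map_zsmul]⟩, k, by
        rw [← map_zsmul]; exact hL.stable _ hk⟩
    · rw [eq_top_iff, ← hR, Submodule.span_le]
      intro v hv
      obtain ⟨c, hc, h⟩ := exists_odd_mem_glue hL.span hv
      have hc0 : (c : ℚ) ≠ 0 := by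
        rintro h0
        rw [Int.cast_eq_zero] at h0
        simp [h0] at hc
      have := Submodule.smul_mem _ (c : ℚ)⁻¹ (Submodule.subset_span (R := ℚ) h)
      rwa [← Int.cast_smul_eq_zsmul ℚ, inv_smul_smul₀ hc0] at this
    · constructor
      · obtain ⟨D, hD, x, hx⟩ := exists_zsmul_mem hR v
        obtain ⟨m, c, hc, rfl⟩ := exists_two_pow_mul_odd hD
        obtain ⟨w, rfl⟩ := hU.pow two_ne_zero m x fun y => by
          obtain ⟨d, hd, hdy⟩ := exists_odd_mem_glue hL.span (N := R) ⟨y, rfl⟩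
          obtain ⟨r, hr⟩ := h _ hdy
          have h1 : d * b x y = 2 ^ m * (c * r) := by
            have : (d : ℚ) * b x y = 2 ^ m * (c * r) := by
              rw [hj.form, hx, ← hr]
              simp only [map_zsmul, LinearMap.smul_apply, zsmul_eq_mul]
              push_cast
              ring
            exact_mod_cast this
          refine IsCoprime.dvd_of_dvd_mul_left ?_ (Dvd.intro _ h1.symm)
          obtain ⟨d', rfl⟩ := hd
          exact IsCoprime.pow_left ⟨-d', 1, by ring⟩
        refine ⟨c, hc, w, smul_right_injective V (pow_ne_zero m (two_ne_zero (α := ℤ))) ?_⟩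
        change (2 ^ m : ℤ) • j w = (2 ^ m : ℤ) • c • v
        rw [← map_zsmul, hx, smul_smul]
      · obtain ⟨D, hD, hx⟩ := exists_zsmul_mem hL.span v
        obtain ⟨m, c, hc, rfl⟩ := exists_two_pow_mul_odd hD
        refine ⟨m, (hL.mem_iff _).mpr fun y hy => ?_⟩
        obtain ⟨k, hk⟩ := exists_pow_mem_glue hR hy
        obtain ⟨r, hr⟩ := h _ hk
        obtain ⟨r', hr'⟩ := (hL.mem_iff _).mp hx _ hy
        refine exists_int_of_odd hc (k := k) ⟨r', ?_⟩ ⟨2 ^ m * r, ?_⟩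
        · rw [← hr']
          simp only [map_zsmul, LinearMap.smul_apply, zsmul_eq_mul]
          push_cast
          ring
        · push_cast
          rw [← hr]
          simp only [map_zsmul, LinearMap.smul_apply, zsmul_eq_mul]
          push_cast
          ring
  refine ⟨_, hU', ?_⟩
  obtain ⟨b', t', hj'⟩ := hU'.exists_model
  let P : Submodule ℤ N := (glue L R).comap j
  have htP : ∀ x ∈ P, t x ∈ P := fun x hx => by
    change j (t x) ∈ glue L R
    rw [hj.op]
    exact hU'.stable _ hx
  let bP : P →ₗ[ℤ] P →ₗ[ℤ] ℤ := b.compl₁₂ P.subtype P.subtype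
  let tP : P →ₗ[ℤ] P := t.restrict htP
  let jP : P →ₗ[ℤ] glue L R := (j.comp P.subtype).codRestrict _ fun x => x.2
  have hoddN : ∀ y, ∃ (c : ℤ) (x : P), Odd c ∧ c • y = P.subtype x := fun y => by
    obtain ⟨c, hc, h⟩ := exists_odd_mem_glue hL.span (N := R) ⟨y, rfl⟩
    exact ⟨c, ⟨c • y, by change j _ ∈ glue L R; rwa [map_zsmul]⟩, hc, rfl⟩
  have hoddL : ∀ y, ∃ (c : ℤ) (x : P), Odd c ∧ c • y = jP x := by
    rintro ⟨v, hv⟩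
    obtain ⟨⟨c, hc, x, hx⟩, -⟩ := id hv
    refine ⟨c, ⟨x, ?_⟩, hc, Subtype.ext hx.symm⟩
    change j x ∈ glue L R
    rw [hx]
    exact (glue L R).smul_mem _ hv
  refine ⟨b', t', hj', ?_, ?_⟩
  · rw [← ha, ← halfIndex_eq_of_odd (s := tP) P.subtype P.injective_subtype (fun _ => rfl) hoddN]
    refine (halfIndex_eq_of_odd jP (fun x y h => ?_) (fun x => ?_) hoddL).symm
    · exact Subtype.ext (hj.injective (congrArg Subtype.val h))
    · exact Subtype.ext ((hj.op _).trans (hj'.op (jP x)).symm)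
  · rw [← he, ← isEvenForm_iff_of_odd (B := bP) P.subtype (fun _ _ => rfl) hoddN]
    refine (isEvenForm_iff_of_odd jP (fun x y => ?_) hoddL).symm
    apply Int.cast_injective (α := ℚ)
    exact (hj'.form _ _).trans (hj.form _ _).symm

end Glue

section IntBlocks

theorem int_two_dvd (x : ℤ) : 2 ∣ x ∨ 2 ∣ x + 1 := by omega

theorem int_two_not_isUnit : ¬ IsUnit (2 : ℤ) := by decide

/-- The inclusion of `ℤ²` in `ℚ²`. -/
def castPair : (ℤ × ℤ) →ₗ[ℤ] (ℚ × ℚ) := (Algebra.linearMap ℤ ℚ).prodMap (Algebra.linearMap ℤ ℚ)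

@[simp] theorem castPair_apply (x : ℤ × ℤ) : castPair x = ((x.1 : ℚ), (x.2 : ℚ)) := rfl

theorem int_prod_eq_smul {x : ℤ × ℤ} (h1 : 2 ∣ x.1) (h2 : 2 ∣ x.2) : ∃ w, x = (2 : ℤ) • w := by
  obtain ⟨c, hc⟩ := h1
  obtain ⟨d, hd⟩ := h2
  exact ⟨(c, d), Prod.ext hc hd⟩

theorem even_of_odd_mul {u x : ℤ} (hu : Odd u) (h : 2 ∣ u * x) : 2 ∣ x := by
  refine (Int.prime_two.dvd_or_dvd h).resolve_left ?_
  rwa [← even_iff_two_dvd, Int.not_even_iff_odd]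

theorem unimodAt_formR {p : ℕ} (hp : p % 2 = 1) {u : ℤ} (hu : Odd u) :
    UnimodAt 2 (formR p u) := by
  have hp' : Odd (p : ℤ) := by exact_mod_cast Nat.odd_iff.mpr hp
  intro x h
  have h1 := h (1, 0)
  have h2 := h (0, 1)
  simp only [formR_apply, mul_one, mul_zero, add_zero, zero_add] at h1 h2
  exact int_prod_eq_smul (even_of_odd_mul hu h1) (even_of_odd_mul hp' (even_of_odd_mul hu h2))

theorem unimodAt_formO (q : ℕ) {u : ℤ} (hu : Odd u) : UnimodAt 2 (formO q u) := by
  intro x h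
  have h1 := h (1, 0)
  have h2 := h (0, 1)
  simp only [formO_apply, mul_one, mul_zero, add_zero, zero_add] at h1 h2
  replace h1 := even_of_odd_mul hu h1
  replace h2 := even_of_odd_mul hu h2
  rw [mul_assoc] at h2
  exact int_prod_eq_smul (by omega) (by omega)

theorem unimodAt_formP {p : ℕ} (hp : p % 2 = 1) {α δ β γ : ℤ} (hα : 2 ∣ α) (hδ : 2 ∣ δ)
    (h : Odd (β + γ)) : UnimodAt 2 (formP p α δ β γ) := by
  have hp' : ¬ Even (p : ℤ) := by
    rw [Int.not_even_iff_odd]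
    exact_mod_cast Nat.odd_iff.mpr hp
  rw [← even_iff_two_dvd] at hα hδ
  rw [← Int.not_even_iff_odd, Int.even_add] at h
  rintro ⟨⟨a, b⟩, c, d⟩ h'
  have h1 := h' ((1, 0), (0, 0))
  have h2 := h' ((0, 1), (0, 0))
  have h3 := h' ((0, 0), (1, 0))
  have h4 := h' ((0, 0), (0, 1))
  simp only [formP_apply, mul_one, mul_zero, add_zero, zero_add, zero_sub, sub_zero, one_mul,
    zero_mul, ← even_iff_two_dvd, Int.even_add, Int.even_mul, even_neg, hα, hδ, hp', true_or,
    false_or, true_iff] at h1 h2 h3 h4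
  have key : (Even a ∧ Even b) ∧ Even c ∧ Even d := by
    by_cases hβ : Even β <;> by_cases hγ : Even γ <;> simp_all
  obtain ⟨w, hw⟩ := int_prod_eq_smul (x := (a, b)) (even_iff_two_dvd.mp key.1.1)
    (even_iff_two_dvd.mp key.1.2)
  obtain ⟨w', hw'⟩ := int_prod_eq_smul (x := (c, d)) (even_iff_two_dvd.mp key.2.1)
    (even_iff_two_dvd.mp key.2.2)
  exact ⟨(w, w'), Prod.ext hw hw'⟩

theorem isEvenForm_formO_int (q : ℕ) (u : ℤ) : IsEvenForm (formO q u) :=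
  fun x => ⟨u * (x.1 * x.1 + x.1 * x.2 + q * x.2 * x.2), by simp; ring⟩

theorem isEvenForm_formP_int (p : ℕ) {α δ : ℤ} (hα : 2 ∣ α) (hδ : 2 ∣ δ) (β γ : ℤ) :
    IsEvenForm (formP p α δ β γ) := by
  obtain ⟨α, rfl⟩ := hα
  obtain ⟨δ, rfl⟩ := hδ
  intro x
  rw [formP_apply]
  refine ⟨α * (x.1.1 * x.1.1 + p * x.1.2 * x.1.2) + δ * (x.2.1 * x.2.1 + p * x.2.2 * x.2.2) +
    β * (x.1.1 * x.2.1 + p * x.1.2 * x.2.2) + γ * (x.1.2 * x.2.1 - x.1.1 * x.2.2), by ring⟩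

theorem not_isEvenForm_formR_int (p : ℕ) {u : ℤ} (hu : Odd u) : ¬ IsEvenForm (formR p u) := by
  intro h
  have := h (1, 0)
  simp only [formR_apply, mul_one, mul_zero, add_zero] at this
  rw [← even_iff_two_dvd, ← Int.not_odd_iff_even] at this
  exact this hu

end IntBlocks

section Achieve

variable {V : Type} [AddCommGroup V] [Module ℚ V]
variable {B : V →ₗ[ℚ] V →ₗ[ℚ] ℚ} {s : V →ₗ[ℚ] V} {p : ℕ}

/-- There is a lattice of rank `r` in `W` that is unimodular at `2`, of half index `2 ^ a` and
parity `e`. -/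
def Achieves (B : V →ₗ[ℚ] V →ₗ[ℚ] ℚ) (s : V →ₗ[ℚ] V) (W : Submodule ℚ V) (r a : ℕ)
    (e : Prop) : Prop :=
  ∃ (N : Type) (_ : AddCommGroup N) (_ : Module.Finite ℤ N) (_ : Module.Free ℤ N)
    (b : N →ₗ[ℤ] N →ₗ[ℤ] ℤ) (t : N →ₗ[ℤ] N) (j : N →ₗ[ℤ] V),
    (∀ x y, (b x y : ℚ) = B (j x) (j y)) ∧ (∀ x, j (t x) = s (j x)) ∧ UnimodAt 2 b ∧
    (∀ x, j x ∈ W) ∧ Module.finrank ℤ N = r ∧ halfIndex t.toAddMonoidHom = 2 ^ a ∧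
    (IsEvenForm b ↔ e)

theorem Achieves.mono {W W' : Submodule ℚ V} {r a : ℕ} {e : Prop} (h : Achieves B s W r a e)
    (hW : W ≤ W') : Achieves B s W' r a e := by
  obtain ⟨N, _, _, _, b, t, j, h1, h2, h3, h4, h5⟩ := h
  exact ⟨N, _, ‹_›, ‹_›, b, t, j, h1, h2, h3, fun x => hW (h4 x), h5⟩

theorem Achieves.zero (W : Submodule ℚ V) : Achieves B s W 0 0 True := by
  refine ⟨PUnit, inferInstance, inferInstance, inferInstance, 0, 0, 0, fun _ _ => by simp,
    fun _ => by simp,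
    fun x _ => ⟨x, Subsingleton.elim _ _⟩, fun x => W.zero_mem, ?_, ?_, ?_⟩
  · exact Module.finrank_zero_of_subsingleton
  · rw [pow_zero, halfIndex_eq_one_iff]
    exact fun x => ⟨x, Subsingleton.elim _ _⟩
  · simp [IsEvenForm]

theorem Achieves.sum (h : IsHerm p B s) {W W₁ W₂ : Submodule ℚ V} (h₁ : W₁ ≤ W) (h₂ : W₂ ≤ W)
    (ho : ∀ x ∈ W₁, ∀ y ∈ W₂, B x y = 0) {r₁ a₁ r₂ a₂ : ℕ} {e₁ e₂ : Prop}
    (H₁ : Achieves B s W₁ r₁ a₁ e₁) (H₂ : Achieves B s W₂ r₂ a₂ e₂) :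
    Achieves B s W (r₁ + r₂) (a₁ + a₂) (e₁ ∧ e₂) := by
  obtain ⟨N, _, _, _, b, t, j, f1, f2, f3, f4, f5, f6, f7⟩ := H₁
  obtain ⟨N', _, _, _, b', t', j', g1, g2, g3, g4, g5, g6, g7⟩ := H₂
  refine ⟨N × N', inferInstance, inferInstance, inferInstance, prodForm b b', t.prodMap t',
    j.coprod j', fun x y => ?_, fun x => ?_, f3.prod g3, fun x => ?_, ?_, ?_, ?_⟩
  · simp [f1, g1, ho _ (f4 x.1) _ (g4 y.2), h.symm (j' x.2), ho _ (f4 y.1) _ (g4 x.2)]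
  · simp [f2, g2]
  · exact W.add_mem (h₁ (f4 _)) (h₂ (g4 _))
  · rw [Module.finrank_prod, f5, g5]
  · rw [halfIndex_prodMap, f6, g6, pow_add]
  · rw [isEvenForm_prod, f7, g7]

/-- The `K`-span of a vector. -/
def lineSpan (s : V →ₗ[ℚ] V) (x : V) : Submodule ℚ V := LinearMap.range (spanR s x)

theorem mem_lineSpan {x v : V} : v ∈ lineSpan s x ↔ ∃ a b : ℚ, v = a • x + b • s x := by
  constructor
  · rintro ⟨a, rfl⟩
    exact ⟨a.1, a.2, rfl⟩
  · rintro ⟨a, b, rfl⟩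
    exact ⟨(a, b), rfl⟩

theorem lineSpan_le {W : Submodule ℚ V} (hW : ∀ v ∈ W, s v ∈ W) {x : V} (hx : x ∈ W) :
    lineSpan s x ≤ W := by
  rintro _ ⟨a, rfl⟩
  exact W.add_mem (W.smul_mem _ hx) (W.smul_mem _ (hW _ hx))

theorem form_lineSpan (h : IsHerm p B s) {x y : V} (h1 : B x y = 0) (h2 : B (s x) y = 0) :
    ∀ v ∈ lineSpan s x, ∀ w ∈ lineSpan s y, B v w = 0 := by
  rintro _ ⟨a, rfl⟩ _ ⟨b, rfl⟩
  simp [h1, h2, h.skew' x, h.apply_s_s]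

theorem achieves_odd (h : IsHerm p B s) (hp : p % 2 = 1) {x : V} {u : ℤ} (hu : Odd u)
    (hx : B x x = u) : Achieves B s (lineSpan s x) 2 1 False := by
  refine ⟨ℤ × ℤ, inferInstance, inferInstance, inferInstance, formR p u, opR ℤ p,
    (spanR s x).restrictScalars ℤ ∘ₗ castPair, fun y z => ?_, fun y => ?_,
    unimodAt_formR hp hu, fun y => ⟨_, rfl⟩, by simp,
    halfIndex_opR hp int_two_dvd int_two_not_isUnit, ?_⟩
  · rw [LinearMap.comp_apply, LinearMap.comp_apply, LinearMap.restrictScalars_apply,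
      LinearMap.restrictScalars_apply, form_spanR h, hx]
    simp
  · rw [LinearMap.comp_apply, LinearMap.comp_apply, LinearMap.restrictScalars_apply,
      LinearMap.restrictScalars_apply, spanR_opR h]
    simp
  · simp [not_isEvenForm_formR_int p hu]

theorem achieves_even (h : IsHerm p B s) (hp4 : p % 4 = 3) {x : V} {u : ℤ} (hu : Odd u)
    (hx : B x x = 2 * u) : Achieves B s (lineSpan s x) 2 0 True := by
  obtain ⟨q, hq⟩ : ∃ q, 4 * q = p + 1 := ⟨(p + 1) / 4, by omega⟩
  have hw : x + s x = (2 : ℚ) • ((1 / 2 : ℚ) • (x + s x)) := by module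
  refine ⟨ℤ × ℤ, inferInstance, inferInstance, inferInstance, formO q u, opO ℤ q,
    (spanO x ((1 / 2 : ℚ) • (x + s x))).restrictScalars ℤ ∘ₗ castPair, fun y z => ?_,
    fun y => ?_, unimodAt_formO q hu, fun y => ?_, by simp, halfIndex_opO q, ?_⟩
  · rw [LinearMap.comp_apply, LinearMap.comp_apply, LinearMap.restrictScalars_apply,
      LinearMap.restrictScalars_apply, form_spanO hq h hw hx]
    simp
  · rw [LinearMap.comp_apply, LinearMap.comp_apply, LinearMap.restrictScalars_apply,
      LinearMap.restrictScalars_apply, spanO_opO hq h hw]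
    simp
  · refine mem_lineSpan.mpr ⟨y.1 + y.2 / 2, y.2 / 2, ?_⟩
    simp only [LinearMap.comp_apply, LinearMap.restrictScalars_apply, spanO_apply, castPair_apply]
    module
  · simp [isEvenForm_formO_int]

theorem achieves_pair (h : IsHerm p B s) (hp4 : p % 4 = 3) {x y : V} {u v : ℤ} (hu : Odd u)
    (hv : Odd v) (hx : B x x = u) (hy : B y y = v) (h1 : B x y = 0) (h2 : B (s x) y = 0) :
    Achieves B s (lineSpan s x ⊔ lineSpan s y) 4 2 True := by
  obtain ⟨q, hq⟩ : ∃ q, 4 * q = p + 1 := ⟨(p + 1) / 4, by omega⟩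
  obtain ⟨u, rfl⟩ := hu
  obtain ⟨v, rfl⟩ := hv
  obtain ⟨r, hr⟩ : ∃ r : ℤ, (p : ℤ) = 2 * r + 1 := ⟨p / 2, by omega⟩
  have hq' : (4 : ℚ) * q = p + 1 := by exact_mod_cast hq
  have h3 : B x (s y) = 0 := by rw [h.skew', h2, neg_zero]
  have h4 : B y x = 0 := by rw [h.symm, h1]
  have h5 : B (s y) x = 0 := by rw [h.symm, h3]
  have h6 : B y (s x) = 0 := by rw [h.symm, h2]
  set E : V := x + y
  set F : V := (1 / 2 : ℚ) • (x + s x) + (1 / 2 : ℚ) • (y - s y)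
  have hEE : B E E = (2 * (u + v + 1) : ℤ) := by
    simp [E, hx, hy, h1, h4]; ring
  have hFF : B F F = (2 * (q * (u + v + 1)) : ℤ) := by
    simp [F, hx, hy, h1, h2, h3, h4, h5, h6, h.apply_self, h.apply_self', h.apply_s_s]
    linear_combination (-(u + v + 1) / 2 : ℚ) * hq'
  have hEF : B E F = (u + v + 1 : ℤ) := by
    simp [E, F, hx, hy, h1, h3, h4, h6, h.apply_self]
    ring
  have hsEF : B (s E) F = (p * (u - v) : ℤ) := by
    simp [E, F, hx, hy, h1, h2, h4, h5, h.apply_self', h.apply_s_s]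
    ring
  refine ⟨(ℤ × ℤ) × (ℤ × ℤ), inferInstance, inferInstance, inferInstance,
    formP p (2 * (u + v + 1)) (2 * (q * (u + v + 1))) (u + v + 1) (p * (u - v)), opP ℤ p,
    (spanP s E F).restrictScalars ℤ ∘ₗ castPair.prodMap castPair, fun y z => ?_, fun y => ?_,
    unimodAt_formP (by omega) (Dvd.intro _ rfl) (Dvd.intro _ rfl) ⟨u + r * (u - v), ?_⟩,
    fun z => ?_, by simp,
    halfIndex_opP (by omega) int_two_dvd int_two_not_isUnit, ?_⟩
  · rw [LinearMap.comp_apply, LinearMap.comp_apply, LinearMap.restrictScalars_apply,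
      LinearMap.restrictScalars_apply, form_spanP h, hEE, hFF, hEF, hsEF]
    simp
  · rw [LinearMap.comp_apply, LinearMap.comp_apply, LinearMap.restrictScalars_apply,
      LinearMap.restrictScalars_apply, spanP_opP h]
    simp
  · rw [hr]; ring
  · have hsx : ∀ v ∈ lineSpan s x ⊔ lineSpan s y, s v ∈ lineSpan s x ⊔ lineSpan s y := by
      intro v hv
      obtain ⟨_, ⟨a, rfl⟩, _, ⟨b, rfl⟩, rfl⟩ := Submodule.mem_sup.mp hv
      rw [map_add, spanR_opR h, spanR_opR h]
      exact Submodule.add_mem_sup ⟨_, rfl⟩ ⟨_, rfl⟩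
    have hxm : x ∈ lineSpan s x ⊔ lineSpan s y :=
      Submodule.mem_sup_left (mem_lineSpan.mpr ⟨1, 0, by module⟩)
    have hym : y ∈ lineSpan s x ⊔ lineSpan s y :=
      Submodule.mem_sup_right (mem_lineSpan.mpr ⟨1, 0, by module⟩)
    have hE : E ∈ lineSpan s x ⊔ lineSpan s y := Submodule.add_mem _ hxm hym
    have hF : F ∈ lineSpan s x ⊔ lineSpan s y := Submodule.add_mem _
      (Submodule.smul_mem _ _ (Submodule.add_mem _ hxm (hsx _ hxm)))
      (Submodule.smul_mem _ _ (Submodule.sub_mem _ hym (hsx _ hym)))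
    exact Submodule.add_mem _ (lineSpan_le hsx hE ⟨_, rfl⟩) (lineSpan_le hsx hF ⟨_, rfl⟩)
  · exact iff_true_intro (isEvenForm_formP_int p (Dvd.intro _ rfl) (Dvd.intro _ rfl) _ _)

end Achieve

section Existence

variable {V : Type} [AddCommGroup V] [Module ℚ V]
variable {B : V →ₗ[ℚ] V →ₗ[ℚ] ℚ} {s : V →ₗ[ℚ] V} {p : ℕ}

theorem self_mem_lineSpan (x : V) : x ∈ lineSpan s x := mem_lineSpan.mpr ⟨1, 0, by module⟩

theorem map_mem_lineSpan (h : IsHerm p B s) {x v : V} (hv : v ∈ lineSpan s x) :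
    s v ∈ lineSpan s x := by
  obtain ⟨a, rfl⟩ := hv
  exact ⟨_, (spanR_opR h x a).symm⟩

theorem map_mem_lineSpan_sup (h : IsHerm p B s) {x y v : V}
    (hv : v ∈ lineSpan s x ⊔ lineSpan s y) : s v ∈ lineSpan s x ⊔ lineSpan s y := by
  obtain ⟨a, ha, b, hb, rfl⟩ := Submodule.mem_sup.mp hv
  rw [map_add]
  exact Submodule.add_mem_sup (map_mem_lineSpan h ha) (map_mem_lineSpan h hb)

theorem exists_odd_or_two_mul_odd (hpos : ∀ x, x ≠ 0 → 0 < B x x) {W : Submodule ℚ V}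
    (hW : W ≠ ⊥) :
    ∃ x ∈ W, ∃ m : ℤ, Odd m ∧ (B x x = m ∨ B x x = 2 * m) := by
  obtain ⟨v, hv, hv0⟩ := W.ne_bot_iff.mp hW
  set r := B v v with hr
  have hr0 : 0 < r := hpos v hv0
  obtain ⟨k, c, hc, h⟩ := exists_two_pow_mul_odd
    (mul_ne_zero (Rat.num_pos.mpr hr0).ne' (Int.natCast_ne_zero.mpr r.den_ne_zero))
  have h1 : (r.den : ℚ) * (r.den * r) = 2 ^ k * c := by
    rw [Rat.den_mul_eq_num, mul_comm]
    exact_mod_cast h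
  rcases Nat.even_or_odd' k with ⟨l, rfl | rfl⟩ <;>
    refine ⟨(1 / 2 ^ l * r.den : ℚ) • v, W.smul_mem _ hv, c, hc, ?_⟩ <;> [left; right] <;>
    simp only [map_smul, LinearMap.smul_apply, smul_eq_mul, ← hr] <;>
    field_simp <;> rw [pow_succ] at * <;> linear_combination h1

theorem finrank_le_inf_ker [FiniteDimensional ℚ V] (W : Submodule ℚ V) (f : V →ₗ[ℚ] ℚ) :
    Module.finrank ℚ W ≤ Module.finrank ℚ ↥(W ⊓ LinearMap.ker f) + 1 := by
  have h1 := Submodule.finrank_sup_add_finrank_inf_eq W (LinearMap.ker f)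
  have h2 := LinearMap.finrank_range_add_finrank_ker f
  have h3 : Module.finrank ℚ (LinearMap.range f) ≤ 1 :=
    (Submodule.finrank_le _).trans_eq (Module.finrank_self ℚ)
  have h4 := Submodule.finrank_le (W ⊔ LinearMap.ker f)
  omega

theorem exists_ortho_complement [FiniteDimensional ℚ V] (h : IsHerm p B s) {W : Submodule ℚ V}
    (hW : ∀ v ∈ W, s v ∈ W) (x : V) : ∃ W' ≤ W, (∀ v ∈ W', s v ∈ W') ∧
      Module.finrank ℚ W ≤ Module.finrank ℚ W' + 2 ∧
      ∀ v ∈ W', B x v = 0 ∧ B (s x) v = 0 := by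
  refine ⟨W ⊓ LinearMap.ker (B x) ⊓ LinearMap.ker (B (s x)), inf_le_left.trans inf_le_left,
    ?_, ?_, fun v hv => ⟨hv.1.2, hv.2⟩⟩
  · rintro v ⟨⟨h1, h2⟩, h3⟩
    refine ⟨⟨hW v h1, ?_⟩, ?_⟩
    · change B x (s v) = 0
      rw [h.skew', neg_eq_zero]
      exact h3
    · change B (s x) (s v) = 0
      rw [h.apply_s_s, show B x v = 0 from h2, mul_zero]
  · have h1 := finrank_le_inf_ker W (B x)
    have h2 := finrank_le_inf_ker (W ⊓ LinearMap.ker (B x)) (B (s x))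
    omega

/-- `x` and `y` in `W` span orthogonal lines and have norms `u` and `v`. -/
structure IsOrthoPair (B : V →ₗ[ℚ] V →ₗ[ℚ] ℚ) (s : V →ₗ[ℚ] V) (W : Submodule ℚ V) (x y : V)
    (u v : ℚ) : Prop where
  left_mem : x ∈ W
  right_mem : y ∈ W
  left_norm : B x x = u
  right_norm : B y y = v
  ortho : B x y = 0
  ortho_op : B (s x) y = 0

theorem IsOrthoPair.symm {W : Submodule ℚ V} {x y : V} {u v : ℚ} (h : IsHerm p B s)
    (hxy : IsOrthoPair B s W x y u v) : IsOrthoPair B s W y x v u :=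
  ⟨hxy.2, hxy.1, hxy.4, hxy.3, by rw [h.symm, hxy.5],
    by rw [h.symm, h.skew', hxy.6, neg_zero]⟩

theorem IsOrthoPair.smul {W : Submodule ℚ V} {x y : V} {u v : ℚ}
    (hxy : IsOrthoPair B s W x y u v) (c d : ℚ) :
    IsOrthoPair B s W (c • x) (d • y) (c ^ 2 * u) (d ^ 2 * v) := by
  refine ⟨W.smul_mem _ hxy.1, W.smul_mem _ hxy.2, ?_, ?_, ?_, ?_⟩
  · simp [hxy.3]; ring
  · simp [hxy.4]; ring
  · simp [hxy.5]
  · simp [hxy.6]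

theorem IsOrthoPair.of_lineSpan (h : IsHerm p B s) {W : Submodule ℚ V} {x y : V} {u v : ℚ}
    (hxy : IsOrthoPair B s W x y u v) (hW : ∀ v ∈ W, s v ∈ W) {x' y' : V} {u' v' : ℚ}
    (hx' : x' ∈ lineSpan s x) (hy' : y' ∈ lineSpan s y) (hu' : B x' x' = u')
    (hv' : B y' y' = v') : IsOrthoPair B s W x' y' u' v' :=
  ⟨lineSpan_le hW hxy.1 hx', lineSpan_le hW hxy.2 hy', hu', hv',
    form_lineSpan h hxy.5 hxy.6 _ hx' _ hy',
    form_lineSpan h hxy.5 hxy.6 _ (map_mem_lineSpan h hx') _ hy'⟩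

theorem IsOrthoPair.exists_add (h : IsHerm p B s) {W : Submodule ℚ V} (hW : ∀ v ∈ W, s v ∈ W)
    {x y : V} {u v : ℚ} (hxy : IsOrthoPair B s W x y u v) {k : ℕ} (hk : k = 1 ∨ k = p) :
    ∃ x' y', IsOrthoPair B s W x' y' (u + k * v) (u * v * (u + k * v)) := by
  obtain ⟨h1, h2, h3, h4, h5, h6⟩ := hxy
  have h7 : B x (s y) = 0 := by rw [h.skew', h6, neg_zero]
  have h8 : B y x = 0 := by rw [h.symm, h5]
  have h9 : B (s y) x = 0 := by rw [h.symm, h7]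
  have h10 : B y (s x) = 0 := by rw [h.symm, h6]
  rcases hk with rfl | rfl
  · refine ⟨x + y, (-v) • x + u • y, W.add_mem h1 h2,
      W.add_mem (W.smul_mem _ h1) (W.smul_mem _ h2), ?_, ?_, ?_, ?_⟩ <;>
    simp [h3, h4, h5, h6, h8, h9, h.apply_self'] <;> ring
  · refine ⟨x + s y, v • s x + u • y, W.add_mem h1 (hW _ h2),
      W.add_mem (W.smul_mem _ (hW _ h1)) (W.smul_mem _ h2), ?_, ?_, ?_, ?_⟩ <;>
    simp [h3, h4, h5, h6, h7, h8, h9, h10, h.apply_self, h.apply_self', h.apply_s_s, h.sq] <;> ring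

theorem exists_add_eq_two_mul_odd (hp4 : p % 4 = 3) {u v : ℤ} (hu : Odd u) (hv : Odd v) :
    ∃ k, (k = 1 ∨ k = p) ∧ ∃ w, Odd w ∧ u + k * v = 2 * w := by
  obtain ⟨u, rfl⟩ := hu
  obtain ⟨v, rfl⟩ := hv
  obtain ⟨r, rfl⟩ : ∃ r : ℕ, p = 4 * r + 3 := ⟨p / 4, by omega⟩
  rcases Int.even_or_odd' (u + v) with ⟨c, hc | hc⟩
  · exact ⟨1, .inl rfl, 2 * c + 1, ⟨c, rfl⟩, by push_cast; linear_combination 2 * hc⟩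
  · refine ⟨_, .inr rfl, 2 * (2 * r * v + r + v + c + 1) + 1, ⟨_, rfl⟩, ?_⟩
    push_cast
    linear_combination 2 * hc

theorem IsOrthoPair.exists_two_mul_odd (h : IsHerm p B s) (hp4 : p % 4 = 3) {W : Submodule ℚ V}
    (hW : ∀ v ∈ W, s v ∈ W) {x y : V} {u v : ℤ} (hu : Odd u) (hv : Odd v)
    (hxy : IsOrthoPair B s W x y u v) :
    ∃ x' y', ∃ u' v' : ℤ, Odd u' ∧ Odd v' ∧ IsOrthoPair B s W x' y' (2 * u') (2 * v') := by
  obtain ⟨k, hk, w, hw, h1⟩ := exists_add_eq_two_mul_odd hp4 hu hv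
  obtain ⟨x', y', h2⟩ := hxy.exists_add h hW hk
  have h1' : (u + k * v : ℚ) = 2 * w := by exact_mod_cast h1
  refine ⟨x', y', w, u * v * w, hw, (hu.mul hv).mul hw, ?_⟩
  convert h2 using 1
  · exact h1'.symm
  · rw [h1']; push_cast; ring

theorem IsOrthoPair.exists_odd (h : IsHerm p B s) (hp4 : p % 4 = 3) {W : Submodule ℚ V}
    (hW : ∀ v ∈ W, s v ∈ W) {x y : V} {u v : ℤ} (hu : Odd u) (hv : Odd v)
    (hxy : IsOrthoPair B s W x y (2 * u) (2 * v)) :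
    ∃ x' y', ∃ u' v' : ℤ, Odd u' ∧ Odd v' ∧ IsOrthoPair B s W x' y' u' v' := by
  obtain ⟨k, hk, w, hw, h1⟩ := exists_add_eq_two_mul_odd hp4 hu hv
  obtain ⟨x', y', h2⟩ := hxy.exists_add h hW hk
  have h1' : (u + k * v : ℚ) = 2 * w := by exact_mod_cast h1
  refine ⟨(1 / 2 : ℚ) • x', (1 / 4 : ℚ) • y', w, u * v * w, hw, (hu.mul hv).mul hw, ?_⟩
  convert h2.smul (1 / 2) (1 / 4) using 1
  · linear_combination (-1 / 2 : ℚ) * h1'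
  · push_cast
    linear_combination (-(u * v) / 2 : ℚ) * h1'

theorem exists_mem_lineSpan_two_mul (h : IsHerm p B s) (hp8 : p % 8 = 7) (x : V) :
    ∃ x' ∈ lineSpan s x, ∃ w : ℤ, Odd w ∧ B x' x' = 2 * w * B x x := by
  obtain ⟨r, rfl⟩ : ∃ r : ℕ, p = 8 * r + 7 := ⟨p / 8, by omega⟩
  rcases Nat.even_or_odd' r with ⟨c, rfl | rfl⟩
  · refine ⟨(1 / 2 : ℚ) • x + (1 / 2 : ℚ) • s x, mem_lineSpan.mpr ⟨_, _, rfl⟩, 2 * c + 1,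
      ⟨c, rfl⟩, ?_⟩
    simp [h.apply_self, h.apply_self', h.apply_s_s]
    ring
  · refine ⟨(3 / 2 : ℚ) • x + (1 / 2 : ℚ) • s x, mem_lineSpan.mpr ⟨_, _, rfl⟩, 2 * (c + 1) + 1,
      ⟨c + 1, rfl⟩, ?_⟩
    simp [h.apply_self, h.apply_self', h.apply_s_s]
    ring

/-- `W` contains an orthogonal pair of vectors of odd norms. -/
def HasOddPair (B : V →ₗ[ℚ] V →ₗ[ℚ] ℚ) (s : V →ₗ[ℚ] V) (W : Submodule ℚ V) : Prop :=
  ∃ (x y : V) (u v : ℤ), Odd u ∧ Odd v ∧ IsOrthoPair B s W x y u v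

theorem hasOddPair_or [FiniteDimensional ℚ V] (h : IsHerm p B s) (hp4 : p % 4 = 3)
    (hpos : ∀ x, x ≠ 0 → 0 < B x x) {W : Submodule ℚ V} (hW : ∀ v ∈ W, s v ∈ W)
    (hr : 4 ≤ Module.finrank ℚ W) : HasOddPair B s W ∨
      Module.finrank ℚ W < 6 ∧ p % 8 = 3 ∧
      ∃ (x y : V) (u v : ℤ), Odd u ∧ Odd v ∧ IsOrthoPair B s W x y u (2 * v) := by
  have hne : ∀ W' : Submodule ℚ V, 1 ≤ Module.finrank ℚ W' → W' ≠ ⊥ := by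
    rintro _ h rfl
    simp at h
  have hmixed : ∀ {x y z : V} {u v w : ℤ}, Odd u → Odd v → Odd w →
      IsOrthoPair B s W x y u (2 * v) → z ∈ W → (B z z = w ∨ B z z = 2 * w) →
      B x z = 0 → B (s x) z = 0 → B y z = 0 → B (s y) z = 0 → HasOddPair B s W := by
    rintro x y z u v w hu hv hw hxy hz (hn | hn) h1 h2 h3 h4
    · exact ⟨x, z, u, w, hu, hw, hxy.1, hz, hxy.3, hn, h1, h2⟩
    · obtain ⟨x', y', u', v', hu', hv', h'⟩ := IsOrthoPair.exists_odd h hp4 hW hv hw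
        ⟨hxy.2, hz, hxy.4, hn, h3, h4⟩
      exact ⟨x', y', u', v', hu', hv', h'⟩
  have hmix : ∀ {x y : V} {u v : ℤ}, Odd u → Odd v → IsOrthoPair B s W x y u (2 * v) →
      HasOddPair B s W ∨ Module.finrank ℚ W < 6 ∧ p % 8 = 3 ∧
      ∃ (x y : V) (u v : ℤ), Odd u ∧ Odd v ∧ IsOrthoPair B s W x y u (2 * v) := by
    intro x y u v hu hv hxy
    by_cases hp8 : p % 8 = 7
    · obtain ⟨y', hy', w, hw, hn⟩ := exists_mem_lineSpan_two_mul h hp8 y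
      rw [hxy.4] at hn
      refine .inl ⟨x, (1 / 2 : ℚ) • y', u, w * v, hu, hw.mul hv, hxy.of_lineSpan h hW
        (self_mem_lineSpan x) ((lineSpan s y).smul_mem _ hy') hxy.3 ?_⟩
      simp [hn]
      ring
    by_cases hr6 : Module.finrank ℚ W < 6
    · exact .inr ⟨hr6, by omega, x, y, u, v, hu, hv, hxy⟩
    obtain ⟨W₁, hW₁, hs₁, hf₁, ho₁⟩ := exists_ortho_complement h hW x
    obtain ⟨W₂, hW₂, hs₂, hf₂, ho₂⟩ := exists_ortho_complement h hs₁ y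
    obtain ⟨z, hz, w, hw, hn⟩ := exists_odd_or_two_mul_odd hpos (hne W₂ (by omega))
    exact .inl (hmixed hu hv hw hxy (hW₁ (hW₂ hz)) hn (ho₁ z (hW₂ hz)).1 (ho₁ z (hW₂ hz)).2
      (ho₂ z hz).1 (ho₂ z hz).2)
  obtain ⟨x, hx, u, hu, hxu⟩ := exists_odd_or_two_mul_odd hpos (hne W (by omega))
  obtain ⟨W₁, hW₁, hs₁, hf₁, ho₁⟩ := exists_ortho_complement h hW x
  obtain ⟨y, hy, v, hv, hyv⟩ := exists_odd_or_two_mul_odd hpos (hne W₁ (by omega))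
  have hxy : IsOrthoPair B s W x y (B x x) (B y y) :=
    ⟨hx, hW₁ hy, rfl, rfl, (ho₁ y hy).1, (ho₁ y hy).2⟩
  rcases hxu with hxu | hxu <;> rcases hyv with hyv | hyv <;> rw [hxu, hyv] at hxy
  · exact .inl ⟨x, y, u, v, hu, hv, hxy⟩
  · exact hmix hu hv hxy
  · exact hmix hv hu (hxy.symm h)
  · obtain ⟨x', y', u', v', hu', hv', h'⟩ := hxy.exists_odd h hp4 hW hu hv
    exact .inl ⟨x', y', u', v', hu', hv', h'⟩

end Existence

section Induction

variable {V : Type} [AddCommGroup V] [Module ℚ V]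
variable {B : V →ₗ[ℚ] V →ₗ[ℚ] ℚ} {s : V →ₗ[ℚ] V} {p : ℕ}

theorem Achieves.congr {W : Submodule ℚ V} {r a r' a' : ℕ} {e e' : Prop}
    (h : Achieves B s W r a e) (hr : r = r') (ha : a = a') (he : e ↔ e') :
    Achieves B s W r' a' e' := by
  subst hr ha
  rwa [← propext he]

theorem IsOrthoPair.achieves {W : Submodule ℚ V} (h : IsHerm p B s) (hW : ∀ v ∈ W, s v ∈ W)
    {x y : V} {u v : ℚ} (hxy : IsOrthoPair B s W x y u v) {r a r' a' : ℕ} {e e' : Prop}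
    (h1 : Achieves B s (lineSpan s x) r a e) (h2 : Achieves B s (lineSpan s y) r' a' e') :
    Achieves B s W (r + r') (a + a') (e ∧ e') :=
  h1.sum h (lineSpan_le hW hxy.1) (lineSpan_le hW hxy.2) (form_lineSpan h hxy.5 hxy.6) h2

/-- The possible types of the sublattices of `W` of rank four. -/
theorem HasOddPair.achieves (h : IsHerm p B s) (hp4 : p % 4 = 3) {W : Submodule ℚ V}
    (hW : ∀ v ∈ W, s v ∈ W) (hP : HasOddPair B s W) :
    Achieves B s W 4 0 True ∧ Achieves B s W 4 2 True ∧ Achieves B s W 4 2 False ∧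
      (p % 8 = 7 → Achieves B s W 4 1 False) := by
  have hp : p % 2 = 1 := by omega
  obtain ⟨x, y, u, v, hu, hv, hxy⟩ := hP
  refine ⟨?_, ?_, ?_, fun hp8 => ?_⟩
  · obtain ⟨x', y', u', v', hu', hv', h'⟩ := hxy.exists_two_mul_odd h hp4 hW hu hv
    exact (h'.achieves h hW (achieves_even h hp4 hu' h'.3) (achieves_even h hp4 hv' h'.4)).congr
      rfl rfl (by simp)
  · exact (achieves_pair h hp4 hu hv hxy.3 hxy.4 hxy.5 hxy.6).mono
      (sup_le (lineSpan_le hW hxy.1) (lineSpan_le hW hxy.2))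
  · exact (hxy.achieves h hW (achieves_odd h hp hu hxy.3) (achieves_odd h hp hv hxy.4)).congr
      rfl rfl (by simp)
  · obtain ⟨y', hy', w, hw, hn⟩ := exists_mem_lineSpan_two_mul h hp8 y
    rw [hxy.4] at hn
    have h' : IsOrthoPair B s W x y' u (2 * (w * v : ℤ)) :=
      hxy.of_lineSpan h hW (self_mem_lineSpan x) hy' hxy.3 (by rw [hn]; push_cast; ring)
    exact (h'.achieves h hW (achieves_odd h hp hu h'.3)
      (achieves_even h hp4 (hw.mul hv) h'.4)).congr rfl rfl (by simp)

theorem HasOddPair.exists_complement [FiniteDimensional ℚ V] (h : IsHerm p B s)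
    {W : Submodule ℚ V} (hW : ∀ v ∈ W, s v ∈ W) (hP : HasOddPair B s W) :
    ∃ W₁ ≤ W, ∃ W₂ ≤ W, (∀ v ∈ W₁, s v ∈ W₁) ∧ (∀ v ∈ W₂, s v ∈ W₂) ∧
      (∀ v ∈ W₁, ∀ w ∈ W₂, B v w = 0) ∧ HasOddPair B s W₁ ∧
      Module.finrank ℚ W ≤ Module.finrank ℚ W₂ + 4 := by
  obtain ⟨x, y, u, v, hu, hv, hxy⟩ := hP
  obtain ⟨W', hW', hs', hf', ho'⟩ := exists_ortho_complement h hW x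
  obtain ⟨W₂, hW₂, hs₂, hf₂, ho₂⟩ := exists_ortho_complement h hs' y
  refine ⟨lineSpan s x ⊔ lineSpan s y, sup_le (lineSpan_le hW hxy.1) (lineSpan_le hW hxy.2),
    W₂, hW₂.trans hW', fun _ => map_mem_lineSpan_sup h, hs₂, ?_, ?_, by omega⟩
  · intro a ha w hw
    obtain ⟨b, hb, c, hc, rfl⟩ := Submodule.mem_sup.mp ha
    rw [map_add, LinearMap.add_apply,
      form_lineSpan h (ho' w (hW₂ hw)).1 (ho' w (hW₂ hw)).2 b hb w (self_mem_lineSpan w),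
      form_lineSpan h (ho₂ w hw).1 (ho₂ w hw).2 c hc w (self_mem_lineSpan w), add_zero]
  · exact ⟨x, y, u, v, hu, hv, Submodule.mem_sup_left (self_mem_lineSpan x),
      Submodule.mem_sup_right (self_mem_lineSpan y), hxy.3, hxy.4, hxy.5, hxy.6⟩

theorem achieves_or [FiniteDimensional ℚ V] (h : IsHerm p B s) (hp4 : p % 4 = 3)
    (hpos : ∀ x, x ≠ 0 → 0 < B x x) (n : ℕ) : ∀ W : Submodule ℚ V, (∀ v ∈ W, s v ∈ W) →
      4 * n ≤ Module.finrank ℚ W →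
      ((∀ i ≤ n, Achieves B s W (4 * n) (2 * i) True) ∧
        (∀ i < n, Achieves B s W (4 * n) (2 * (i + 1)) False) ∧
        (p % 8 = 7 → ∀ i < n, Achieves B s W (4 * n) (2 * i + 1) False)) ∨
      (p % 8 = 3 ∧ 1 ≤ n ∧ ∀ i < n, Achieves B s W (4 * n) (2 * i + 1) False) := by
  induction n with
  | zero =>
    intro W _ _
    refine .inl ⟨fun i hi => ?_, by simp, by simp⟩
    obtain rfl : i = 0 := by omega
    exact Achieves.zero W
  | succ n ih =>
    intro W hW hr
    rcases hasOddPair_or h hp4 hpos hW (by omega) with hP | ⟨h6, hp8, x, y, u, v, hu, hv, hxy⟩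
    · obtain ⟨W₁, hW₁, W₂, hW₂, hs₁, hs₂, ho, hP₁, hf⟩ := hP.exists_complement h hW
      obtain ⟨a0, a2, b2, b1⟩ := hP₁.achieves h hp4 hs₁
      rcases ih W₂ hs₂ (by omega) with ⟨h1, -, -⟩ | ⟨hp8, hn, h1⟩
      · refine .inl ⟨fun i hi => ?_, fun i hi => ?_, fun hp8 i hi => ?_⟩
        · rcases Nat.lt_or_ge n i with hi' | hi'
          · exact (a2.sum h hW₁ hW₂ ho (h1 n le_rfl)).congr (by ring) (by omega) (by simp)
          · exact (a0.sum h hW₁ hW₂ ho (h1 i hi')).congr (by ring) (by omega) (by simp)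
        · exact (b2.sum h hW₁ hW₂ ho (h1 i (by omega))).congr (by ring) (by omega) (by simp)
        · exact ((b1 hp8).sum h hW₁ hW₂ ho (h1 i (by omega))).congr (by ring) (by omega) (by simp)
      · refine .inr ⟨hp8, by omega, fun i hi => ?_⟩
        rcases Nat.lt_or_ge i n with hi' | hi'
        · exact (a0.sum h hW₁ hW₂ ho (h1 i hi')).congr (by ring) (by omega) (by simp)
        · exact (b2.sum h hW₁ hW₂ ho (h1 (n - 1) (by omega))).congr (by ring) (by omega) (by simp)
    · obtain rfl : n = 0 := by omega
      refine .inr ⟨hp8, by omega, fun i hi => ?_⟩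
      obtain rfl : i = 0 := by omega
      exact (hxy.achieves h hW (achieves_odd h (by omega) hu hxy.3)
        (achieves_even h hp4 hv hxy.4)).congr rfl rfl (by simp)

theorem eq_zero_of_two_pow_dvd {N : Type} [AddCommGroup N] [Module.Free ℤ N] {x : N}
    (h : ∀ m : ℕ, ∃ w, x = (2 ^ m : ℤ) • w) : x = 0 := by
  let b := Module.Free.chooseBasis ℤ N
  refine b.ext_elem fun i => ?_
  rw [map_zero, Finsupp.zero_apply]
  by_contra hne
  obtain ⟨m, c, hc, hm⟩ := exists_two_pow_mul_odd hne
  obtain ⟨w, hw⟩ := h (m + 1)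
  have h1 : b.repr x i = 2 ^ (m + 1) * b.repr w i := by
    conv_lhs => rw [hw]
    simp
  rw [hm, pow_succ, mul_assoc, mul_right_inj' (pow_ne_zero m two_ne_zero)] at h1
  rw [h1] at hc
  exact absurd hc (by simp)

theorem Achieves.exists_lattice [FiniteDimensional ℚ V] {L : Submodule ℤ V}
    (hL : IsUnimodLat B s L) {a : ℕ} {e : Prop}
    (H : Achieves B s ⊤ (Module.finrank ℚ V) a e) :
    ∃ L', IsUnimodLat B s L' ∧ HasType B s L' a e := by
  obtain ⟨N, _, _, _, b, t, j, f1, f2, f3, -, f5, f6, f7⟩ := H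
  have hj : Function.Injective j := by
    refine (injective_iff_map_eq_zero j).mpr fun x hx => eq_zero_of_two_pow_dvd fun m => ?_
    refine f3.pow two_ne_zero m x fun y => ?_
    have : (b x y : ℚ) = 0 := by rw [f1, hx, map_zero, LinearMap.zero_apply]
    rw [Int.cast_eq_zero.mp this]
    exact dvd_zero _
  refine exists_glue hL ⟨hj, f1, f2⟩ f3 ?_ f6 f7
  let U := Submodule.span ℚ (Set.range j)
  let j' : N →ₗ[ℤ] U := j.codRestrict (U.restrictScalars ℤ) fun x => Submodule.subset_span ⟨x, rfl⟩
  have h1 : Module.finrank ℤ N = Module.finrank ℚ U := by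
    refine finrank_of_span (j := j') (fun x y h => hj (congrArg Subtype.val h)) ?_
    refine Submodule.map_injective_of_injective U.injective_subtype ?_
    rw [Submodule.map_span, ← Set.range_comp, Submodule.map_top, Submodule.range_subtype]
    rfl
  exact Submodule.eq_top_of_finrank_eq (h1.symm.trans f5)

end Induction

section Count

variable {K : Type} [Field K] [Algebra ℚ K] {sp : K} {p : ℕ}
variable {V : Type} [AddCommGroup V] [Module ℚ V] [Module K V] [IsScalarTower ℚ K V]
variable {φ : V →ₗ[ℚ] V →ₗ[ℚ] K} {B : V →ₗ[ℚ] V →ₗ[ℚ] ℚ} {s : V →ₗ[ℚ] V}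

theorem HasType.even_iff (hp : p.Prime) (hp8 : p % 8 = 3) (h : IsHerm p B s)
    (hpos : ∀ x, x ≠ 0 → 0 < B x x) {L : Submodule ℤ V} (hL : IsUnimodLat B s L) {a : ℕ}
    {e : Prop} (ht : HasType B s L a e) {k : ℕ} (hk : Module.finrank ℚ V = 4 * k) :
    Even a ↔ Even k := by
  obtain ⟨b, t, hj, ha, -⟩ := ht
  obtain ⟨_, _⟩ := finite_free_of_fg hL.fg
  obtain ⟨k', h1, h2⟩ := even_halfIndex_iff hp hp8 (hj.isHerm h) (fun x hx => by
      have h3 := hpos _ ((map_ne_zero_iff _ hj.injective).mpr hx)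
      rw [← hj.form] at h3
      exact_mod_cast h3)
    (fun l hl => hL.unimodAt hj (by exact_mod_cast hl.ne_zero)) ha
  rwa [show k = k' by rw [hL.finrank_eq] at h1; omega]

/-- If the types of the lattices are exactly the pairs `(f i, g i)` with `i < N`, and these are
distinct, then there are exactly `N` genera. -/
theorem hasExactlyGenera_of_types [FiniteDimensional ℚ V]
    (hp : p.Prime) (hp4 : p % 4 = 3) (hK2 : Module.finrank ℚ K = 2) (hsp : sp ^ 2 = -(p : K))
    (hR : IsRealization sp φ p B s) (h : IsHerm p B s) {N : ℕ} (f : ℕ → ℕ) (g : ℕ → Prop)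
    (hinj : ∀ i < N, ∀ j < N, f i = f j → (g i ↔ g j) → i = j)
    (hreal : ∀ i < N, ∃ L, IsUnimodLat B s L ∧ HasType B s L (f i) (g i))
    (hall : ∀ L a e, IsUnimodLat B s L → HasType B s L a e → 2 * a ≤ Module.finrank ℚ V →
      (e → Even a) → (a = 0 → e) → ∃ i < N, f i = a ∧ (g i ↔ e)) :
    HasExactlyGenera K sp V φ N := by
  choose! Ls hLs ht using hreal
  refine ⟨fun i => Ls i, fun i => (isModularRLat_iff hp hK2 hsp hR h _).mpr (hLs i i.2),
    fun i j hij hG => hij ?_, fun L hL => ?_⟩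
  · obtain ⟨h1, h2⟩ := (HasType.sameGenus_iff hp hp4 hK2 hsp hR h (hLs i i.2) (hLs j j.2)
      (ht i i.2) (ht j j.2)).mp hG
    exact Fin.ext (hinj i i.2 j j.2 h1 h2)
  · rw [isModularRLat_iff hp hK2 hsp hR h] at hL
    obtain ⟨a, e, hae, h1, h2, h3⟩ := hL.exists_hasType hp4 h
    obtain ⟨i, hi, h4⟩ := hall L a e hL hae h1 h2 h3
    exact ⟨⟨i, hi⟩, (HasType.sameGenus_iff hp hp4 hK2 hsp hR h (hLs i hi) hL (ht i hi) hae).mpr h4⟩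

/-- The possible types of the lattices in a space of dimension `4 * k`. -/
theorem exists_lattices [FiniteDimensional ℚ V] (h : IsHerm p B s) (hp4 : p % 4 = 3)
    (hpos : ∀ x, x ≠ 0 → 0 < B x x) {L : Submodule ℤ V} (hL : IsUnimodLat B s L) {k : ℕ}
    (hk : Module.finrank ℚ V = 4 * k) :
    ((∀ i ≤ k, ∃ L, IsUnimodLat B s L ∧ HasType B s L (2 * i) True) ∧
      (∀ i < k, ∃ L, IsUnimodLat B s L ∧ HasType B s L (2 * (i + 1)) False) ∧
      (p % 8 = 7 → ∀ i < k, ∃ L, IsUnimodLat B s L ∧ HasType B s L (2 * i + 1) False)) ∨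
    (p % 8 = 3 ∧ 1 ≤ k ∧ ∀ i < k, ∃ L, IsUnimodLat B s L ∧ HasType B s L (2 * i + 1) False) := by
  have H := achieves_or h hp4 hpos k ⊤ (fun _ _ => trivial) (by rw [finrank_top, hk])
  rw [← hk] at H
  exact H.imp (fun H => ⟨fun i hi => (H.1 i hi).exists_lattice hL,
    fun i hi => (H.2.1 i hi).exists_lattice hL,
    fun hp8 i hi => (H.2.2 hp8 i hi).exists_lattice hL⟩)
    fun H => ⟨H.1, H.2.1, fun i hi => (H.2.2 i hi).exists_lattice hL⟩

theorem hasExactlyGenera_seven [FiniteDimensional ℚ V]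
    (hp : p.Prime) (hp8 : p % 8 = 7) (hK2 : Module.finrank ℚ K = 2) (hsp : sp ^ 2 = -(p : K))
    (hR : IsRealization sp φ p B s) (h : IsHerm p B s) (hpos : ∀ x, x ≠ 0 → 0 < B x x)
    {L : Submodule ℤ V} (hL : IsUnimodLat B s L) {k : ℕ} (hk : Module.finrank ℚ V = 4 * k) :
    HasExactlyGenera K sp V φ (3 * k + 1) := by
  rcases exists_lattices h (by omega) hpos hL hk with ⟨h1, h2, h3⟩ | ⟨h8, -⟩
  · refine hasExactlyGenera_of_types hp (by omega) hK2 hsp hR h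
      (fun i => if i ≤ k then 2 * i else i - k) (· ≤ k) (fun i hi j hj hij hg => ?_)
      (fun i hi => ?_) fun L a e _ _ ha he h0 => ?_
    · split_ifs at hij <;> omega
    · by_cases hik : i ≤ k
      · simpa [hik] using h1 i hik
      · obtain ⟨m, hm | hm⟩ := Nat.even_or_odd' (i - k)
        · obtain ⟨L', h4, h5⟩ := h2 (m - 1) (by omega)
          refine ⟨L', h4, ?_⟩
          simpa [hik, hm, show m - 1 + 1 = m by omega] using h5
        · simpa [hik, hm] using h3 hp8 m (by omega)
    · by_cases he' : e
      · obtain ⟨m, rfl⟩ := he he'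
        have hm : m ≤ k := by omega
        exact ⟨m, by omega, by simp [hm, two_mul], by simp [he', hm]⟩
      · have ha0 : a ≠ 0 := fun h => he' (h0 h)
        exact ⟨k + a, by omega, by simp [ha0], by simp [he', ha0]⟩
  · omega

theorem hasExactlyGenera_three_even [FiniteDimensional ℚ V]
    (hp : p.Prime) (hp8 : p % 8 = 3) (hK2 : Module.finrank ℚ K = 2) (hsp : sp ^ 2 = -(p : K))
    (hR : IsRealization sp φ p B s) (h : IsHerm p B s) (hpos : ∀ x, x ≠ 0 → 0 < B x x)
    {L : Submodule ℤ V} (hL : IsUnimodLat B s L) {k : ℕ} (hk : Module.finrank ℚ V = 4 * k)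
    (hk2 : Even k) : HasExactlyGenera K sp V φ (2 * k + 1) := by
  rcases exists_lattices h (by omega) hpos hL hk with ⟨h1, h2, -⟩ | ⟨-, h3, h4⟩
  · refine hasExactlyGenera_of_types hp (by omega) hK2 hsp hR h
      (fun i => if i ≤ k then 2 * i else 2 * (i - k)) (· ≤ k) (fun i hi j hj hij hg => ?_)
      (fun i hi => ?_) fun L a e hL' ht ha _ h0 => ?_
    · split_ifs at hij <;> omega
    · by_cases hik : i ≤ k
      · simpa [hik] using h1 i hik
      · obtain ⟨L', h4, h5⟩ := h2 (i - k - 1) (by omega)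
        refine ⟨L', h4, ?_⟩
        simpa [hik, show i - k - 1 + 1 = i - k by omega] using h5
    · obtain ⟨m, rfl⟩ := (ht.even_iff hp hp8 h hpos hL' hk).mpr hk2
      by_cases he' : e
      · have hm : m ≤ k := by omega
        exact ⟨m, by omega, by simp [hm, two_mul], by simp [he', hm]⟩
      · have hm0 : m ≠ 0 := fun h => he' (h0 (by omega))
        exact ⟨k + m, by omega, by simp [hm0, two_mul], by simp [he', hm0]⟩
  · obtain ⟨L', hL', ht⟩ := h4 0 (by omega)
    simpa using (ht.even_iff hp hp8 h hpos hL' hk).mpr hk2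

theorem hasExactlyGenera_three_odd [FiniteDimensional ℚ V]
    (hp : p.Prime) (hp8 : p % 8 = 3) (hK2 : Module.finrank ℚ K = 2) (hsp : sp ^ 2 = -(p : K))
    (hR : IsRealization sp φ p B s) (h : IsHerm p B s) (hpos : ∀ x, x ≠ 0 → 0 < B x x)
    {L : Submodule ℤ V} (hL : IsUnimodLat B s L) {k : ℕ} (hk : Module.finrank ℚ V = 4 * k)
    (hk2 : ¬ Even k) : HasExactlyGenera K sp V φ k := by
  rcases exists_lattices h (by omega) hpos hL hk with ⟨h1, -⟩ | ⟨-, -, h1⟩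
  · obtain ⟨L', hL', ht⟩ := h1 0 (by omega)
    exact absurd ((ht.even_iff hp hp8 h hpos hL' hk).mp (by simp)) hk2
  · refine hasExactlyGenera_of_types hp (by omega) hK2 hsp hR h (fun i => 2 * i + 1)
      (fun _ => False) (fun i hi j hj hij _ => by omega) h1 fun L a e hL' ht ha he _ => ?_
    have hodd := mt (ht.even_iff hp hp8 h hpos hL' hk).mp hk2
    obtain ⟨m, rfl⟩ := Nat.not_even_iff_odd.mp hodd
    exact ⟨m, by omega, rfl, by tauto⟩

end Count

end SqrtForm

theorem stmt14
    (p : ℕ) (hp : p.Prime) (hp4 : p % 4 = 3)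
    (K : Type) [Field K] [Algebra ℚ K]
    (hK2 : Module.finrank ℚ K = 2)
    (sp : K) (hsp : sp ^ 2 = -(p : K))
    (σ : K →ₐ[ℚ] K) (hσ : σ sp = -sp)
    (V : Type) [AddCommGroup V] [Module ℚ V] [Module K V] [IsScalarTower ℚ K V]
    [FiniteDimensional K V]
    (n : ℕ) (hn : Module.finrank K V = n)
    (φ : V →ₗ[ℚ] V →ₗ[ℚ] K)
    (hlin : ∀ (a : K) (x y : V), φ (a • x) y = a * φ x y)
    (hherm : ∀ x y : V, φ y x = σ (φ x y))
    (hpos : ∀ x : V, x ≠ 0 → ∃ q : ℚ, 0 < q ∧ φ x x = algebraMap ℚ K q)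
    -- (V, φ) admits a √-p-modular R-lattice
    (hex : ∃ L : Submodule ℤ V, IsModularRLat K sp V φ L) :
    -- two √-p-modular R-lattices lie in the same genus iff their 2-adic completions
    -- are isometric hermitian R⊗ℤ₂-lattices,
    (∀ L L' : Submodule ℤ V, IsModularRLat K sp V φ L → IsModularRLat K sp V φ L' →
      (SameGenus K V φ L L' ↔ SameGenusAt K V φ 2 L L')) ∧
    -- and the number of genera is 3n/2+1, n+1, n/2 in cases (a), (b), (c) resp.
    (p % 8 = 7 ∧ 4 ∣ n → HasExactlyGenera K sp V φ (3 * (n / 2) + 1)) ∧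
    (p % 8 = 3 ∧ 4 ∣ n → HasExactlyGenera K sp V φ (n + 1)) ∧
    (p % 8 = 3 ∧ n % 4 = 2 → HasExactlyGenera K sp V φ (n / 2)) := by
  have : FiniteDimensional ℚ K := Module.finite_of_finrank_pos (by omega)
  have : FiniteDimensional ℚ V := Module.Finite.trans K V
  have hdim : Module.finrank ℚ V = 2 * n := by
    rw [← Module.finrank_mul_finrank ℚ K V, hK2, hn]
  obtain ⟨B, s, hR, h, hB⟩ :=
    SqrtForm.exists_realization hp hK2 hsp σ hσ hlin hherm hpos
  have hiff := SqrtForm.isModularRLat_iff hp hK2 hsp hR h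
  obtain ⟨L₀, hL₀⟩ := hex
  rw [hiff] at hL₀
  refine ⟨fun L L' hL hL' => SqrtForm.sameGenus_iff_sameGenusAt_two hp hp4 hK2 hsp hR h
    ((hiff L).mp hL) ((hiff L').mp hL'), fun ⟨hp8, hn4⟩ => ?_, fun ⟨hp8, hn4⟩ => ?_,
    fun ⟨hp8, hn4⟩ => ?_⟩
  · exact SqrtForm.hasExactlyGenera_seven hp hp8 hK2 hsp hR h hB hL₀ (by omega)
  · have := SqrtForm.hasExactlyGenera_three_even hp hp8 hK2 hsp hR h hB hL₀ (k := n / 2)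
      (by omega) (by rw [Nat.even_iff]; omega)
    rwa [show 2 * (n / 2) + 1 = n + 1 by omega] at this
  · exact SqrtForm.hasExactlyGenera_three_odd hp hp8 hK2 hsp hR h hB hL₀ (by omega)
      (by rw [Nat.even_iff]; omega)
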